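/- arXiv:2508.00125 — 2 statements merged into one kernel-verified Lean document; each statement's English description precedes it below -/
import Mathlib

section
/- Let A and B be separable C*-algebras such that A homotopy dominates B (in particular this holds if A and B are homotopy equivalent). Let D be a C*-algebra with closed two-sided ideal I. If every *-homomorphism from A to D/I lifts to a (discrete) asymptotic homomorphism from A to D, then every *-homomorphism from B to D/I lifts to a (discrete) asymptotic homomorphism from B to D. -/
open Filter Topology

noncomputable section

/-- A (continuous) asymptotic homomorphism between C*-algebras, indexed by `ℝ≥0 = [0,∞)`. -/
def IsAsymptoticHom {A B : Type*} [NonUnitalCStarAlgebra A] [NonUnitalCStarAlgebra B]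
    (f : NNReal → A → B) : Prop :=
  (∀ a : A, Continuous fun t => f t a) ∧
  (∀ a b : A, Tendsto (fun t => ‖f t (a * b) - f t a * f t b‖) atTop (𝓝 0)) ∧
  (∀ (μ₁ μ₂ : ℂ) (a b : A),
    Tendsto (fun t => ‖f t (μ₁ • a + μ₂ • b) - (μ₁ • f t a + μ₂ • f t b)‖) atTop (𝓝 0)) ∧
  (∀ a : A, Tendsto (fun t => ‖f t (star a) - star (f t a)‖) atTop (𝓝 0))

/-- A discrete asymptotic homomorphism between C*-algebras, indexed by `ℕ`. -/
def IsDiscreteAsymptoticHom {A B : Type*} [NonUnitalCStarAlgebra A] [NonUnitalCStarAlgebra B]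
    (f : ℕ → A → B) : Prop :=
  (∀ a b : A, Tendsto (fun n => ‖f n (a * b) - f n a * f n b‖) atTop (𝓝 0)) ∧
  (∀ (μ₁ μ₂ : ℂ) (a b : A),
    Tendsto (fun n => ‖f n (μ₁ • a + μ₂ • b) - (μ₁ • f n a + μ₂ • f n b)‖) atTop (𝓝 0)) ∧
  (∀ a : A, Tendsto (fun n => ‖f n (star a) - star (f n a)‖) atTop (𝓝 0)) ∧
  (∀ a : A, ∃ C : ℝ, ∀ n, ‖f n a‖ ≤ C)

/-- Two ∗-homomorphisms `φ, ψ : B → A` are homotopic:  there is a ∗-homomorphism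
`Φ : B → C([0,1], A)` with `ev₀ ∘ Φ = ψ` and `ev₁ ∘ Φ = φ`. -/
def AreHomotopic {B A : Type*} [NonUnitalCStarAlgebra A] [NonUnitalCStarAlgebra B]
    (φ ψ : B →⋆ₙₐ[ℂ] A) : Prop :=
  ∃ Φ : B →⋆ₙₐ[ℂ] C(unitInterval, A), (∀ b, Φ b 0 = ψ b) ∧ (∀ b, Φ b 1 = φ b)

section CStarAlgebra

variable {D : Type*} [CStarAlgebra D]

lemma CStarAlgebra.norm_sq_le_norm_star_mul_self_add (x y : D) :
    ‖x‖ ^ 2 ≤ ‖star x * x + star y * y‖ := by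
  let := CStarAlgebra.spectralOrder D
  let := CStarAlgebra.spectralOrderedRing D
  rw [sq, ← CStarRing.norm_star_mul_self]
  exact CStarAlgebra.norm_le_norm_of_nonneg_of_le (star_mul_self_nonneg x)
    (le_add_of_nonneg_right (star_mul_self_nonneg y))

lemma norm_le_one_of_mul_self_add_mul_self_eq_one {s c : D} (hs : star s = s) (hc : star c = c)
    (h : s * s + c * c = 1) : ‖s‖ ≤ 1 := by
  have h1 := CStarAlgebra.norm_sq_le_norm_star_mul_self_add s c
  rw [hs, hc, h] at h1
  have h2 : ‖(1 : D)‖ ≤ 1 := by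
    rcases subsingleton_or_nontrivial D with hD | hD
    · rw [Subsingleton.elim (1 : D) 0, norm_zero]; exact zero_le_one
    · exact CStarRing.norm_one.le
  nlinarith [norm_nonneg s]

lemma CStarAlgebra.norm_conj_add_conj_le {s c : D} (hs : star s = s) (hc : star c = c)
    (hsc : s * c = c * s) (h : s * s + c * c = 1) (X Y : D) :
    ‖s * X * s + c * Y * c‖ ≤ max ‖X‖ ‖Y‖ := by
  let := CStarAlgebra.spectralOrder D
  let := CStarAlgebra.spectralOrderedRing D
  set M := max ‖X‖ ‖Y‖
  have hM : 0 ≤ M := (norm_nonneg X).trans (le_max_left _ _)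
  set Z := s * X * s + c * Y * c with hZ
  set W := c * X * s - s * Y * c with hW
  have key : star Z * Z + star W * W = s * (star X * X) * s + c * (star Y * Y) * c := by
    have e : star Z * Z + star W * W = s * star X * (s * s + c * c) * X * s
        + c * star Y * (s * s + c * c) * Y * c + s * star X * (s * c - c * s) * Y * c
        + c * star Y * (c * s - s * c) * X * s := by
      simp only [hZ, hW, star_add, star_sub, star_mul, hs, hc]
      noncomm_ring
    rw [e, h, hsc]
    simp only [sub_self, mul_zero, zero_mul, mul_one, add_zero, mul_assoc]
  have bound (V : D) (hV : ‖V‖ ≤ M) (d : D) (hd : star d = d) :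
      d * (star V * V) * d ≤ (M ^ 2 : ℝ) • (d * d) := by
    have h1 : star V * V ≤ algebraMap ℝ D (M ^ 2) := by
      refine (CStarAlgebra.star_mul_le_algebraMap_norm_sq).trans ?_
      gcongr
    have h2 := star_left_conjugate_le_conjugate h1 d
    rw [hd] at h2
    refine h2.trans (le_of_eq ?_)
    rw [Algebra.algebraMap_eq_smul_one]; simp
  have hle : star Z * Z ≤ algebraMap ℝ D (M ^ 2) := by
    calc star Z * Z ≤ star Z * Z + star W * W := le_add_of_nonneg_right (star_mul_self_nonneg W)
      _ = _ := key
      _ ≤ (M ^ 2 : ℝ) • (s * s) + (M ^ 2 : ℝ) • (c * c) :=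
        add_le_add (bound X (le_max_left _ _) s hs) (bound Y (le_max_right _ _) c hc)
      _ = _ := by rw [← smul_add, h, Algebra.algebraMap_eq_smul_one]
  have h3 := (CStarAlgebra.norm_le_iff_le_algebraMap (star Z * Z) (by positivity)
    (star_mul_self_nonneg Z)).2 hle
  rw [CStarRing.norm_star_mul_self, ← sq] at h3
  exact (sq_le_sq₀ (norm_nonneg _) hM).1 h3

lemma IsSelfAdjoint.isUnit_one_add_mul_self {w : D} (hw : IsSelfAdjoint w) :
    IsUnit (1 + w * w) := by
  have h (z : ℂ) (hz : z.im ≠ 0) : IsUnit (algebraMap ℂ D z - w) := by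
    by_contra hn
    have := hw.mem_spectrum_eq_re (a := w) (z := z) hn
    apply hz
    rw [this]; simp
  have h1 := (h Complex.I (by simp)).mul (h (-Complex.I) (by simp))
  have h2 : (algebraMap ℂ D Complex.I - w) * (algebraMap ℂ D (-Complex.I) - w) = 1 + w * w := by
    rw [sub_mul, mul_sub, mul_sub, ← map_mul, ← Algebra.commutes]
    simp
    abel
  rwa [h2] at h1

/-- For `w` close to a unit on an element of an ideal, `cayleyCos w` almost annihilates it. -/
def cayleyCos (w : D) : D := 2 * Ring.inverse (1 + w * w) - 1

/-- The companion of `cayleyCos`. -/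
def cayleySin (w : D) : D := 2 * (w * Ring.inverse (1 + w * w))

lemma cayley_relations {w : D} (hw : star w = w) :
    star (cayleyCos w) = cayleyCos w ∧ star (cayleySin w) = cayleySin w ∧
    cayleySin w * cayleyCos w = cayleyCos w * cayleySin w ∧
    cayleySin w * cayleySin w + cayleyCos w * cayleyCos w = 1 := by
  have hu : IsUnit (1 + w * w) := IsSelfAdjoint.isUnit_one_add_mul_self hw
  set r := Ring.inverse (1 + w * w) with hr
  have h1 : r * (1 + w * w) = 1 := Ring.inverse_mul_cancel _ hu
  have h2 : (1 + w * w) * r = 1 := Ring.mul_inverse_cancel _ hu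
  have hwr : w * r = r * w := by
    have hc : Commute w (1 + w * w) :=
      (Commute.one_right w).add_right ((Commute.refl w).mul_right (Commute.refl w))
    calc w * r = r * (1 + w * w) * (w * r) := by rw [h1, one_mul]
      _ = r * ((1 + w * w) * w) * r := by noncomm_ring
      _ = r * (w * (1 + w * w)) * r := by rw [hc.eq]
      _ = r * w * ((1 + w * w) * r) := by noncomm_ring
      _ = r * w := by rw [h2, mul_one]
  have hrs : star r = r := by
    have h3 : star r * (1 + w * w) = 1 := by
      have := congrArg star h2
      simpa [hw] using this
    calc star r = star r * ((1 + w * w) * r) := by rw [h2, mul_one]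
      _ = r := by rw [← mul_assoc, h3, one_mul]
  have hc : cayleyCos w = 2 * r - 1 := rfl
  have hs : cayleySin w = 2 * (w * r) := rfl
  have hwwr : w * w * r = 1 - r := by
    rw [add_mul, one_mul] at h2
    exact eq_sub_of_add_eq' h2
  refine ⟨?_, ?_, ?_, ?_⟩
  · rw [hc, star_sub, star_mul, hrs, star_one, star_ofNat]; noncomm_ring
  · rw [hs, star_mul, star_mul, hrs, hw, ← hwr, star_ofNat]; noncomm_ring
  · have : w * r * r = r * (w * r) := by rw [hwr, mul_assoc, hwr]
    rw [hc, hs]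
    calc 2 * (w * r) * (2 * r - 1) = 4 * (w * r * r) - 2 * (w * r) := by noncomm_ring
      _ = 4 * (r * (w * r)) - 2 * (w * r) := by rw [this]
      _ = _ := by noncomm_ring
  · have : w * r * (w * r) = (1 - r) * r := by
      rw [← hwwr]
      calc w * r * (w * r) = w * (r * w) * r := by noncomm_ring
        _ = _ := by rw [← hwr]; noncomm_ring
    rw [hc, hs]
    calc 2 * (w * r) * (2 * (w * r)) + (2 * r - 1) * (2 * r - 1)
        = 4 * (w * r * (w * r)) + 4 * (r * r) - 4 * r + 1 := by noncomm_ring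
      _ = 1 := by rw [this]; noncomm_ring

lemma norm_cayleyCos_le {w : D} (hw : star w = w) : ‖cayleyCos w‖ ≤ 1 := by
  obtain ⟨hc, hs, -, h⟩ := cayley_relations hw
  exact norm_le_one_of_mul_self_add_mul_self_eq_one hc hs (by rw [add_comm, h])

lemma norm_cayleySin_le {w : D} (hw : star w = w) : ‖cayleySin w‖ ≤ 1 := by
  obtain ⟨hc, hs, -, h⟩ := cayley_relations hw
  exact norm_le_one_of_mul_self_add_mul_self_eq_one hs hc h

lemma norm_inverse_one_add_mul_self_le {w : D} (hw : star w = w) :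
    ‖Ring.inverse (1 + w * w)‖ ≤ 1 := by
  have h1 := norm_cayleyCos_le hw
  have h2 : ‖(1 : D)‖ ≤ 1 := by
    rcases subsingleton_or_nontrivial D with hD | hD
    · rw [Subsingleton.elim (1 : D) 0, norm_zero]; exact zero_le_one
    · exact CStarRing.norm_one.le
  have h3 : Ring.inverse (1 + w * w) = (1 / 2 : ℝ) • (cayleyCos w + 1) := by
    rw [cayleyCos, sub_add_cancel, two_mul, ← two_smul ℝ, smul_smul]
    norm_num
  rw [h3, norm_smul]
  have := norm_add_le (cayleyCos w) 1
  norm_num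
  linarith

lemma norm_inverse_commutator_le {w : D} (hw : star w = w) (hw1 : ‖w‖ ≤ 1) (d : D) :
    ‖Ring.inverse (1 + w * w) * d - d * Ring.inverse (1 + w * w)‖ ≤ 2 * ‖w * d - d * w‖ := by
  have hu : IsUnit (1 + w * w) := IsSelfAdjoint.isUnit_one_add_mul_self hw
  have hr1 := norm_inverse_one_add_mul_self_le hw
  set r := Ring.inverse (1 + w * w) with hr
  have h1 : r * (1 + w * w) = 1 := Ring.inverse_mul_cancel _ hu
  have h2 : (1 + w * w) * r = 1 := Ring.mul_inverse_cancel _ hu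
  have e : r * d - d * r = -(r * (w * (w * d - d * w) + (w * d - d * w) * w) * r) := by
    calc r * d - d * r = r * d * ((1 + w * w) * r) - r * (1 + w * w) * d * r := by
          rw [h1, h2, mul_one, one_mul]
      _ = _ := by noncomm_ring
  rw [e, norm_neg]
  have h3 : ‖w * (w * d - d * w) + (w * d - d * w) * w‖ ≤ 2 * ‖w * d - d * w‖ := by
    refine (norm_add_le _ _).trans ?_
    have h4 := norm_mul_le_of_le hw1 (le_refl ‖w * d - d * w‖)
    have h5 := norm_mul_le_of_le (le_refl ‖w * d - d * w‖) hw1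
    linarith
  have h6 := norm_mul_le_of_le (norm_mul_le_of_le hr1 h3) hr1
  simpa using h6

lemma norm_cayleyCos_commutator_le {w : D} (hw : star w = w) (hw1 : ‖w‖ ≤ 1) (d : D) :
    ‖cayleyCos w * d - d * cayleyCos w‖ ≤ 4 * ‖w * d - d * w‖ := by
  have h := norm_inverse_commutator_le hw hw1 d
  have e : cayleyCos w * d - d * cayleyCos w =
      (2 : ℝ) • (Ring.inverse (1 + w * w) * d - d * Ring.inverse (1 + w * w)) := by
    rw [two_smul, cayleyCos]; noncomm_ring
  rw [e, norm_smul]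
  norm_num
  linarith

lemma norm_cayleySin_commutator_le {w : D} (hw : star w = w) (hw1 : ‖w‖ ≤ 1) (d : D) :
    ‖cayleySin w * d - d * cayleySin w‖ ≤ 6 * ‖w * d - d * w‖ := by
  have h := norm_inverse_commutator_le hw hw1 d
  have hr1 := norm_inverse_one_add_mul_self_le hw
  set r := Ring.inverse (1 + w * w) with hr
  have e : cayleySin w * d - d * cayleySin w =
      (2 : ℝ) • (w * (r * d - d * r) + (w * d - d * w) * r) := by
    rw [two_smul, cayleySin]; noncomm_ring
  rw [e, norm_smul]
  have h4 := norm_mul_le_of_le hw1 h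
  have h5 := norm_mul_le_of_le (le_refl ‖w * d - d * w‖) hr1
  have h6 := norm_add_le (w * (r * d - d * r)) ((w * d - d * w) * r)
  norm_num
  linarith

lemma norm_cayleyCos_mul_le {w : D} (hw : star w = w) (hw1 : ‖w‖ ≤ 1) (d : D) :
    ‖cayleyCos w * d‖ ≤ 2 * ‖d - w * d‖ := by
  have hu : IsUnit (1 + w * w) := IsSelfAdjoint.isUnit_one_add_mul_self hw
  have hr1 := norm_inverse_one_add_mul_self_le hw
  have e : cayleyCos w * d =
      Ring.inverse (1 + w * w) * ((d - w * d) + w * (d - w * d)) := by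
    have h1 : Ring.inverse (1 + w * w) * (1 + w * w) = 1 := Ring.inverse_mul_cancel _ hu
    calc cayleyCos w * d = (2 * Ring.inverse (1 + w * w) -
          Ring.inverse (1 + w * w) * (1 + w * w)) * d := by rw [h1]; rfl
      _ = _ := by noncomm_ring
  rw [e]
  have h2 := norm_mul_le_of_le hw1 (le_refl ‖d - w * d‖)
  have h3 := norm_add_le (d - w * d) (w * (d - w * d))
  have h4 := norm_mul_le_of_le hr1 (h3.trans (add_le_add_right h2 _))
  linarith

/-- The quantity whose vanishing expresses that `z` is the prescribed combination of `x`, `y`,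
`star x` and `x * y`. -/
def relDefect {A : Type*} [NonUnitalCStarAlgebra A] (μ ν σ κ : ℂ) (x y z : A) : A :=
  z - μ • x - ν • y - σ • star x - κ • (x * y)

lemma norm_relDefect_conj_le {w : D} (hw : star w = w) (hw1 : ‖w‖ ≤ 1) (μ ν σ κ : ℂ)
    (x y z x' y' z' v v' : D) {δ : ℝ}
    (hx : (1 + ‖κ‖) * (1 + ‖x' - x‖ + ‖y' - y‖) * ‖w * x - x * w‖ ≤ δ)
    (hy : (1 + ‖κ‖) * (1 + ‖x' - x‖ + ‖y' - y‖) * ‖w * y - y * w‖ ≤ δ)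
    (ha : (1 + ‖κ‖) * (1 + ‖x' - x‖ + ‖y' - y‖) * ‖w * (x' - x) - (x' - x) * w‖ ≤ δ)
    (he : ‖w * relDefect μ ν σ κ x y z - relDefect μ ν σ κ x y z * w‖ ≤ δ)
    (hv : ‖(relDefect μ ν σ κ x' y' z' - v) - w * (relDefect μ ν σ κ x' y' z' - v)‖ ≤ δ)
    (hv' : (1 + ‖κ‖) *
      ‖((x' - x) * (y' - y) - v') - w * ((x' - x) * (y' - y) - v')‖ ≤ δ) :
    ‖relDefect μ ν σ κ (x + cayleyCos w * (x' - x) * cayleyCos w)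
      (y + cayleyCos w * (y' - y) * cayleyCos w) (z + cayleyCos w * (z' - z) * cayleyCos w)‖ ≤
    max ‖relDefect μ ν σ κ x y z‖ (‖v‖ + ‖κ‖ * ‖v'‖) + 30 * δ := by
  obtain ⟨hc, hs, hsc, hone⟩ := cayley_relations hw
  have nc := norm_cayleyCos_le hw
  have ns := norm_cayleySin_le hw
  have cx := norm_cayleyCos_commutator_le hw hw1 x
  have cy := norm_cayleyCos_commutator_le hw hw1 y
  have ca := norm_cayleyCos_commutator_le hw hw1 (x' - x)
  have ce := norm_cayleyCos_commutator_le hw hw1 (relDefect μ ν σ κ x y z)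
  have se := norm_cayleySin_commutator_le hw hw1 (relDefect μ ν σ κ x y z)
  have cv := norm_cayleyCos_mul_le hw hw1 (relDefect μ ν σ κ x' y' z' - v)
  have cv' := norm_cayleyCos_mul_le hw hw1 ((x' - x) * (y' - y) - v')
  set c := cayleyCos w
  set s := cayleySin w
  set a := x' - x with hadef
  set b := y' - y with hbdef
  set e := relDefect μ ν σ κ x y z with hedef
  set e' := relDefect μ ν σ κ x' y' z' with hedef'
  have hs2 : s * s = 1 - c * c := eq_sub_of_add_eq hone
  set R := c * a * (y * c - c * y) + (c * x - x * c) * b * c + c * (c * (c * a - a * c)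
    + (c * a - a * c) * c) * b * c + s * s * (c * (a * b - v')) * c with hR
  have bracket : x * y + c * (x' * y' - x * y) * c - (x + c * a * c) * (y + c * b * c) =
      c * (s * s * v') * c + R := by
    have hss : c * (s * s) = s * s * c := by rw [hs2]; noncomm_ring
    have h1 : s * s * (c * (a * b - v')) * c = c * (s * s) * (a * b - v') * c := by
      rw [hss]; noncomm_ring
    rw [hR, h1, hs2]
    have hx' : x' = x + a := by rw [hadef]; abel
    have hy' : y' = y + b := by rw [hbdef]; abel
    rw [hx', hy']
    noncomm_ring
  have main : relDefect μ ν σ κ (x + c * a * c) (y + c * b * c) (z + c * (z' - z) * c) =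
      (s * e * s + c * (v + κ • (s * s * v')) * c) +
      ((e * s - s * e) * s - (c * e - e * c) * c + c * (e' - v) * c + κ • R) := by
    have h1 : relDefect μ ν σ κ (x + c * a * c) (y + c * b * c) (z + c * (z' - z) * c) =
        e + c * (e' - e) * c +
        κ • (x * y + c * (x' * y' - x * y) * c - (x + c * a * c) * (y + c * b * c)) := by
      simp only [hedef, hedef', relDefect, star_add, star_mul, hc, hadef, hbdef, star_sub, mul_sub,
        sub_mul, smul_sub, smul_add, mul_smul_comm, smul_mul_assoc, mul_assoc]
      abel
    have h2 : e = e * (s * s) + e * (c * c) := by rw [← mul_add, hone, mul_one]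
    rw [h1, bracket]
    have h3 : e + c * (e' - e) * c = (s * e * s + c * v * c) +
      ((e * s - s * e) * s - (c * e - e * c) * c + c * (e' - v) * c) := by
      nth_rewrite 1 [h2]
      noncomm_ring
    rw [h3, smul_add, mul_add, add_mul, mul_smul_comm, smul_mul_assoc]
    abel
  have hK : 0 ≤ ‖κ‖ := norm_nonneg _
  have nR : ‖κ‖ * ‖R‖ ≤ 18 * δ := by
    have b1 : ‖c * a * (y * c - c * y)‖ ≤ 1 * ‖a‖ * (4 * ‖w * y - y * w‖) :=
      norm_mul_le_of_le (norm_mul_le_of_le nc le_rfl) (by rwa [norm_sub_rev])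
    have b2 : ‖(c * x - x * c) * b * c‖ ≤ 4 * ‖w * x - x * w‖ * ‖b‖ * 1 :=
      norm_mul_le_of_le (norm_mul_le_of_le cx le_rfl) nc
    have b3 : ‖c * (c * (c * a - a * c) + (c * a - a * c) * c) * b * c‖ ≤
        1 * (1 * (4 * ‖w * a - a * w‖) + (4 * ‖w * a - a * w‖) * 1) * ‖b‖ * 1 :=
      norm_mul_le_of_le (norm_mul_le_of_le (norm_mul_le_of_le nc
        (norm_add_le_of_le (norm_mul_le_of_le nc ca) (norm_mul_le_of_le ca nc))) le_rfl) nc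
    have b4 : ‖s * s * (c * (a * b - v')) * c‖ ≤
        1 * 1 * (2 * ‖(a * b - v') - w * (a * b - v')‖) * 1 :=
      norm_mul_le_of_le (norm_mul_le_of_le (norm_mul_le_of_le ns ns) cv') nc
    have b5 : ‖R‖ ≤ _ := norm_add_le_of_le (norm_add_le_of_le (norm_add_le_of_le b1 b2) b3) b4
    have weaken {p q r t : ℝ} (hp : 0 ≤ p) (hq : 0 ≤ q) (hr : r ≤ q) (ht : 0 ≤ t)
        (hr0 : 0 ≤ r) (h : (1 + p) * q * t ≤ δ) : p * r * t ≤ δ := by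
      refine le_trans ?_ h
      gcongr
      linarith
    have na := norm_nonneg a
    have nb := norm_nonneg b
    have k1 := weaken hK (q := 1 + ‖a‖ + ‖b‖) (r := ‖a‖) (by positivity) (by linarith)
      (norm_nonneg _) na hy
    have k2 := weaken hK (q := 1 + ‖a‖ + ‖b‖) (r := ‖b‖) (by positivity) (by linarith)
      (norm_nonneg _) nb hx
    have k3 := weaken hK (q := 1 + ‖a‖ + ‖b‖) (r := ‖b‖) (by positivity) (by linarith)
      (norm_nonneg _) nb ha
    have k4 : ‖κ‖ * ‖(a * b - v') - w * (a * b - v')‖ ≤ δ := by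
      refine le_trans ?_ hv'
      gcongr
      linarith
    calc ‖κ‖ * ‖R‖ ≤ ‖κ‖ * _ := mul_le_mul_of_nonneg_left b5 hK
      _ = 4 * (‖κ‖ * ‖a‖ * ‖w * y - y * w‖) + 4 * (‖κ‖ * ‖b‖ * ‖w * x - x * w‖) +
        8 * (‖κ‖ * ‖b‖ * ‖w * a - a * w‖) +
        2 * (‖κ‖ * ‖(a * b - v') - w * (a * b - v')‖) := by ring
      _ ≤ 18 * δ := by linarith
  rw [main]
  refine norm_add_le_of_le ?_ ?_
  · refine (CStarAlgebra.norm_conj_add_conj_le hs hc hsc hone _ _).trans ?_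
    refine max_le_max le_rfl (norm_add_le_of_le le_rfl ?_)
    rw [norm_smul]
    gcongr
    simpa using norm_mul_le_of_le (norm_mul_le_of_le ns ns) (le_refl ‖v'‖)
  · have d1 : ‖(e * s - s * e) * s‖ ≤ 6 * ‖w * e - e * w‖ * 1 :=
      norm_mul_le_of_le (by rwa [norm_sub_rev]) ns
    have d2 := norm_mul_le_of_le ce nc
    have d3 := norm_mul_le_of_le cv nc
    have d4 : ‖κ • R‖ ≤ 18 * δ := by rwa [norm_smul]
    refine (norm_add_le_of_le (norm_add_le_of_le (norm_sub_le_of_le d1 d2) d3) d4).trans ?_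
    linarith

section Quasicentral

variable {Q : Type*} [CStarAlgebra Q]

/-- The kernel of a `⋆`-homomorphism as a non-unital `⋆`-subalgebra. -/
def StarAlgHom.kernel (q : D →⋆ₐ[ℂ] Q) : NonUnitalStarSubalgebra ℂ D where
  carrier := {x | q x = 0}
  add_mem' {a b} ha hb := by simp_all
  zero_mem' := by simp
  mul_mem' {a b} ha hb := by simp_all
  smul_mem' c a ha := by simp_all
  star_mem' {a} ha := by simp_all [map_star]

lemma StarAlgHom.continuous_of_cstar (q : D →⋆ₐ[ℂ] Q) : Continuous q :=
  (AddMonoidHomClass.lipschitz_of_bound q 1 fun x => by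
    simpa using NonUnitalStarAlgHom.norm_apply_le q x).continuous

lemma StarAlgHom.isClosed_kernel (q : D →⋆ₐ[ℂ] Q) : IsClosed (q.kernel : Set D) :=
  isClosed_singleton.preimage q.continuous_of_cstar

lemma StarAlgHom.exists_approximate_unit (q : D →⋆ₐ[ℂ] Q) {F : Set D} (hF : F.Finite)
    (hFq : ∀ i ∈ F, q i = 0) {δ : ℝ} (hδ : 0 < δ) :
    ∃ e : D, q e = 0 ∧ star e = e ∧ ‖e‖ ≤ 1 ∧ ∀ i ∈ F, ‖i - e * i‖ < δ := by
  let := NonUnitalStarSubalgebra.nonUnitalCStarAlgebra q.kernel (h_closed := q.isClosed_kernel)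
  let := CStarAlgebra.spectralOrder q.kernel
  let := CStarAlgebra.spectralOrderedRing q.kernel
  have hl := CStarAlgebra.increasingApproximateUnit q.kernel
  have := hl.neBot
  have h : ∀ i ∈ F, ∀ᶠ e : q.kernel in CStarAlgebra.approximateUnit q.kernel,
      ‖i - (e : D) * i‖ < δ := by
    intro i hi
    have h1 := hl.tendsto_mul_right ⟨i, hFq i hi⟩
    have h2 : Tendsto (fun e : q.kernel => (e : D) * i)
      (CStarAlgebra.approximateUnit q.kernel) (𝓝 i) :=
      (continuous_subtype_val.tendsto _).comp h1
    have h3 := (tendsto_const_nhds (x := i)).sub h2 |>.norm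
    rw [sub_self, norm_zero] at h3
    exact h3.eventually_lt_const hδ
  obtain ⟨e, h1, h2, h3⟩ := (((hF.eventually_all).2 h).and
    (hl.eventually_star_eq.and hl.eventually_norm)).exists
  exact ⟨e, e.2, congrArg Subtype.val h2, h3, h1⟩

lemma StarAlgHom.exists_quasicentral_sum (q : D →⋆ₐ[ℂ] Q) {F I : Set D} (hF : F.Finite)
    (hI : I.Finite) (hIq : ∀ i ∈ I, q i = 0) {ε : ℝ} (hε : 0 < ε) (n : ℕ) :
    ∃ w : D, q w = 0 ∧ star w = w ∧ ‖w‖ ≤ n ∧ (∀ i ∈ I, ‖(n : ℂ) • i - w * i‖ ≤ n * ε) ∧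
      ∀ d ∈ F, ‖w * d - d * w‖ ^ 2 ≤ n * (4 * ‖d‖ ^ 2 + 1) := by
  induction n with
  | zero => exact ⟨0, by simp⟩
  | succ n ih =>
    obtain ⟨w, hw, hws, hwn, hwI, hwF⟩ := ih
    obtain ⟨M, hM⟩ := (hF.image norm).bddAbove
    have hM' : ∀ d ∈ F, ‖d‖ ≤ |M| := fun d hd =>
      (hM (Set.mem_image_of_mem _ hd)).trans (le_abs_self M)
    have hδ : 0 < min ε (1 / (2 * (|M| + 1))) := by positivity
    obtain ⟨e, he, hes, hen, heT⟩ := q.exists_approximate_unit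
      (F := I ∪ ((fun d => w * d - d * w) '' F ∪ (fun d => star d * (w * d - d * w)) '' F))
      (hI.union ((hF.image _).union (hF.image _)))
      (by
        rintro i (hi | ⟨d, -, rfl⟩ | ⟨d, -, rfl⟩)
        · exact hIq i hi
        · simp [hw]
        · simp [hw]) hδ
    refine ⟨w + e, by simp [hw, he], by rw [star_add, hws, hes], ?_, fun i hi => ?_,
      fun d hd => ?_⟩
    · push_cast
      exact (norm_add_le _ _).trans (add_le_add hwn hen)
    · have h1 := hwI i hi
      have h2 := (heT i (Or.inl hi)).le.trans (min_le_left _ _)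
      have h3 : ((n + 1 : ℕ) : ℂ) • i - (w + e) * i = ((n : ℂ) • i - w * i) + (i - e * i) := by
        push_cast
        rw [add_smul, one_smul, add_mul]
        abel
      rw [h3]
      push_cast
      linarith [norm_add_le ((n : ℂ) • i - w * i) (i - e * i)]
    · have h1 := hwF d hd
      have h2 := (heT _ (Or.inr (Or.inl ⟨d, hd, rfl⟩))).le.trans (min_le_right _ _)
      have h3 := (heT _ (Or.inr (Or.inr ⟨d, hd, rfl⟩))).le.trans (min_le_right _ _)
      simp only at h2 h3
      set X := w * d - d * w with hX
      set Y := e * d - d * e with hY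
      have hXY : ‖star X * Y‖ ≤ 1 / 2 := by
        have h4 : star X * Y = star (star d * X - e * (star d * X)) - star (X - e * X) * d := by
          simp only [hY, star_sub, star_mul, star_star, hes]
          noncomm_ring
        have h5 : ‖star (X - e * X) * d‖ ≤ 1 / (2 * (|M| + 1)) * |M| :=
          norm_mul_le_of_le (by rw [norm_star]; exact h2) (hM' d hd)
        rw [h4]
        refine (norm_sub_le _ _).trans ?_
        rw [norm_star]
        refine (add_le_add h3 h5).trans (le_of_eq ?_)
        have : |M| + 1 ≠ 0 := by positivity
        field_simp
        ring
      have hYn : ‖Y‖ ≤ 2 * ‖d‖ := by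
        refine (norm_sub_le _ _).trans ?_
        have h4 := norm_mul_le_of_le hen (le_refl ‖d‖)
        have h5 := norm_mul_le_of_le (le_refl ‖d‖) hen
        linarith
      have h4 : (w + e) * d - d * (w + e) = X + Y := by rw [hX, hY]; noncomm_ring
      rw [h4, sq, ← CStarRing.norm_star_mul_self]
      have h5 : star (X + Y) * (X + Y) = star X * X + star Y * Y + (star X * Y
          + star (star X * Y)) := by
        rw [star_add, star_mul, star_star]; noncomm_ring
      rw [h5]
      have h6 : ‖star X * Y + star (star X * Y)‖ ≤ 1 := by
        refine (norm_add_le _ _).trans ?_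
        rw [norm_star]; linarith
      refine (norm_add₃_le).trans ?_
      rw [CStarRing.norm_star_mul_self, CStarRing.norm_star_mul_self]
      push_cast
      nlinarith [norm_nonneg Y, norm_nonneg d]

/-- Pointwise quasicentral approximate units for the kernel of a `⋆`-homomorphism. -/
lemma StarAlgHom.exists_quasicentral (q : D →⋆ₐ[ℂ] Q) {F I : Set D} (hF : F.Finite)
    (hI : I.Finite) (hIq : ∀ i ∈ I, q i = 0) {ε : ℝ} (hε : 0 < ε) :
    ∃ w : D, q w = 0 ∧ star w = w ∧ ‖w‖ ≤ 1 ∧ (∀ i ∈ I, ‖i - w * i‖ < ε) ∧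
      ∀ d ∈ F, ‖w * d - d * w‖ < ε := by
  obtain ⟨M, hM⟩ := (hF.image norm).bddAbove
  obtain ⟨n, hn⟩ := exists_nat_gt ((4 * M ^ 2 + 1) / ε ^ 2)
  have hn0 : (0 : ℝ) < n := lt_of_le_of_lt (by positivity) hn
  have hnC : (n : ℂ) ≠ 0 := by exact_mod_cast hn0.ne'
  obtain ⟨w, hw, hws, hwn, hwI, hwF⟩ := q.exists_quasicentral_sum hF hI hIq (half_pos hε) n
  have hsm (x : D) : ‖(n : ℂ)⁻¹ • x‖ = ‖x‖ / n := by
    rw [norm_smul, norm_inv, Complex.norm_natCast]; ring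
  refine ⟨(n : ℂ)⁻¹ • w, by simp [hw], by simp [hws], ?_, fun i hi => ?_, fun d hd => ?_⟩
  · rw [hsm]; exact div_le_one_of_le₀ hwn hn0.le
  · have h1 : i - (n : ℂ)⁻¹ • w * i = (n : ℂ)⁻¹ • ((n : ℂ) • i - w * i) := by
      rw [smul_sub, smul_smul, inv_mul_cancel₀ hnC, one_smul, smul_mul_assoc]
    rw [h1, hsm, div_lt_iff₀ hn0]
    nlinarith [hwI i hi]
  · have h1 : (n : ℂ)⁻¹ • w * d - d * (n : ℂ)⁻¹ • w = (n : ℂ)⁻¹ • (w * d - d * w) := by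
      rw [smul_sub, smul_mul_assoc, mul_smul_comm]
    rw [h1, hsm, div_lt_iff₀ hn0]
    refine lt_of_pow_lt_pow_left₀ 2 (by positivity) ((hwF d hd).trans_lt ?_)
    have h2 : ‖d‖ ^ 2 ≤ M ^ 2 := by
      have := hM (Set.mem_image_of_mem _ hd)
      gcongr
    rw [div_lt_iff₀ (by positivity)] at hn
    nlinarith

end Quasicentral
end CStarAlgebra

section Selection

variable {D Q T : Type*} [CStarAlgebra D] [CStarAlgebra Q] [TopologicalSpace T] [T2Space T]
  [ParacompactSpace T]

/-- A continuous family of quasicentral elements, where at time `t` only the first `ρ t` of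
countably many conditions are imposed. -/
lemma StarAlgHom.exists_continuous_quasicentral (q : D →⋆ₐ[ℂ] Q) (ρ : C(T, ℝ))
    (F I : ℕ → Set C(T, D)) (hF : ∀ k, (F k).Finite) (hI : ∀ k, (I k).Finite)
    (hIq : ∀ k, ∀ i ∈ I k, ∀ t, q (i t) = 0) (N : ℕ → C(T, ℝ)) :
    ∃ w : C(T, D), ∀ t, q (w t) = 0 ∧ star (w t) = w t ∧ ‖w t‖ ≤ 1 ∧
      ∀ k : ℕ, (k : ℝ) ≤ ρ t → (∀ i ∈ I k, N k t * ‖i t - w t * i t‖ ≤ 1) ∧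
        ∀ d ∈ F k, N k t * ‖w t * d t - d t * w t‖ ≤ 1 := by
  let S (t : T) : Set D := {w | q w = 0} ∩ ({w | star w = w} ∩ (Metric.closedBall 0 1 ∩
    ⋂ (k : ℕ) (_ : (k : ℝ) ≤ ρ t), (⋂ i ∈ I k, {w | |N k t| * ‖i t - w * i t‖ ≤ 1}) ∩
      ⋂ d ∈ F k, {w | |N k t| * ‖w * d t - d t * w‖ ≤ 1}))
  have hS (t : T) : Convex ℝ (S t) := by
    have key (c : ℝ) (hc : 0 ≤ c) (L : D → D) (hL : ∀ a b : ℝ, a + b = 1 → ∀ x y : D,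
        L (a • x + b • y) = a • L x + b • L y) : Convex ℝ {w | c * ‖L w‖ ≤ 1} := by
      intro x hx y hy a b ha hb hab
      simp only [Set.mem_ofPred_eq] at *
      rw [hL a b hab]
      have h1 : ‖a • L x + b • L y‖ ≤ a * ‖L x‖ + b * ‖L y‖ := by
        refine (norm_add_le _ _).trans (le_of_eq ?_)
        rw [norm_smul, norm_smul, Real.norm_of_nonneg ha, Real.norm_of_nonneg hb]
      calc c * ‖a • L x + b • L y‖ ≤ c * (a * ‖L x‖ + b * ‖L y‖) := by gcongr
        _ = a * (c * ‖L x‖) + b * (c * ‖L y‖) := by ring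
        _ ≤ a * 1 + b * 1 := by gcongr
        _ = 1 := by linarith
    refine Convex.inter ?_ (Convex.inter ?_ (Convex.inter (convex_closedBall _ _) ?_))
    · intro x hx y hy a b ha hb hab
      simp only [Set.mem_ofPred_eq] at *
      rw [← Complex.coe_smul, ← Complex.coe_smul, map_add, map_smul, map_smul, hx, hy]
      simp
    · intro x hx y hy a b ha hb hab
      simp only [Set.mem_ofPred_eq] at *
      simp [hx, hy]
    · refine convex_iInter₂ fun k _ => (convex_iInter₂ fun i _ => ?_).inter
        (convex_iInter₂ fun d _ => ?_)
      · refine key _ (abs_nonneg _) (fun w => i t - w * i t) fun a b hab x y => ?_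
        have h1 : i t = a • i t + b • i t := by rw [← add_smul, hab, one_smul]
        simp only [add_mul, smul_mul_assoc, smul_sub]
        nth_rewrite 1 [h1]
        abel
      · refine key _ (abs_nonneg _) (fun w => w * d t - d t * w) fun a b hab x y => ?_
        simp only [add_mul, mul_add, smul_mul_assoc, mul_smul_comm, smul_sub]
        abel
  have hloc (x : T) : ∃ w, ∀ᶠ y in 𝓝 x, w ∈ S y := by
    set K : Set ℕ := {k | (k : ℝ) ≤ ρ x + 1} with hK
    have hKf : K.Finite := (Set.finite_le_nat ⌈ρ x + 1⌉₊).subset fun k hk => by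
      have : (k : ℝ) ≤ ⌈ρ x + 1⌉₊ := le_trans hk (Nat.le_ceil _)
      exact Nat.cast_le.1 this
    obtain ⟨w, hw, hws, hwn, hwI, hwF⟩ := q.exists_quasicentral
      (F := ⋃ k ∈ K, (fun d : C(T, D) => ((|N k x| : ℝ) : ℂ) • d x) '' F k)
      (I := ⋃ k ∈ K, (fun d : C(T, D) => ((|N k x| : ℝ) : ℂ) • d x) '' I k)
      (hKf.biUnion fun k _ => (hF k).image _) (hKf.biUnion fun k _ => (hI k).image _)
      (by
        simp only [Set.mem_iUnion, Set.mem_image]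
        rintro i ⟨k, -, j, hj, rfl⟩
        rw [map_smul, hIq k j hj, smul_zero]) one_pos
    have ev1 : ∀ᶠ y in 𝓝 x, ρ y < ρ x + 1 :=
      (ρ.continuous.tendsto x).eventually_lt_const (by linarith)
    have ev2 : ∀ᶠ y in 𝓝 x, ∀ k ∈ K, ∀ i ∈ I k, |N k y| * ‖i y - w * i y‖ < 1 := by
      refine (hKf.eventually_all).2 fun k hk => ((hI k).eventually_all).2 fun i hi => ?_
      have hc : Continuous fun y => |N k y| * ‖i y - w * i y‖ := by fun_prop
      refine (hc.tendsto x).eventually_lt_const ?_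
      have := hwI _ (Set.mem_biUnion hk (Set.mem_image_of_mem _ hi))
      rwa [mul_smul_comm, ← smul_sub, norm_smul, Complex.norm_real, norm_abs_eq_norm,
        Real.norm_eq_abs] at this
    have ev3 : ∀ᶠ y in 𝓝 x, ∀ k ∈ K, ∀ d ∈ F k, |N k y| * ‖w * d y - d y * w‖ < 1 := by
      refine (hKf.eventually_all).2 fun k hk => ((hF k).eventually_all).2 fun i hi => ?_
      have hc : Continuous fun y => |N k y| * ‖w * i y - i y * w‖ := by fun_prop
      refine (hc.tendsto x).eventually_lt_const ?_
      have := hwF _ (Set.mem_biUnion hk (Set.mem_image_of_mem _ hi))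
      rwa [mul_smul_comm, smul_mul_assoc, ← smul_sub, norm_smul, Complex.norm_real,
        norm_abs_eq_norm, Real.norm_eq_abs] at this
    refine ⟨w, ?_⟩
    filter_upwards [ev1, ev2, ev3] with y h1 h2 h3
    refine ⟨hw, hws, by simpa using hwn, ?_⟩
    simp only [Set.mem_iInter, Set.mem_inter_iff, Set.mem_ofPred_eq]
    exact fun k hk => ⟨fun i hi => (h2 k (hk.trans h1.le) i hi).le,
      fun d hd => (h3 k (hk.trans h1.le) d hd).le⟩
  obtain ⟨w, hw⟩ := exists_continuous_forall_mem_convex_of_local_const hS hloc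
  refine ⟨w, fun t => ?_⟩
  obtain ⟨h1, h2, h3, h4⟩ := hw t
  refine ⟨h1, h2, by simpa using h3, ?_⟩
  simp only [Set.mem_iInter, Set.mem_inter_iff, Set.mem_ofPred_eq] at h4
  exact fun k hk => ⟨fun i hi => (mul_le_mul_of_nonneg_right (le_abs_self _)
      (norm_nonneg _)).trans ((h4 k hk).1 i hi),
    fun d hd => (mul_le_mul_of_nonneg_right (le_abs_self _)
      (norm_nonneg _)).trans ((h4 k hk).2 d hd)⟩

/-- Lifting a continuous family under a surjection with norm control, given that it has some
continuous lift. -/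
lemma StarAlgHom.exists_norm_controlled_lift (q : D →⋆ₐ[ℂ] Q) {C : ℝ}
    (hC : ∀ y : Q, ∃ x : D, q x = y ∧ ‖x‖ ≤ C * ‖y‖) (f : C(T, D)) (ε : C(T, ℝ))
    (hε : ∀ t, 0 < ε t) :
    ∃ v : C(T, D), ∀ t, q (v t) = q (f t) ∧ ‖v t‖ ≤ C * ‖q (f t)‖ + ε t := by
  have hqc := q.continuous_of_cstar
  obtain ⟨v, hv⟩ := exists_continuous_forall_mem_convex_of_local
    (t := fun t => {v : D | q v = q (f t)} ∩ Metric.closedBall 0 (C * ‖q (f t)‖ + ε t))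
    (fun t => by
      refine Convex.inter ?_ (convex_closedBall _ _)
      intro x hx y hy a b ha hb hab
      simp only [Set.mem_ofPred_eq] at *
      rw [← Complex.coe_smul, ← Complex.coe_smul, map_add, map_smul, map_smul, hx, hy,
        ← add_smul, ← Complex.ofReal_add, hab]
      simp)
    (fun x => by
      obtain ⟨d, hd, hdn⟩ := hC (q (f x))
      have hc : Continuous fun y => ‖f y - (f x - d)‖ := by fun_prop
      have hc2 : Continuous fun y => C * ‖q (f y)‖ + ε y := by fun_prop
      have ev : ∀ᶠ y in 𝓝 x, ‖f y - (f x - d)‖ < C * ‖q (f y)‖ + ε y :=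
        hc.continuousAt.eventually_lt hc2.continuousAt (by
          simp only [sub_sub_cancel]
          linarith [hε x])
      refine ⟨_, ev, fun y => f y - (f x - d), by fun_prop, fun y hy => ⟨?_, ?_⟩⟩
      · simp [hd]
      · rw [mem_closedBall_zero_iff]; exact hy.le)
  exact ⟨v, fun t => ⟨(hv t).1, by simpa using (hv t).2⟩⟩

lemma StarAlgHom.exists_preimage_norm_le (q : D →⋆ₐ[ℂ] Q) (hq : Function.Surjective q) :
    ∃ C > 0, ∀ y : Q, ∃ x : D, q x = y ∧ ‖x‖ ≤ C * ‖y‖ :=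
  ContinuousLinearMap.exists_preimage_norm_le
    (⟨q.toAlgHom.toLinearMap, q.continuous_of_cstar⟩ : D →L[ℂ] Q) hq

/-- Paths lift along surjective `⋆`-homomorphisms. -/
lemma StarAlgHom.exists_path_lift (q : D →⋆ₐ[ℂ] Q) (hq : Function.Surjective q)
    (ξ : C(unitInterval, Q)) : ∃ L : C(unitInterval, D), ∀ s, q (L s) = ξ s := by
  obtain ⟨C, hC0, hC⟩ := q.exists_preimage_norm_le hq
  have hqc := q.continuous_of_cstar
  let f : NormedAddGroupHom C(unitInterval, D) C(unitInterval, Q) :=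
    AddMonoidHom.mkNormedAddGroupHom
      { toFun := fun h => ⟨fun s => q (h s), by fun_prop⟩
        map_zero' := by ext; simp
        map_add' := fun a b => by ext; simp } 1 fun h => by
      rw [ContinuousMap.norm_le _ (by positivity), one_mul]
      exact fun s => (NonUnitalStarAlgHom.norm_apply_le q (h s)).trans (h.norm_coe_le_norm s)
  have hf (h : C(unitInterval, D)) (s : unitInterval) : f h s = q (h s) := rfl
  have hon : f.SurjectiveOnWith f.range (C + 1) := by
    rintro _ ⟨h, rfl⟩
    rcases eq_or_ne (f h) 0 with h0 | h0
    · exact ⟨0, (map_zero f).trans h0.symm, by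
        rw [norm_zero]
        positivity⟩
    · obtain ⟨v, hv⟩ := q.exists_norm_controlled_lift hC h (.const _ ‖f h‖)
        (fun _ => norm_pos_iff.2 h0)
      refine ⟨v, by ext s; exact (hv s).1, ?_⟩
      rw [ContinuousMap.norm_le _ (by positivity)]
      refine fun s => (hv s).2.trans ?_
      have h1 : C * ‖q (h s)‖ ≤ C * ‖f h‖ := by
        gcongr
        exact (f h).norm_coe_le_norm s
      change C * ‖q (h s)‖ + ‖f h‖ ≤ (C + 1) * ‖f h‖
      linarith
  have hcl : ξ ∈ f.range.topologicalClosure := by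
    refine Metric.mem_closure_iff.2 fun ε hε => ?_
    obtain ⟨v, hv⟩ := exists_continuous_forall_mem_convex_of_local_const
      (t := fun s : unitInterval => {v : D | ‖q v - ξ s‖ ≤ ε / 2})
      (fun s => by
        intro x hx y hy a b ha hb hab
        simp only [Set.mem_ofPred_eq] at *
        have h1 : q (a • x + b • y) - ξ s = a • (q x - ξ s) + b • (q y - ξ s) := by
          have h2 : ξ s = a • ξ s + b • ξ s := by rw [← add_smul, hab, one_smul]
          rw [← Complex.coe_smul, ← Complex.coe_smul, map_add, map_smul, map_smul,
            Complex.coe_smul, Complex.coe_smul]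
          nth_rewrite 1 [h2]
          simp only [smul_sub]
          abel
        rw [h1]
        refine (norm_add_le _ _).trans ?_
        rw [norm_smul, norm_smul, Real.norm_of_nonneg ha, Real.norm_of_nonneg hb]
        nlinarith)
      (fun s => by
        obtain ⟨c, hc⟩ := hq (ξ s)
        have h1 : Continuous fun y => ‖q c - ξ y‖ := by fun_prop
        refine ⟨c, ?_⟩
        filter_upwards [(h1.tendsto s).eventually_lt_const
          (show ‖q c - ξ s‖ < ε / 2 by rw [hc, sub_self, norm_zero]; linarith)] with y hy
        exact hy.le)
    refine ⟨f v, ⟨v, rfl⟩, lt_of_le_of_lt ?_ (half_lt_self hε)⟩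
    rw [dist_eq_norm', ContinuousMap.norm_le _ (by positivity)]
    exact hv
  obtain ⟨L, hL, -⟩ := controlled_closure_of_complete (by positivity) one_pos hon ξ hcl
  exact ⟨L, fun s => by rw [← hL]; rfl⟩

end Selection

section Contractive

variable {T B D : Type*} [NonUnitalCStarAlgebra B]

/-- The asymptotic algebraic conditions along a filter. -/
structure IsAsymptoticAlong [NonUnitalCStarAlgebra D] (l : Filter T) (f : T → B → D) : Prop where
  mul : ∀ a b : B, Tendsto (fun t => ‖f t (a * b) - f t a * f t b‖) l (𝓝 0)
  lin : ∀ (μ₁ μ₂ : ℂ) (a b : B),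
    Tendsto (fun t => ‖f t (μ₁ • a + μ₂ • b) - (μ₁ • f t a + μ₂ • f t b)‖) l (𝓝 0)
  star_defect : ∀ a : B, Tendsto (fun t => ‖f t (star a) - star (f t a)‖) l (𝓝 0)

lemma exists_selfAdjoint_two_smul_eq {b : B} (hb : ‖b‖ ≤ 1) :
    ∃ c : B, star c = c ∧ (2 : ℂ) • c = star b * b + c * c := by
  set p := star b * b with hp
  have hps : IsSelfAdjoint p := .star_mul_self b
  have hpn : ‖p‖ ≤ 1 := by
    rw [hp, CStarRing.norm_star_mul_self]
    nlinarith [norm_nonneg b]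
  set f : ℝ → ℝ := fun x => 1 - √(1 - x) with hf
  have hfc : Continuous f := by fun_prop
  have hf0 : f 0 = 0 := by simp [hf]
  refine ⟨cfcₙ f p, (cfcₙ_predicate f p).star_eq, ?_⟩
  have h1 : cfcₙ f p * cfcₙ f p = cfcₙ (fun x => f x * f x) p :=
    (cfcₙ_mul f f p hfc.continuousOn hf0 hfc.continuousOn hf0).symm
  have h2 : (2 : ℝ) • cfcₙ f p = cfcₙ (fun x => 2 * f x) p :=
    (cfcₙ_const_mul 2 f p hfc.continuousOn hf0).symm
  have h3 : p + cfcₙ (fun x => f x * f x) p = cfcₙ (fun x => x + f x * f x) p := by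
    rw [cfcₙ_add (fun x => x) (fun x => f x * f x) p (by fun_prop) (by simp) (by fun_prop)
      (by simp [hf0]), cfcₙ_id' ℝ p]
  have h4 : (2 : ℂ) • cfcₙ f p = (2 : ℝ) • cfcₙ f p := by
    rw [← Complex.coe_smul]; norm_num
  rw [h4, h1, h2, h3]
  refine cfcₙ_congr fun x hx => ?_
  have hx1 : x ≤ 1 := (le_abs_self x).trans
    ((NonUnitalIsometricContinuousFunctionalCalculus.norm_quasispectrum_le p hx hps).trans hpn)
  have := Real.sq_sqrt (sub_nonneg.2 hx1)
  simp only [hf]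
  nlinarith

variable [CStarAlgebra D] {l : Filter T} {ψ : T → B → D}

lemma IsAsymptoticAlong.eventually_norm_le_one_add (hψ : IsAsymptoticAlong l ψ) {b : B}
    (hb : ‖b‖ ≤ 1) {η : ℝ} (hη : 0 < η) : ∀ᶠ t in l, ‖ψ t b‖ ≤ 1 + η := by
  obtain ⟨c, hc, h2c⟩ := exists_selfAdjoint_two_smul_eq hb
  have hδ : 0 < η / 8 := by positivity
  filter_upwards [(hψ.mul (star b) b).eventually_lt_const hδ,
    (hψ.mul c c).eventually_lt_const hδ, (hψ.star_defect b).eventually_lt_const hδ,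
    (hψ.star_defect c).eventually_lt_const hδ, (hψ.lin 2 0 c c).eventually_lt_const hδ,
    (hψ.lin 1 1 (star b * b) (c * c)).eventually_lt_const hδ] with t h1 h3 h2 h4 h5 h6
  have e : (2 : ℂ) • c + (0 : ℂ) • c = (1 : ℂ) • (star b * b) + (1 : ℂ) • (c * c) := by
    rw [zero_smul, add_zero, one_smul, one_smul, h2c]
  rw [e] at h5
  rw [hc] at h4
  set x := ψ t b
  set y := ψ t c
  set δ := η / 8
  set e1 := ψ t (star b * b) - ψ t (star b) * x with he1
  set e2 := ψ t (star b) - star x with he2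
  set e3 := ψ t (c * c) - y * y with he3
  set e4 := y - star y with he4
  set e5 := ψ t ((1 : ℂ) • (star b * b) + (1 : ℂ) • (c * c)) - ((2 : ℂ) • y + (0 : ℂ) • y)
    with he5
  set e6 := ψ t ((1 : ℂ) • (star b * b) + (1 : ℂ) • (c * c)) -
    ((1 : ℂ) • ψ t (star b * b) + (1 : ℂ) • ψ t (c * c)) with he6
  have R : star x * x + star (1 - y) * (1 - y)
      = 1 + (e5 - e6) - e1 - e3 - e2 * x - e4 * y + e4 := by
    simp only [he1, he2, he3, he4, he5, he6, star_sub, star_one, two_smul, one_smul, zero_smul]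
    noncomm_ring
  set m := max ‖x‖ ‖1 - y‖
  have hxm : ‖x‖ ≤ m := le_max_left _ _
  have hy'm : ‖1 - y‖ ≤ m := le_max_right _ _
  have hone : ‖(1 : D)‖ ≤ 1 := by
    rcases subsingleton_or_nontrivial D with hD | hD
    · rw [Subsingleton.elim (1 : D) 0, norm_zero]; exact zero_le_one
    · exact CStarRing.norm_one.le
  have hym : ‖y‖ ≤ 1 + m := by
    have : y = 1 - (1 - y) := by abel
    rw [this]
    exact (norm_sub_le _ _).trans (add_le_add hone hy'm)
  have hm0 : 0 ≤ m := (norm_nonneg x).trans hxm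
  have hRn : ‖star x * x + star (1 - y) * (1 - y)‖ ≤ 1 + 6 * δ + 2 * δ * m := by
    rw [R]
    have i1 := norm_add_le (1 + (e5 - e6) - e1 - e3 - e2 * x - e4 * y) e4
    have i2 := norm_sub_le (1 + (e5 - e6) - e1 - e3 - e2 * x) (e4 * y)
    have i3 := norm_sub_le (1 + (e5 - e6) - e1 - e3) (e2 * x)
    have i4 := norm_sub_le (1 + (e5 - e6) - e1) e3
    have i5 := norm_sub_le (1 + (e5 - e6)) e1
    have i6 := norm_add_le 1 (e5 - e6)
    have i7 := norm_sub_le e5 e6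
    have i8 := norm_mul_le_of_le h2.le hxm
    have i9 := norm_mul_le_of_le h4.le hym
    linarith
  have hsq : m ^ 2 ≤ 1 + 6 * δ + 2 * δ * m := by
    have j1 := (CStarAlgebra.norm_sq_le_norm_star_mul_self_add x (1 - y)).trans hRn
    have j2 := (CStarAlgebra.norm_sq_le_norm_star_mul_self_add (1 - y) x).trans
      ((congrArg norm (add_comm _ _)).le.trans hRn)
    rcases max_choice ‖x‖ ‖1 - y‖ with h | h
    · simpa only [m, h] using j1
    · simpa only [m, h] using j2
  refine hxm.trans (not_lt.1 fun hlt => ?_)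
  have h8 : η = 8 * δ := by simp only [δ]; ring
  nlinarith

/-- Asymptotic homomorphisms are asymptotically contractive. -/
lemma IsAsymptoticAlong.eventually_norm_le (hψ : IsAsymptoticAlong l ψ) (b : B)
    {ε : ℝ} (hε : 0 < ε) : ∀ᶠ t in l, ‖ψ t b‖ ≤ ‖b‖ + ε := by
  set r := ‖b‖ + ε / 3 with hr
  have hr0 : 0 < r := by positivity
  have hrC : (r : ℂ) ≠ 0 := by exact_mod_cast hr0.ne'
  have hb : ‖(r : ℂ)⁻¹ • b‖ ≤ 1 := by
    rw [norm_smul, norm_inv, Complex.norm_real, Real.norm_of_nonneg hr0.le,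
      inv_mul_le_iff₀ hr0]
    linarith
  filter_upwards [hψ.eventually_norm_le_one_add hb (η := ε / (3 * r)) (by positivity),
    (hψ.lin r 0 ((r : ℂ)⁻¹ • b) 0).eventually_lt_const (show 0 < ε / 3 by positivity)]
    with t h1 h2
  rw [smul_smul, mul_inv_cancel₀ hrC, one_smul, smul_zero, add_zero, zero_smul, add_zero] at h2
  have h3 : ‖(r : ℂ) • ψ t ((r : ℂ)⁻¹ • b)‖ ≤ r * (1 + ε / (3 * r)) := by
    rw [norm_smul, Complex.norm_real, Real.norm_of_nonneg hr0.le]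
    gcongr
  have h4 : r * (1 + ε / (3 * r)) = r + ε / 3 := by field_simp
  have h5 := norm_le_norm_add_norm_sub' (ψ t b) ((r : ℂ) • ψ t ((r : ℂ)⁻¹ • b))
  linarith

lemma IsAsymptoticAlong.eventually_norm_relDefect_le (hψ : IsAsymptoticAlong l ψ)
    (μ ν σ κ : ℂ) (b c z : B) {ε : ℝ} (hε : 0 < ε) :
    ∀ᶠ t in l, ‖relDefect μ ν σ κ (ψ t b) (ψ t c) (ψ t z)‖ ≤ ‖relDefect μ ν σ κ b c z‖ + ε := by
  set u := μ • b + ν • c with hu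
  set v := σ • star b + κ • (b * c) with hv
  set s := (1 : ℂ) • u + (1 : ℂ) • v with hs
  have h0 : relDefect μ ν σ κ b c z = (1 : ℂ) • z + (-1 : ℂ) • s := by
    simp only [relDefect, hs, hu, hv, one_smul, neg_smul]; abel
  have l1 := hψ.lin μ ν b c
  have l2 := hψ.lin σ κ (star b) (b * c)
  have l3 := hψ.lin 1 1 u v
  have l4 := hψ.lin 1 (-1) z s
  have l5 := (hψ.star_defect b).const_mul ‖σ‖
  have l6 := (hψ.mul b c).const_mul ‖κ‖
  rw [mul_zero] at l5 l6
  have hδ : 0 < ε / 7 := by positivity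
  filter_upwards [l1.eventually_lt_const hδ, l2.eventually_lt_const hδ, l3.eventually_lt_const hδ,
    l4.eventually_lt_const hδ, l5.eventually_lt_const hδ, l6.eventually_lt_const hδ,
    hψ.eventually_norm_le (relDefect μ ν σ κ b c z) hδ] with t h1 h2 h3 h4 h5 h6 h7
  rw [← norm_smul] at h5 h6
  rw [h0] at h7 ⊢
  rw [← hu] at h1
  rw [← hv] at h2
  rw [← hs] at h3
  set d1 := ψ t u - (μ • ψ t b + ν • ψ t c) with hd1
  set d2 := ψ t v - (σ • ψ t (star b) + κ • ψ t (b * c)) with hd2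
  set d3 := ψ t s - ((1 : ℂ) • ψ t u + (1 : ℂ) • ψ t v) with hd3
  set d4 := ψ t ((1 : ℂ) • z + (-1 : ℂ) • s) - ((1 : ℂ) • ψ t z + (-1 : ℂ) • ψ t s) with hd4
  set d5 := σ • (ψ t (star b) - star (ψ t b)) with hd5
  set d6 := κ • (ψ t (b * c) - ψ t b * ψ t c) with hd6
  have e : relDefect μ ν σ κ (ψ t b) (ψ t c) (ψ t z) =
      ψ t ((1 : ℂ) • z + (-1 : ℂ) • s) - d4 + d3 + d1 + d2 + d5 + d6 := by
    simp only [relDefect, hd1, hd2, hd3, hd4, hd5, hd6, one_smul, neg_smul, smul_sub]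
    abel
  rw [e]
  set g := ψ t ((1 : ℂ) • z + (-1 : ℂ) • s)
  have i1 := norm_add_le (g - d4 + d3 + d1 + d2 + d5) d6
  have i2 := norm_add_le (g - d4 + d3 + d1 + d2) d5
  have i3 := norm_add_le (g - d4 + d3 + d1) d2
  have i4 := norm_add_le (g - d4 + d3) d1
  have i5 := norm_add_le (g - d4) d3
  have i6 := norm_sub_le g d4
  linarith

end Contractive

section Iteration

variable {B D Q T : Type*} [NonUnitalCStarAlgebra B] [CStarAlgebra D] [CStarAlgebra Q]
  [TopologicalSpace T]

lemma map_relDefect {A A' F : Type*} [NonUnitalCStarAlgebra A] [NonUnitalCStarAlgebra A']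
    [FunLike F A A'] [NonUnitalAlgHomClass F ℂ A A'] [StarHomClass F A A'] (f : F)
    (μ ν σ κ : ℂ) (x y z : A) :
    f (relDefect μ ν σ κ x y z) = relDefect μ ν σ κ (f x) (f y) (f z) := by
  simp only [relDefect, map_sub, map_smul, map_mul, map_star]

lemma continuous_cayleyCos (w : C(T, D)) (hw : ∀ t, star (w t) = w t) :
    Continuous fun t => cayleyCos (w t) := by
  have h : Continuous fun t => Ring.inverse (1 + w t * w t) := by
    refine continuous_iff_continuousAt.2 fun t => ?_
    obtain ⟨u, hu⟩ := IsSelfAdjoint.isUnit_one_add_mul_self (hw t)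
    have h1 := NormedRing.inverse_continuousAt u
    rw [hu] at h1
    have h2 : ContinuousAt (fun t => 1 + w t * w t) t := by fun_prop
    exact ContinuousAt.comp (g := Ring.inverse) h1 h2
  unfold cayleyCos
  fun_prop

variable [T2Space T] [ParacompactSpace T]

/-- Moving a family of lifts to another family of lifts, with control on countably many algebraic
relations. -/
lemma StarAlgHom.exists_lift_step (q : D →⋆ₐ[ℂ] Q) {C : ℝ} (hC0 : 0 < C)
    (hC : ∀ y : Q, ∃ x : D, q x = y ∧ ‖x‖ ≤ C * ‖y‖) (ρ ε : C(T, ℝ)) (hε : ∀ t, 0 < ε t)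
    (μ ν σ κ : ℕ → ℂ) (b c z : ℕ → B) (R R' : T → B →⋆ₙₐ[ℂ] Q) (x x' : B → C(T, D))
    (hx : ∀ a t, q (x a t) = R t a) (hx' : ∀ a t, q (x' a t) = R' t a) :
    ∃ y : B → C(T, D), (∀ a t, q (y a t) = R' t a) ∧ (∀ a t, x' a t = x a t → y a t = x a t) ∧
      ∀ t (n : ℕ), (n : ℝ) ≤ ρ t →
        ‖relDefect (μ n) (ν n) (σ n) (κ n) (y (b n) t) (y (c n) t) (y (z n) t)‖ ≤
          max ‖relDefect (μ n) (ν n) (σ n) (κ n) (x (b n) t) (x (c n) t) (x (z n) t)‖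
            (C * ‖relDefect (μ n) (ν n) (σ n) (κ n) (b n) (c n) (z n)‖ + ε t +
              ‖κ n‖ * (C * (‖R' t (b n) - R t (b n)‖ * ‖R' t (c n) - R t (c n)‖) + ε t))
            + ε t := by
  let E (n : ℕ) : C(T, D) := ⟨fun t => relDefect (μ n) (ν n) (σ n) (κ n)
    (x (b n) t) (x (c n) t) (x (z n) t), by unfold relDefect; fun_prop⟩
  let E' (n : ℕ) : C(T, D) := ⟨fun t => relDefect (μ n) (ν n) (σ n) (κ n)
    (x' (b n) t) (x' (c n) t) (x' (z n) t), by unfold relDefect; fun_prop⟩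
  choose v hv using fun n => q.exists_norm_controlled_lift hC (E' n) ε hε
  choose v' hv' using fun n => q.exists_norm_controlled_lift hC
    ((x' (b n) - x (b n)) * (x' (c n) - x (c n))) ε hε
  let M (n : ℕ) (t : T) : ℝ :=
    (1 + ‖κ n‖) * (1 + ‖x' (b n) t - x (b n) t‖ + ‖x' (c n) t - x (c n) t‖)
  have hMk (n : ℕ) (t : T) : 1 + ‖κ n‖ ≤ M n t := by
    refine le_mul_of_one_le_right (by positivity) ?_
    rw [add_assoc]
    exact le_add_of_nonneg_right (by positivity)
  let N (n : ℕ) : C(T, ℝ) := ⟨fun t => 30 * M n t / ε t, by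
    have : ∀ t, ε t ≠ 0 := fun t => (hε t).ne'
    unfold M
    fun_prop (disch := assumption)⟩
  obtain ⟨w, hw⟩ := q.exists_continuous_quasicentral ρ
    (fun n => {x (b n), x (c n), x' (b n) - x (b n), x' (c n) - x (c n), E n})
    (fun n => {E' n - v n, (x' (b n) - x (b n)) * (x' (c n) - x (c n)) - v' n})
    (fun n => by simp) (fun n => by simp)
    (fun n i hi t => by
      rcases hi with rfl | rfl
      · simp [(hv n t).1]
      · simp [(hv' n t).1]) N
  have hcw := continuous_cayleyCos w fun t => (hw t).2.1
  refine ⟨fun a => ⟨fun t => x a t + cayleyCos (w t) * (x' a t - x a t) * cayleyCos (w t),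
    by fun_prop⟩, fun a t => ?_, fun a t h => ?_, fun t n hn => ?_⟩
  · have h1 : q (cayleyCos (w t)) = 1 := by
      obtain ⟨u, hu⟩ := IsSelfAdjoint.isUnit_one_add_mul_self (hw t).2.1
      have h2 : q (Ring.inverse (1 + w t * w t)) = 1 := by
        have h3 := congrArg q (Ring.inverse_mul_cancel (1 + w t * w t) ⟨u, hu⟩)
        simpa [(hw t).1] using h3
      simp only [cayleyCos, map_sub, map_mul, h2, map_one, map_ofNat]
      norm_num
    simp [h1, hx, hx']
  · simp [h]
  · obtain ⟨-, hws, hwn, hwk⟩ := hw t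
    obtain ⟨hI, hF⟩ := hwk n hn
    have conv {X : ℝ} (h : N n t * X ≤ 1) : M n t * X ≤ ε t / 30 := by
      have h1 : N n t * X = 30 * M n t * X / ε t := by
        change 30 * M n t / ε t * X = _
        ring
      rw [h1, div_le_one (hε t)] at h
      linarith
    have conv1 {X : ℝ} (hX : 0 ≤ X) (h : N n t * X ≤ 1) : (1 + ‖κ n‖) * X ≤ ε t / 30 :=
      (mul_le_mul_of_nonneg_right (hMk n t) hX).trans (conv h)
    have conv2 {X : ℝ} (hX : 0 ≤ X) (h : N n t * X ≤ 1) : X ≤ ε t / 30 :=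
      (le_mul_of_one_le_left hX (by simp)).trans (conv1 hX h)
    have key := norm_relDefect_conj_le hws hwn (μ n) (ν n) (σ n) (κ n) (x (b n) t) (x (c n) t)
      (x (z n) t) (x' (b n) t) (x' (c n) t) (x' (z n) t) (v n t) (v' n t) (δ := ε t / 30)
      (conv (hF (x (b n)) (by simp))) (conv (hF (x (c n)) (by simp)))
      (conv (hF (x' (b n) - x (b n)) (by simp))) (conv2 (norm_nonneg _) (hF (E n) (by simp)))
      (conv2 (norm_nonneg _) (hI (E' n - v n) (by simp)))
      (conv1 (norm_nonneg _)
        (hI ((x' (b n) - x (b n)) * (x' (c n) - x (c n)) - v' n) (by simp)))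
    refine key.trans (add_le_add (max_le_max_left _ ?_) (by linarith))
    have h1 : ‖q (E' n t)‖ ≤ ‖relDefect (μ n) (ν n) (σ n) (κ n) (b n) (c n) (z n)‖ := by
      have : q (E' n t) = R' t (relDefect (μ n) (ν n) (σ n) (κ n) (b n) (c n) (z n)) := by
        change q (relDefect _ _ _ _ _ _ _) = _
        rw [map_relDefect, map_relDefect, hx', hx', hx']
      rw [this]
      exact NonUnitalStarAlgHom.norm_apply_le _ _
    have h2 : ‖q (((x' (b n) - x (b n)) * (x' (c n) - x (c n))) t)‖ ≤
        ‖R' t (b n) - R t (b n)‖ * ‖R' t (c n) - R t (c n)‖ := by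
      simp only [ContinuousMap.mul_apply, ContinuousMap.sub_apply, map_mul, map_sub, hx, hx']
      exact norm_mul_le _ _
    have h3 := (hv n t).2
    have h4 := (hv' n t).2
    refine add_le_add (h3.trans ?_) (mul_le_mul_of_nonneg_left (h4.trans ?_) (norm_nonneg _))
    · gcongr
    · gcongr

/-- Following a path of `⋆`-homomorphisms of the quotient by families of lifts. -/
lemma StarAlgHom.exists_lift_of_path (q : D →⋆ₐ[ℂ] Q) (hq : Function.Surjective q) (ρ : C(T, ℝ))
    (hρ : ∀ t, 0 ≤ ρ t) (μ ν σ κ : ℕ → ℂ) (b c z : ℕ → B) (P : unitInterval → B →⋆ₙₐ[ℂ] Q)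
    (hP : ∀ a, Continuous fun s => P s a) (x₀ : B → C(T, D)) (hx₀ : ∀ a t, q (x₀ a t) = P 0 a)
    (h₀ : ∀ n, ∀ ε > 0, ∀ᶠ t in comap ρ atTop,
      ‖relDefect (μ n) (ν n) (σ n) (κ n) (x₀ (b n) t) (x₀ (c n) t) (x₀ (z n) t)‖ ≤
        ‖relDefect (μ n) (ν n) (σ n) (κ n) (b n) (c n) (z n)‖ + ε) :
    ∃ G : B → C(T, D), (∀ a t, q (G a t) = P 1 a) ∧ ∃ C > 0, ∀ n, ∀ ε > 0,
      ∀ᶠ t in comap ρ atTop,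
        ‖relDefect (μ n) (ν n) (σ n) (κ n) (G (b n) t) (G (c n) t) (G (z n) t)‖ ≤
          C * ‖relDefect (μ n) (ν n) (σ n) (κ n) (b n) (c n) (z n)‖ + ε := by
  obtain ⟨C, hC0, hC⟩ := q.exists_preimage_norm_le hq
  choose L hL using fun a => q.exists_path_lift hq ⟨fun s => P s a, hP a⟩
  have hρ1 (t : T) : 0 < 1 + ρ t := by linarith [hρ t]
  have hρ1' (t : T) : 1 + ρ t ≠ 0 := (hρ1 t).ne'
  let τ (j : ℕ) : C(T, unitInterval) :=
    ⟨fun t => Set.projIcc 0 1 zero_le_one (j / (1 + ρ t)), by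
      refine continuous_projIcc.comp ?_
      fun_prop (disch := assumption)⟩
  have hτ0 (t : T) : τ 0 t = 0 := by
    change Set.projIcc 0 1 zero_le_one (((0 : ℕ) : ℝ) / (1 + ρ t)) = 0
    simp
  have hτ1 (j : ℕ) (t : T) (h : 1 + ρ t ≤ j) : τ j t = 1 :=
    Set.projIcc_of_right_le zero_le_one ((one_le_div (hρ1 t)).2 h)
  let ε (j : ℕ) : C(T, ℝ) := ⟨fun t => (1 / 2) ^ (j + 1) / (1 + ρ t), by
    fun_prop (disch := assumption)⟩
  have hε (j : ℕ) (t : T) : 0 < ε j t := by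
    have := hρ1 t
    change 0 < (1 / 2 : ℝ) ^ (j + 1) / (1 + ρ t)
    positivity
  let χ (j : ℕ) : C(T, ℝ) := ⟨fun t => max 0 (min 1 (ρ t + 2 - j)), by fun_prop⟩
  have step (j : ℕ) (x : {x : B → C(T, D) // ∀ a t, q (x a t) = P (τ j t) a}) :
      ∃ y : {y : B → C(T, D) // ∀ a t, q (y a t) = P (τ (j + 1) t) a},
        (∀ a t, ρ t + 2 ≤ j → y.1 a t = x.1 a t) ∧
        ∀ t (n : ℕ), (n : ℝ) ≤ ρ t →
        ‖relDefect (μ n) (ν n) (σ n) (κ n) (y.1 (b n) t) (y.1 (c n) t) (y.1 (z n) t)‖ ≤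
          max ‖relDefect (μ n) (ν n) (σ n) (κ n) (x.1 (b n) t) (x.1 (c n) t) (x.1 (z n) t)‖
            (C * ‖relDefect (μ n) (ν n) (σ n) (κ n) (b n) (c n) (z n)‖ + ε j t +
              ‖κ n‖ * (C * (‖P (τ (j + 1) t) (b n) - P (τ j t) (b n)‖ *
                ‖P (τ (j + 1) t) (c n) - P (τ j t) (c n)‖) + ε j t)) + ε j t := by
    obtain ⟨x, hx⟩ := x
    let x' (a : B) : C(T, D) := ⟨fun t => (χ j t : ℂ) • L a (τ (j + 1) t) +
      (1 - χ j t : ℂ) • x a t, by fun_prop⟩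
    have hx' (a : B) (t : T) : q (x' a t) = P (τ (j + 1) t) a := by
      have h1 : q (x' a t) = (χ j t : ℂ) • P (τ (j + 1) t) a +
          (1 - χ j t : ℂ) • P (τ j t) a := by
        change q ((χ j t : ℂ) • L a (τ (j + 1) t) + (1 - χ j t : ℂ) • x a t) = _
        rw [map_add, map_smul, map_smul, hx, hL]
        rfl
      rw [h1]
      rcases le_total (j : ℝ) (ρ t + 1) with h | h
      · have : χ j t = 1 := by
          change max 0 (min 1 (ρ t + 2 - j)) = 1
          rw [min_eq_left (by linarith), max_eq_right zero_le_one]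
        rw [this]
        simp
      · rw [hτ1 j t (by linarith), hτ1 (j + 1) t (by push_cast; linarith), ← add_smul]
        simp
    obtain ⟨y, hy, hyx, hyn⟩ := q.exists_lift_step hC0 hC ρ (ε j) (hε j) μ ν σ κ b c z
      (fun t => P (τ j t)) (fun t => P (τ (j + 1) t)) x x' hx hx'
    refine ⟨⟨y, hy⟩, fun a t h => hyx a t ?_, hyn⟩
    have h0 : χ j t = 0 := by
      change max 0 (min 1 (ρ t + 2 - j)) = 0
      exact max_eq_left ((min_le_right _ _).trans (by linarith))
    change (χ j t : ℂ) • L a (τ (j + 1) t) + (1 - χ j t : ℂ) • x a t = x a t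
    rw [h0]
    simp
  choose next hnext1 hnext2 using step
  let X : ∀ j : ℕ, {x : B → C(T, D) // ∀ a t, q (x a t) = P (τ j t) a} := fun j =>
    Nat.rec ⟨x₀, fun a t => by rw [hx₀, hτ0]⟩ next j
  have hconst (a : B) (t : T) (i j : ℕ) (hi : ρ t + 2 ≤ i) (hij : i ≤ j) :
      (X j).1 a t = (X i).1 a t := by
    induction j, hij using Nat.le_induction with
    | base => rfl
    | succ j hj ih => exact (hnext1 j (X j) a t (hi.trans (by exact_mod_cast hj))).trans ih
  let J (t : T) : ℕ := ⌈ρ t⌉₊ + 2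
  have hJ (t : T) : ρ t + 2 ≤ J t := by
    simp only [J]
    push_cast
    linarith [Nat.le_ceil (ρ t)]
  have hX (a : B) (t : T) (j : ℕ) (hj : ρ t + 2 ≤ j) : (X j).1 a t = (X (J t)).1 a t := by
    rcases le_total j (J t) with h | h
    · exact (hconst a t j (J t) hj h).symm
    · exact hconst a t (J t) j (hJ t) h
  refine ⟨fun a => ⟨fun t => (X (J t)).1 a t, continuous_iff_continuousAt.2 fun t₀ => ?_⟩,
    fun a t => ?_, max 1 C, by positivity, fun n δ hδ => ?_⟩
  · obtain ⟨j, hj⟩ := exists_nat_ge (ρ t₀ + 3)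
    have h1 : (fun t => (X j).1 a t) =ᶠ[𝓝 t₀] fun t => (X (J t)).1 a t := by
      filter_upwards [(ρ.continuous.tendsto t₀).eventually_lt_const
        (show ρ t₀ < ρ t₀ + 1 by linarith)] with t ht
      exact hX a t j (by linarith)
    exact (((X j).1 a).continuous.continuousAt).congr h1
  · change q ((X (J t)).1 a t) = _
    rw [(X (J t)).2 a t, hτ1 _ t (by linarith [hJ t])]
  · set A := ‖relDefect (μ n) (ν n) (σ n) (κ n) (b n) (c n) (z n)‖ with hA
    obtain ⟨η, hη0, hη⟩ : ∃ η > 0, η + η + ‖κ n‖ * (C * (η * η) + η) ≤ δ ∧ η + η ≤ δ := by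
      have hc : Continuous fun η : ℝ => η + η + ‖κ n‖ * (C * (η * η) + η) := by fun_prop
      have h1 := (hc.tendsto 0).eventually_lt_const (u := δ) (by simpa using hδ)
      have hc2 : Continuous fun η : ℝ => η + η := by fun_prop
      have h2 := (hc2.tendsto 0).eventually_lt_const (u := δ) (by simpa using hδ)
      obtain ⟨η, ⟨h3, h4⟩, h5⟩ := (((h1.and h2).filter_mono nhdsWithin_le_nhds).and
        (self_mem_nhdsWithin (s := Set.Ioi (0 : ℝ)))).exists
      exact ⟨η, h5, h3.le, h4.le⟩
    have hev (a : B) : ∀ᶠ t in comap ρ atTop, ∀ j : ℕ,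
        ‖P (τ (j + 1) t) a - P (τ j t) a‖ ≤ η := by
      obtain ⟨θ, hθ, hθ'⟩ := Metric.uniformContinuous_iff.1
        (CompactSpace.uniformContinuous_of_continuous (hP a)) η hη0
      filter_upwards [(tendsto_comap (f := ρ) (x := atTop)).eventually_gt_atTop (1 / θ)]
        with t ht j
      rw [← dist_eq_norm]
      refine (hθ' ?_).le
      refine lt_of_le_of_lt (b := 1 / (1 + ρ t)) ?_ ?_
      · have h1 := (LipschitzWith.projIcc (zero_le_one (α := ℝ))).dist_le_mul
          (((j + 1 : ℕ) : ℝ) / (1 + ρ t)) ((j : ℝ) / (1 + ρ t))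
        refine h1.trans (le_of_eq ?_)
        rw [NNReal.coe_one, one_mul, Real.dist_eq, ← sub_div]
        push_cast
        rw [add_sub_cancel_left, abs_of_pos (by have := hρ1 t; positivity)]
      · rw [div_lt_comm₀ (hρ1 t) hθ]
        linarith
    have hρη : ∀ᶠ t in comap ρ atTop, 1 / (1 + ρ t) ≤ η := by
      filter_upwards [(tendsto_comap (f := ρ) (x := atTop)).eventually_gt_atTop (1 / η)] with t ht
      rw [div_le_comm₀ (hρ1 t) hη0]
      linarith
    filter_upwards [hev (b n), hev (c n), hρη, h₀ n η hη0,
      (tendsto_comap (f := ρ) (x := atTop)).eventually_ge_atTop (n : ℝ)] with t hb hc hr hi hn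
    set U := max (A + η) (C * A + η + ‖κ n‖ * (C * (η * η) + η)) with hU
    have ind (j : ℕ) : ‖relDefect (μ n) (ν n) (σ n) (κ n) ((X j).1 (b n) t) ((X j).1 (c n) t)
        ((X j).1 (z n) t)‖ ≤ U + (1 - (1 / 2) ^ j) * η := by
      induction j with
      | zero =>
        rw [pow_zero, sub_self, zero_mul, add_zero]
        exact hi.trans (le_max_left _ _)
      | succ j ih =>
        have hε1 : ε j t ≤ (1 / 2) ^ (j + 1) * η := by
          change (1 / 2 : ℝ) ^ (j + 1) / (1 + ρ t) ≤ _
          rw [div_eq_mul_one_div]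
          gcongr
        have hp : (1 / 2 : ℝ) ^ j ≤ 1 := pow_le_one₀ (by norm_num) (by norm_num)
        have hp0 : (0 : ℝ) < (1 / 2) ^ j := by positivity
        have hε2 : ε j t ≤ η := by
          rw [pow_succ] at hε1
          nlinarith
        refine (hnext2 j (X j) t n hn).trans ?_
        have h2 : C * A + ε j t + ‖κ n‖ * (C * (‖P (τ (j + 1) t) (b n) - P (τ j t) (b n)‖ *
                ‖P (τ (j + 1) t) (c n) - P (τ j t) (c n)‖) + ε j t) ≤ U := by
          refine le_trans ?_ (le_max_right _ _)
          gcongr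
          exacts [hb j, hc j]
        have h3 : 0 ≤ (1 - (1 / 2 : ℝ) ^ j) * η := mul_nonneg (by linarith) hη0.le
        refine (add_le_add (max_le ih (h2.trans (by linarith))) hε1).trans (le_of_eq ?_)
        ring
    refine (ind (J t)).trans ?_
    have h1 : (1 - (1 / 2 : ℝ) ^ (J t)) * η ≤ η := by
      have : (0 : ℝ) < (1 / 2) ^ (J t) := by positivity
      nlinarith
    have h2 : U ≤ max 1 C * A + (δ - η) := by
      have hA0 : 0 ≤ A := norm_nonneg _
      refine max_le ?_ ?_
      · have := mul_le_mul_of_nonneg_right (le_max_left 1 C) hA0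
        linarith [hη.2]
      · have := mul_le_mul_of_nonneg_right (le_max_right 1 C) hA0
        linarith [hη.1]
    linarith

end Iteration

section Extension

lemma norm_relDefect_sub_relDefect_le {A : Type*} [NonUnitalCStarAlgebra A]
    {μ ν σ κ μ' ν' σ' κ' : ℂ} {x y z x' y' z' : A} {θ M : ℝ} (hμ : ‖μ - μ'‖ ≤ θ)
    (hν : ‖ν - ν'‖ ≤ θ) (hσ : ‖σ - σ'‖ ≤ θ) (hκ : ‖κ - κ'‖ ≤ θ) (hx : ‖x - x'‖ ≤ θ)
    (hy : ‖y - y'‖ ≤ θ) (hz : ‖z - z'‖ ≤ θ) (hyM : ‖y‖ ≤ M) (hxM : ‖x'‖ ≤ M) (hyM' : ‖y'‖ ≤ M) :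
    ‖relDefect μ ν σ κ x y z - relDefect μ' ν' σ' κ' x' y' z'‖ ≤
      θ * (1 + ‖μ‖ + ‖ν‖ + ‖σ‖ + 3 * M + 2 * ‖κ‖ * M + M * M) := by
  have hθ : 0 ≤ θ := (norm_nonneg _).trans hx
  have hM : 0 ≤ M := (norm_nonneg _).trans hxM
  have e : relDefect μ ν σ κ x y z - relDefect μ' ν' σ' κ' x' y' z' =
      (z - z') - (μ • (x - x') + (μ - μ') • x') - (ν • (y - y') + (ν - ν') • y')
        - (σ • star (x - x') + (σ - σ') • star x')
        - (κ • ((x - x') * y + x' * (y - y')) + (κ - κ') • (x' * y')) := by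
    simp only [relDefect, smul_sub, sub_smul, star_sub, sub_mul, mul_sub, smul_add]
    abel
  have a1 : ‖μ • (x - x') + (μ - μ') • x'‖ ≤ ‖μ‖ * θ + θ * M := by
    refine norm_add_le_of_le ?_ ?_ <;> rw [norm_smul] <;> gcongr
  have a2 : ‖ν • (y - y') + (ν - ν') • y'‖ ≤ ‖ν‖ * θ + θ * M := by
    refine norm_add_le_of_le ?_ ?_ <;> rw [norm_smul] <;> gcongr
  have a3 : ‖σ • star (x - x') + (σ - σ') • star x'‖ ≤ ‖σ‖ * θ + θ * M := by
    refine norm_add_le_of_le ?_ ?_ <;> rw [norm_smul, norm_star] <;> gcongr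
  have a4 : ‖κ • ((x - x') * y + x' * (y - y')) + (κ - κ') • (x' * y')‖ ≤
      ‖κ‖ * (θ * M + M * θ) + θ * (M * M) := by
    refine norm_add_le_of_le ?_ ?_ <;> rw [norm_smul]
    · gcongr
      exact norm_add_le_of_le (norm_mul_le_of_le hx hyM) (norm_mul_le_of_le hxM hy)
    · gcongr
      exact norm_mul_le_of_le hxM hyM'
  rw [e]
  have b1 := norm_sub_le (z - z') (μ • (x - x') + (μ - μ') • x')
  have b2 := norm_sub_le ((z - z') - (μ • (x - x') + (μ - μ') • x'))
    (ν • (y - y') + (ν - ν') • y')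
  have b3 := norm_sub_le ((z - z') - (μ • (x - x') + (μ - μ') • x')
    - (ν • (y - y') + (ν - ν') • y')) (σ • star (x - x') + (σ - σ') • star x')
  have b4 := norm_sub_le ((z - z') - (μ • (x - x') + (μ - μ') • x')
    - (ν • (y - y') + (ν - ν') • y') - (σ • star (x - x') + (σ - σ') • star x'))
    (κ • ((x - x') * y + x' * (y - y')) + (κ - κ') • (x' * y'))
  linarith

variable {B D Q T : Type*} [NonUnitalCStarAlgebra B] [CStarAlgebra D] [CStarAlgebra Q]
  [TopologicalSpace T]

/-- A sequence of lifts which is asymptotically geometrically Cauchy has an asymptotic limit. -/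
lemma StarAlgHom.exists_lift_limit (q : D →⋆ₐ[ℂ] Q) {l : Filter T} (h : ℕ → C(T, D)) (y : Q)
    (hy : ∀ n t, q (h n t) = y)
    (hh : ∀ n, ∀ᶠ t in l, ‖h (n + 1) t - h n t‖ ≤ (1 / 2) ^ n) :
    ∃ H : C(T, D), (∀ t, q (H t) = y) ∧ ∀ n, ∀ᶠ t in l, ‖H t - h n t‖ ≤ 2 * (1 / 2) ^ n := by
  let r (n : ℕ) : ℝ := (1 / 2) ^ n
  have hr (n : ℕ) : 0 < r n := by positivity
  have hrm (n : ℕ) (s : ℝ) : 0 < max (r n) s := lt_max_of_lt_left (hr n)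
  let k (n : ℕ) (t : T) : D :=
    ((r n / max (r n) ‖h (n + 1) t - h n t‖ : ℝ) : ℂ) • (h (n + 1) t - h n t)
  have hk (n : ℕ) (t : T) : ‖k n t‖ ≤ r n := by
    simp only [k]
    rw [norm_smul, Complex.norm_real, Real.norm_of_nonneg (by have := hr n; positivity),
      div_mul_eq_mul_div, div_le_iff₀ (hrm n _)]
    exact mul_le_mul_of_nonneg_left (le_max_right _ _) (hr n).le
  have hsr : Summable r := summable_geometric_two
  have hsk (t : T) : Summable fun n => k n t := .of_norm_bounded hsr fun n => hk n t
  have hkc (n : ℕ) : Continuous (k n) := by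
    have : ∀ t, max (r n) ‖h (n + 1) t - h n t‖ ≠ 0 := fun t => (hrm n _).ne'
    simp only [k]
    fun_prop (disch := assumption)
  have hqk (n : ℕ) (t : T) : q (k n t) = 0 := by simp [k, hy]
  refine ⟨⟨fun t => h 0 t + ∑' n, k n t,
    (h 0).continuous.add (continuous_tsum hkc hsr hk)⟩, fun t => ?_, fun n => ?_⟩
  · have h1 : q (∑' n, k n t) = 0 := by
      have h2 := ((hsk t).hasSum.map q q.continuous_of_cstar)
      have h3 : (q ∘ fun n => k n t) = fun _ => 0 := by ext n; exact hqk n t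
      rw [h3] at h2
      exact h2.unique hasSum_zero
    change q (h 0 t + _) = y
    rw [map_add, h1, hy, add_zero]
  · filter_upwards [(Set.finite_lt_nat n).eventually_all.2 fun i _ => hh i] with t ht
    have h1 : ∀ i < n, k i t = h (i + 1) t - h i t := fun i hi => by
      simp only [k]
      rw [max_eq_left (ht i hi), div_self (hr i).ne', Complex.ofReal_one, one_smul]
    have h2 : h 0 t + ∑' i, k i t - h n t = ∑' i, k (i + n) t := by
      rw [← (hsk t).sum_add_tsum_nat_add n,
        Finset.sum_congr rfl fun i hi => h1 i (Finset.mem_range.1 hi),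
        Finset.sum_range_sub (fun i => h i t)]
      abel
    change ‖h 0 t + ∑' i, k i t - h n t‖ ≤ _
    rw [h2]
    have h3 : HasSum (fun i => r (i + n)) (2 * (1 / 2) ^ n) := by
      simp only [r, pow_add]
      exact hasSum_geometric_two.mul_right _
    exact tsum_of_norm_bounded h3 fun i => hk _ _

/-- Extending a family of lifts from a dense subset. -/
lemma StarAlgHom.exists_lift_extension (q : D →⋆ₐ[ℂ] Q) (hq : Function.Surjective q)
    {l : Filter T} (g : B →⋆ₙₐ[ℂ] Q) (G : B → C(T, D)) (hG : ∀ a t, q (G a t) = g a)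
    {S : Set B} (hS : Dense S) {C : ℝ} (hC : 0 < C)
    (hGS : ∀ a ∈ S, ∀ b ∈ S, ∀ ε > 0, ∀ᶠ t in l, ‖G a t - G b t‖ ≤ C * ‖a - b‖ + ε) (b : B) :
    ∃ H : C(T, D), (∀ t, q (H t) = g b) ∧
      ∀ ε > 0, ∃ c ∈ S, ‖b - c‖ ≤ ε ∧ ∀ᶠ t in l, ‖H t - G c t‖ ≤ ε := by
  obtain ⟨C', hC'0, hC'⟩ := q.exists_preimage_norm_le hq
  set s : ℝ := 1 / (8 * (C + C' + 1)) with hs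
  have hs0 : 0 < s := by positivity
  have hsC : s * (C + C' + 1) = 1 / 8 := by rw [hs]; field_simp
  have hc (n : ℕ) : ∃ c ∈ S, ‖b - c‖ ≤ s * (1 / 2) ^ n := by
    obtain ⟨c, hc, hcb⟩ := Metric.dense_iff.1 hS b (s * (1 / 2) ^ n) (by positivity)
    exact ⟨c, hcb, by rw [← dist_eq_norm']; exact (Metric.mem_ball.1 hc).le⟩
  choose c hcS hcb using hc
  choose L hL hLn using fun n => hC' (g (b - c n))
  have hLs (n : ℕ) : ‖L n‖ ≤ C' * (s * (1 / 2) ^ n) := by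
    refine (hLn n).trans ?_
    gcongr
    exact (NonUnitalStarAlgHom.norm_apply_le g _).trans (hcb n)
  obtain ⟨H, hH, hHn⟩ := q.exists_lift_limit (l := l) (fun n => G (c n) + .const T (L n)) (g b)
    (fun n t => by simp [hG, hL])
    (fun n => by
      have hp : (0 : ℝ) < (1 / 2) ^ n := by positivity
      filter_upwards [hGS _ (hcS (n + 1)) _ (hcS n) ((1 / 2) ^ n / 2) (by positivity)] with t ht
      have e : (G (c (n + 1)) + .const T (L (n + 1))) t - (G (c n) + .const T (L n)) t =
          (G (c (n + 1)) t - G (c n) t) + L (n + 1) - L n := by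
        simp only [ContinuousMap.add_apply, ContinuousMap.const_apply]
        abel
      rw [e]
      have h1 : ‖c (n + 1) - c n‖ ≤ 2 * (s * (1 / 2) ^ n) := by
        have e2 : c (n + 1) - c n = (b - c n) - (b - c (n + 1)) := by abel
        rw [e2]
        have := hcb (n + 1)
        rw [pow_succ] at this
        have hsp : 0 < s * (1 / 2) ^ n := by positivity
        linarith [norm_sub_le (b - c n) (b - c (n + 1)), hcb n]
      have h2 : C * ‖c (n + 1) - c n‖ ≤ C * (2 * (s * (1 / 2) ^ n)) := by gcongr
      have h3 := hLs (n + 1)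
      have h4 := hLs n
      rw [pow_succ] at h3
      have h5 := norm_sub_le ((G (c (n + 1)) t - G (c n) t) + L (n + 1)) (L n)
      have h6 := norm_add_le (G (c (n + 1)) t - G (c n) t) (L (n + 1))
      have h7 : s * (C + C' + 1) * (1 / 2) ^ n = 1 / 8 * (1 / 2) ^ n := by rw [hsC]
      have h8 : 0 < C * s * (1 / 2) ^ n := by positivity
      have h9 : 0 < C' * s * (1 / 2) ^ n := by positivity
      have h10 : 0 < s * (1 / 2) ^ n := by positivity
      nlinarith)
  refine ⟨H, hH, fun ε hε => ?_⟩
  obtain ⟨n, hn⟩ := exists_pow_lt_of_lt_one (show 0 < ε / 3 by positivity)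
    (show (1 / 2 : ℝ) < 1 by norm_num)
  have hp : (0 : ℝ) < (1 / 2) ^ n := by positivity
  have hs1 : s ≤ 1 := by nlinarith
  have hs2 : C' * s ≤ 1 := by nlinarith
  refine ⟨c n, hcS n, ?_, ?_⟩
  · have := hcb n
    nlinarith
  · filter_upwards [hHn n] with t ht
    have e : H t - G (c n) t = (H t - (G (c n) + .const T (L n)) t) + L n := by
      simp only [ContinuousMap.add_apply, ContinuousMap.const_apply]
      abel
    rw [e]
    have h1 := norm_add_le (H t - (G (c n) + .const T (L n)) t) (L n)
    have h2 := hLs n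
    nlinarith

end Extension

section UnitalLifting

variable {B D Q T : Type*} [NonUnitalCStarAlgebra B] [TopologicalSpace.SeparableSpace B]
  [CStarAlgebra D] [CStarAlgebra Q] [TopologicalSpace T] [T2Space T] [ParacompactSpace T]

/-- If the initial point of a path of `⋆`-homomorphisms lifts to an asymptotic homomorphism, then so
does its endpoint. -/
theorem StarAlgHom.exists_asymptotic_lift_of_path (q : D →⋆ₐ[ℂ] Q) (hq : Function.Surjective q)
    (ρ : C(T, ℝ)) (hρ : ∀ t, 0 ≤ ρ t) (P : unitInterval → B →⋆ₙₐ[ℂ] Q)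
    (hP : ∀ a, Continuous fun s => P s a) (ψ : B → C(T, D)) (hψq : ∀ a t, q (ψ a t) = P 0 a)
    (hψ : IsAsymptoticAlong (comap ρ atTop) fun t a => ψ a t) :
    ∃ H : B → C(T, D), (∀ a t, q (H a t) = P 1 a) ∧
      IsAsymptoticAlong (comap ρ atTop) (fun t a => H a t) ∧
      ∀ a, ∃ M, ∀ᶠ t in comap ρ atTop, ‖H a t‖ ≤ M := by
  obtain ⟨S, hSc, hSd⟩ := TopologicalSpace.exists_countable_dense B
  obtain ⟨K₀, hK₀c, hK₀d⟩ := TopologicalSpace.exists_countable_dense ℂ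
  set K : Set ℂ := insert 0 (insert 1 K₀) with hK
  have hKd : Dense K := hK₀d.mono ((Set.subset_insert _ _).trans (Set.subset_insert _ _))
  have hKc : K.Countable := (hK₀c.insert 1).insert 0
  have hK0 : (0 : ℂ) ∈ K := by simp [hK]
  have hK1 : (1 : ℂ) ∈ K := by simp [hK]
  have := hSc.to_subtype
  have := hKc.to_subtype
  have : Nonempty S := hSd.nonempty.to_subtype
  have : Nonempty K := ⟨⟨0, hK0⟩⟩
  obtain ⟨e, he⟩ := exists_surjective_nat ((S × S × S) × K × K × K × K)
  obtain ⟨G, hGq, C, hC, hG⟩ := q.exists_lift_of_path hq ρ hρ (fun n => (e n).2.1)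
    (fun n => (e n).2.2.1) (fun n => (e n).2.2.2.1) (fun n => (e n).2.2.2.2)
    (fun n => ((e n).1.1 : B)) (fun n => (e n).1.2.1) (fun n => (e n).1.2.2) P hP ψ hψq
    (fun n ε hε => hψ.eventually_norm_relDefect_le _ _ _ _ _ _ _ hε)
  have hG' {μ ν σ κ : ℂ} {a b z : B} (hμ : μ ∈ K) (hν : ν ∈ K) (hσ : σ ∈ K) (hκ : κ ∈ K)
      (ha : a ∈ S) (hb : b ∈ S) (hz : z ∈ S) {ε : ℝ} (hε : 0 < ε) : ∀ᶠ t in comap ρ atTop,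
      ‖relDefect μ ν σ κ (G a t) (G b t) (G z t)‖ ≤ C * ‖relDefect μ ν σ κ a b z‖ + ε := by
    obtain ⟨n, hn⟩ := he ((⟨a, ha⟩, ⟨b, hb⟩, ⟨z, hz⟩), ⟨μ, hμ⟩, ⟨ν, hν⟩, ⟨σ, hσ⟩, ⟨κ, hκ⟩)
    have := hG n ε hε
    rwa [hn] at this
  have hGS : ∀ a ∈ S, ∀ b ∈ S, ∀ ε > 0, ∀ᶠ t in comap ρ atTop,
      ‖G a t - G b t‖ ≤ C * ‖a - b‖ + ε := fun a ha b hb ε hε => by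
    simpa [relDefect] using hG' hK1 hK0 hK0 hK0 hb hb ha hε
  have hGb : ∀ a ∈ S, ∀ᶠ t in comap ρ atTop, ‖G a t‖ ≤ C * ‖a‖ + 1 := fun a ha => by
    simpa [relDefect] using hG' hK0 hK0 hK0 hK0 ha ha ha one_pos
  choose H hHq hH using q.exists_lift_extension hq (P 1) G hGq hSd hC hGS
  have hHb (a : B) : ∃ M, ∀ᶠ t in comap ρ atTop, ‖H a t‖ ≤ M := by
    obtain ⟨c, hc, -, hc'⟩ := hH a 1 one_pos
    refine ⟨1 + (C * ‖c‖ + 1), ?_⟩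
    filter_upwards [hc', hGb c hc] with t h1 h2
    linarith [norm_le_norm_add_norm_sub' (H a t) (G c t)]
  have key {μ ν σ κ : ℂ} {a b z : B} (h0 : relDefect μ ν σ κ a b z = 0) :
      Tendsto (fun t => ‖relDefect μ ν σ κ (H a t) (H b t) (H z t)‖) (comap ρ atTop) (𝓝 0) := by
    obtain ⟨Ma, hMa⟩ := hHb a
    obtain ⟨Mb, hMb⟩ := hHb b
    set M := |Ma| + |Mb| + ‖a‖ + ‖b‖ + 1 with hM
    have hMa' : Ma ≤ |Ma| := le_abs_self _
    have hMb' : Mb ≤ |Mb| := le_abs_self _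
    have hMa0 := abs_nonneg Ma
    have hMb0 := abs_nonneg Mb
    have ha0 := norm_nonneg a
    have hb0 := norm_nonneg b
    set R := 1 + ‖μ‖ + ‖ν‖ + ‖σ‖ + 3 * M + 2 * ‖κ‖ * M + M * M with hR
    have hR0 : 0 < R := by positivity
    refine (Metric.tendsto_nhds).2 fun ε hε => ?_
    obtain ⟨θ, hθ0, hθ1, hθ⟩ : ∃ θ > 0, θ ≤ 1 ∧ (1 + C) * (θ * R) ≤ ε / 3 := by
      refine ⟨min 1 (ε / (3 * ((1 + C) * R))), by positivity, min_le_left _ _, ?_⟩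
      calc (1 + C) * (min 1 (ε / (3 * ((1 + C) * R))) * R)
          ≤ (1 + C) * (ε / (3 * ((1 + C) * R)) * R) := by gcongr; exact min_le_right _ _
        _ = ε / 3 := by field_simp
    have hk (x : ℂ) : ∃ y ∈ K, ‖x - y‖ ≤ θ := by
      obtain ⟨y, hy, hyK⟩ := Metric.dense_iff.1 hKd x θ hθ0
      exact ⟨y, hyK, by rw [← dist_eq_norm']; exact (Metric.mem_ball.1 hy).le⟩
    obtain ⟨μ', hμ', dμ⟩ := hk μ
    obtain ⟨ν', hν', dν⟩ := hk ν
    obtain ⟨σ', hσ', dσ⟩ := hk σ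
    obtain ⟨κ', hκ', dκ⟩ := hk κ
    obtain ⟨a', ha', da, ea⟩ := hH a θ hθ0
    obtain ⟨b', hb', db, eb⟩ := hH b θ hθ0
    obtain ⟨z', hz', dz, ez⟩ := hH z θ hθ0
    have hB : ‖relDefect μ' ν' σ' κ' a' b' z'‖ ≤ θ * R := by
      have h1 := norm_relDefect_sub_relDefect_le dμ dν dσ dκ da db dz (M := M) (by linarith)
        (by linarith [norm_le_norm_add_norm_sub a a'])
        (by linarith [norm_le_norm_add_norm_sub b b'])
      rwa [h0, zero_sub, norm_neg] at h1
    filter_upwards [ea, eb, ez, hMa, hMb, hG' hμ' hν' hσ' hκ' ha' hb' hz' (half_pos hε)]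
      with t h1 h2 h3 h4 h5 h6
    have h7 := norm_relDefect_sub_relDefect_le dμ dν dσ dκ h1 h2 h3 (M := M) (by linarith)
      (by linarith [norm_le_norm_add_norm_sub (H a t) (G a' t)])
      (by linarith [norm_le_norm_add_norm_sub (H b t) (G b' t)])
    have h8 := norm_le_norm_add_norm_sub' (relDefect μ ν σ κ (H a t) (H b t) (H z t))
      (relDefect μ' ν' σ' κ' (G a' t) (G b' t) (G z' t))
    have h9 : C * ‖relDefect μ' ν' σ' κ' a' b' z'‖ ≤ C * (θ * R) := by gcongr
    rw [dist_zero_right, norm_norm]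
    linarith
  refine ⟨H, hHq, ⟨fun a b => ?_, fun μ₁ μ₂ a b => ?_, fun a => ?_⟩, hHb⟩
  · simpa [relDefect] using key (μ := 0) (ν := 0) (σ := 0) (κ := 1) (a := a) (b := b)
      (z := a * b) (by simp [relDefect])
  · simpa [relDefect, sub_sub] using key (μ := μ₁) (ν := μ₂) (σ := 0) (κ := 0) (a := a) (b := b)
      (z := μ₁ • a + μ₂ • b) (by simp [relDefect])
  · simpa [relDefect] using key (μ := 0) (ν := 0) (σ := 1) (κ := 0) (a := a) (b := a)
      (z := star a) (by simp [relDefect])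

end UnitalLifting

section HomotopyLifting

variable {T B D Q : Type*} [NonUnitalCStarAlgebra B] [NonUnitalCStarAlgebra D]
  [NonUnitalCStarAlgebra Q]

lemma isAsymptoticAlong_inr_iff {l : Filter T} {f : T → B → D} :
    IsAsymptoticAlong l (fun t a => (f t a : Unitization ℂ D)) ↔ IsAsymptoticAlong l f := by
  have hm (a b) (t : T) : ‖(f t (a * b) : Unitization ℂ D) - f t a * f t b‖
      = ‖f t (a * b) - f t a * f t b‖ := by
    rw [← Unitization.inr_mul, ← Unitization.inr_sub, Unitization.norm_inr]
  have hl (μ₁ μ₂ : ℂ) (a b) (t : T) :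
      ‖(f t (μ₁ • a + μ₂ • b) : Unitization ℂ D) - (μ₁ • (f t a : Unitization ℂ D)
        + μ₂ • (f t b : Unitization ℂ D))‖
      = ‖f t (μ₁ • a + μ₂ • b) - (μ₁ • f t a + μ₂ • f t b)‖ := by
    rw [← Unitization.inr_smul, ← Unitization.inr_smul, ← Unitization.inr_add,
      ← Unitization.inr_sub, Unitization.norm_inr]
  have hs (a) (t : T) : ‖(f t (star a) : Unitization ℂ D) - star (f t a : Unitization ℂ D)‖
      = ‖f t (star a) - star (f t a)‖ := by
    rw [← Unitization.inr_star, ← Unitization.inr_sub, Unitization.norm_inr]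
  refine ⟨fun h => ⟨fun a b => ?_, fun μ₁ μ₂ a b => ?_, fun a => ?_⟩,
    fun h => ⟨fun a b => ?_, fun μ₁ μ₂ a b => ?_, fun a => ?_⟩⟩
  · simpa only [hm] using h.mul a b
  · simpa only [hl] using h.lin μ₁ μ₂ a b
  · simpa only [hs] using h.star_defect a
  · simpa only [hm] using h.mul a b
  · simpa only [hl] using h.lin μ₁ μ₂ a b
  · simpa only [hs] using h.star_defect a

lemma IsAsymptoticAlong.comp_starAlgHom {A : Type*} [NonUnitalCStarAlgebra A] {l : Filter T}
    {f : T → A → D} (hf : IsAsymptoticAlong l f) (β : B →⋆ₙₐ[ℂ] A) :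
    IsAsymptoticAlong l fun t b => f t (β b) where
  mul a b := by simpa only [map_mul] using hf.mul (β a) (β b)
  lin μ₁ μ₂ a b := by simpa only [map_add, map_smul] using hf.lin μ₁ μ₂ (β a) (β b)
  star_defect a := by simpa only [map_star] using hf.star_defect (β a)

/-- Asymptotic lifts can be transported along a homotopy of ⋆-homomorphisms. -/
theorem NonUnitalStarAlgHom.exists_asymptotic_lift_of_path
    [TopologicalSpace.SeparableSpace B] [TopologicalSpace T] [T2Space T] [ParacompactSpace T]
    (q : D →⋆ₙₐ[ℂ] Q) (hq : Function.Surjective q) (ρ : C(T, ℝ)) (hρ : ∀ t, 0 ≤ ρ t)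
    (P : unitInterval → B →⋆ₙₐ[ℂ] Q) (hP : ∀ a, Continuous fun s => P s a)
    (ψ : B → C(T, D)) (hψq : ∀ a t, q (ψ a t) = P 0 a)
    (hψ : IsAsymptoticAlong (comap ρ atTop) fun t a => ψ a t) :
    ∃ H : B → C(T, D), (∀ a t, q (H a t) = P 1 a) ∧
      IsAsymptoticAlong (comap ρ atTop) (fun t a => H a t) ∧
      ∀ a, ∃ M, ∀ᶠ t in comap ρ atTop, ‖H a t‖ ≤ M := by
  obtain ⟨G, hGq, hG, hGb⟩ := (Unitization.starMap q).exists_asymptotic_lift_of_path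
    (Unitization.starMap_surjective hq) ρ hρ
    (fun s => (Unitization.inrNonUnitalStarAlgHom ℂ Q).comp (P s))
    (fun a => Unitization.continuous_inr.comp (hP a))
    (fun a => ⟨fun t => (ψ a t : Unitization ℂ D),
      Unitization.continuous_inr.comp (ψ a).continuous⟩)
    (fun a t => by simp [hψq]) (isAsymptoticAlong_inr_iff.2 hψ)
  have hGq' (a t) : Unitization.starMap q (G a t) = (P 1 a : Unitization ℂ Q) := hGq a t
  have hG' (a t) : ((G a t).snd : Unitization ℂ D) = G a t := by
    refine Unitization.ext ?_ rfl
    simpa [Unitization.algebraMap_eq_inl] using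
      (congrArg (fun x : Unitization ℂ Q => x.fst) (hGq' a t)).symm
  refine ⟨fun a => ⟨fun t => (G a t).snd, Unitization.continuous_snd.comp (G a).continuous⟩,
    fun a t => ?_, ?_, fun a => ?_⟩
  · have h := hGq' a t
    rw [← hG', Unitization.starMap_inr] at h
    exact Unitization.inr_injective h
  · refine isAsymptoticAlong_inr_iff.1 ?_
    simpa only [ContinuousMap.coe_mk, hG'] using hG
  · obtain ⟨M, hM⟩ := hGb a
    refine ⟨M, hM.mono fun t ht => ?_⟩
    rwa [ContinuousMap.coe_mk, ← Unitization.norm_inr (𝕜 := ℂ), hG']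

/-- Asymptotic lifts along a filter `comap ρ atTop` pass to homotopy dominated C⋆-algebras. -/
theorem AreHomotopic.exists_asymptotic_lift {A : Type*} [NonUnitalCStarAlgebra A]
    [TopologicalSpace.SeparableSpace B] [TopologicalSpace T] [T2Space T] [ParacompactSpace T]
    {q : D →⋆ₙₐ[ℂ] Q} (hq : Function.Surjective q) {α : A →⋆ₙₐ[ℂ] B} {β : B →⋆ₙₐ[ℂ] A}
    (hdom : AreHomotopic (α.comp β) (NonUnitalStarAlgHom.id ℂ B))
    (ρ : C(T, ℝ)) (hρ : ∀ t, 0 ≤ ρ t) (g : B →⋆ₙₐ[ℂ] Q) (F : A → C(T, D))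
    (hFq : ∀ a t, q (F a t) = g (α a))
    (hF : IsAsymptoticAlong (comap ρ atTop) fun t a => F a t) :
    ∃ H : B → C(T, D), (∀ b t, q (H b t) = g b) ∧
      IsAsymptoticAlong (comap ρ atTop) (fun t b => H b t) ∧
      ∀ b, ∃ M, ∀ᶠ t in comap ρ atTop, ‖H b t‖ ≤ M := by
  obtain ⟨Φ, hΦ0, hΦ1⟩ := hdom
  let ev (s : unitInterval) : B →⋆ₙₐ[ℂ] B :=
    { toFun b := Φ b s
      map_smul' c b := by simp
      map_zero' := by simp
      map_add' a b := by simp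
      map_mul' a b := by simp
      map_star' a := by simp [map_star] }
  have hev (s b) : ev s b = Φ b s := rfl
  have hg : Continuous g := AddMonoidHomClass.continuous_of_bound g 1 fun b => by
    simpa using NonUnitalStarAlgHom.norm_apply_le g b
  obtain ⟨H, hHq, hH⟩ := q.exists_asymptotic_lift_of_path hq ρ hρ
    (fun s => g.comp (ev (unitInterval.symm s)))
    (fun b => hg.comp ((Φ b).continuous.comp unitInterval.continuous_symm))
    (fun b => F (β b)) (fun b t => by simp [hev, hFq, hΦ1]) (hF.comp_starAlgHom β)
  exact ⟨H, fun b t => by simp [hHq, hev, hΦ0], hH⟩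

end HomotopyLifting

/-- If `A` homotopy dominates `B` (there are ∗-homomorphisms `α : A → B`, `β : B → A` with
`α∘β` homotopic to `id_B`) and every ∗-homomorphism `A → D/I` lifts to a (discrete) asymptotic
homomorphism `A → D`, then every ∗-homomorphism `B → D/I` lifts to a (discrete) asymptotic
homomorphism `B → D`.  Here the quotient map `q : D → D/I` is modelled as a surjective
∗-homomorphism onto `Q`. -/
theorem lifting_of_homotopy_dominated
    {A B D Q : Type*} [NonUnitalCStarAlgebra A] [NonUnitalCStarAlgebra B]
    [NonUnitalCStarAlgebra D] [NonUnitalCStarAlgebra Q]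
    [TopologicalSpace.SeparableSpace A] [TopologicalSpace.SeparableSpace B]
    (q : D →⋆ₙₐ[ℂ] Q) (hq : Function.Surjective q)
    (α : A →⋆ₙₐ[ℂ] B) (β : B →⋆ₙₐ[ℂ] A)
    (hdom : AreHomotopic (α.comp β) (NonUnitalStarAlgHom.id ℂ B)) :
    -- continuous version
    ((∀ f : A →⋆ₙₐ[ℂ] Q, ∃ F : NNReal → A → D, IsAsymptoticHom F ∧ ∀ t a, q (F t a) = f a) →
      ∀ g : B →⋆ₙₐ[ℂ] Q, ∃ G : NNReal → B → D, IsAsymptoticHom G ∧ ∀ t b, q (G t b) = g b) ∧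
    -- discrete version
    ((∀ f : A →⋆ₙₐ[ℂ] Q, ∃ F : ℕ → A → D, IsDiscreteAsymptoticHom F ∧ ∀ n a, q (F n a) = f a) →
      ∀ g : B →⋆ₙₐ[ℂ] Q, ∃ G : ℕ → B → D, IsDiscreteAsymptoticHom G ∧ ∀ n b, q (G n b) = g b) := by
  refine ⟨fun h g => ?_, fun h g => ?_⟩
  · obtain ⟨F, ⟨hFc, hFm, hFl, hFs⟩, hFq⟩ := h (g.comp α)
    have hT : comap (ContinuousMap.coeNNRealReal) (atTop : Filter ℝ) = atTop :=
      NNReal.comap_coe_atTop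
    obtain ⟨H, hHq, hH, -⟩ := hdom.exists_asymptotic_lift hq ContinuousMap.coeNNRealReal
      (fun t => t.coe_nonneg) g (fun a => ⟨fun t => F t a, hFc a⟩) (fun a t => hFq t a)
      (by rw [hT]; exact ⟨hFm, hFl, hFs⟩)
    rw [hT] at hH
    exact ⟨fun t b => H b t, ⟨fun b => (H b).continuous, hH.mul, hH.lin, hH.star_defect⟩,
      fun t b => hHq b t⟩
  · obtain ⟨F, ⟨hFm, hFl, hFs, -⟩, hFq⟩ := h (g.comp α)
    let ρ : C(ℕ, ℝ) := ⟨fun n => (n : ℝ), continuous_of_discreteTopology⟩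
    have hT : comap ρ atTop = atTop := Nat.comap_cast_atTop
    obtain ⟨H, hHq, hH, hHb⟩ := hdom.exists_asymptotic_lift hq ρ
      (fun n => n.cast_nonneg) g (fun a => ⟨fun n => F n a, continuous_of_discreteTopology⟩)
      (fun a n => hFq n a) (by rw [hT]; exact ⟨hFm, hFl, hFs⟩)
    rw [hT] at hH
    refine ⟨fun n b => H b n, ⟨hH.mul, hH.lin, hH.star_defect, fun b => ?_⟩, fun n b => hHq b n⟩
    obtain ⟨M, hM⟩ := hHb b
    rw [hT] at hM
    obtain ⟨C, hC⟩ := (isBoundedUnder_of_eventually_le hM).bddAbove_range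
    exact ⟨C, fun n => hC ⟨n, rfl⟩⟩

end
end

section
/- Let B, C be separable C*-algebras, D a C*-algebra with closed two-sided ideal I and quotient map q: D → D/I. Let φ: B → D/I be a *-homomorphism that has a cp lift to D. Let ψ', ψ'': C → B be homotopic *-homomorphisms and suppose φ∘ψ'' lifts to a cp (discrete) asymptotic homomorphism from C to D. Then φ∘ψ' lifts to a cp (discrete) asymptotic homomorphism from C to D. -/
open Filter Topology

noncomputable section

/-- A map between C*-algebras is completely positive: it is linear and its amplification to
every matrix level maps positive elements to positive elements. -/
def IsCompletelyPositive {A B : Type*} [NonUnitalCStarAlgebra A] [NonUnitalCStarAlgebra B]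
    (φ : A → B) : Prop :=
  (∀ a b, φ (a + b) = φ a + φ b) ∧ (∀ (c : ℂ) (a : A), φ (c • a) = c • φ a) ∧
  ∀ (k : ℕ) (x : Matrix (Fin k) (Fin k) A),
    (∃ y : Matrix (Fin k) (Fin k) A, x = star y * y) →
    ∃ z : Matrix (Fin k) (Fin k) B, x.map φ = star z * z

section Auxiliary

open scoped CStarAlgebra

section CStar
variable {E : Type*} [CStarAlgebra E] [PartialOrder E] [StarOrderedRing E]

theorem norm_sum_conj_le_of_nonneg {ι : Type*} (s : Finset ι) (w K : ι → E) {κ : ℝ}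
    (hw : ∑ i ∈ s, star (w i) * w i ≤ 1) (hK0 : ∀ i ∈ s, 0 ≤ K i) (hK : ∀ i ∈ s, ‖K i‖ ≤ κ)
    (hκ : 0 ≤ κ) :
    ‖∑ i ∈ s, star (w i) * K i * w i‖ ≤ κ := by
  rw [CStarAlgebra.norm_le_iff_le_algebraMap _ hκ
    (Finset.sum_nonneg fun i hi => star_left_conjugate_nonneg (hK0 i hi) _)]
  calc ∑ i ∈ s, star (w i) * K i * w i
      ≤ ∑ i ∈ s, star (w i) * algebraMap ℝ E κ * w i := by
        refine Finset.sum_le_sum fun i hi => star_left_conjugate_le_conjugate ?_ _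
        exact (CStarAlgebra.norm_le_iff_le_algebraMap _ hκ (hK0 i hi)).1 (hK i hi)
    _ = κ • ∑ i ∈ s, star (w i) * w i := by
        simp [Algebra.algebraMap_eq_smul_one, Finset.smul_sum]
    _ ≤ κ • 1 := smul_le_smul_of_nonneg_left hw hκ
    _ = algebraMap ℝ E κ := (Algebra.algebraMap_eq_smul_one κ).symm

theorem norm_sum_conj_le {ι : Type*} (s : Finset ι) (w K : ι → E) {κ : ℝ}
    (hw : ∑ i ∈ s, star (w i) * w i ≤ 1) (hK : ∀ i ∈ s, ‖K i‖ ≤ κ) (hκ : 0 ≤ κ) :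
    ‖∑ i ∈ s, star (w i) * K i * w i‖ ≤ 4 * κ := by
  choose y hy0 hyn hy using fun i => CStarAlgebra.exists_sum_four_nonneg (K i)
  have : ∑ i ∈ s, star (w i) * K i * w i =
      ∑ x : Fin 4, (Complex.I ^ (x : ℕ)) • ∑ i ∈ s, star (w i) * y i x * w i := by
    simp_rw [Finset.smul_sum]
    rw [Finset.sum_comm]
    refine Finset.sum_congr rfl fun i _ => ?_
    conv_lhs => rw [hy i]
    simp [Finset.mul_sum, Finset.sum_mul]
  rw [this]
  refine (norm_sum_le _ _).trans ?_
  calc _ ≤ ∑ x : Fin 4, κ := by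
        refine Finset.sum_le_sum fun x _ => ?_
        rw [norm_smul]
        simpa using norm_sum_conj_le_of_nonneg s w (fun i => y i x) hw (fun i _ => hy0 i x)
          (fun i hi => (hyn i x).trans (hK i hi)) hκ
    _ = 4 * κ := by simp

/-- Elements almost intertwining `y` and `y'` almost intertwine `h(y)` and `h(y')`. -/
theorem exists_delta_intertwine (E : Type*) [CStarAlgebra E] {R : ℝ} {h : ℝ → ℝ}
    (hh : Continuous h) {ε : ℝ} (hε : 0 < ε) :
    ∃ δ > 0, ∀ y y' z : E, IsSelfAdjoint y → IsSelfAdjoint y' →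
      spectrum ℝ y ⊆ Set.Icc 0 R → spectrum ℝ y' ⊆ Set.Icc 0 R →
      ‖y * z - z * y'‖ ≤ δ → ‖cfc h y * z - z * cfc h y'‖ ≤ ε * (1 + ‖z‖) := by
  obtain ⟨P, hP⟩ := exists_polynomial_near_of_continuousOn 0 R h hh.continuousOn (ε / 2)
    (by positivity)
  have key : ∀ Q : Polynomial ℝ, ∃ C : ℝ, 0 ≤ C ∧ ∀ y y' z : E, IsSelfAdjoint y →
      IsSelfAdjoint y' → spectrum ℝ y ⊆ Set.Icc 0 R → spectrum ℝ y' ⊆ Set.Icc 0 R →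
      ‖Polynomial.aeval y Q * z - z * Polynomial.aeval y' Q‖ ≤ C * ‖y * z - z * y'‖ := by
    intro Q
    have bd : ∀ y : E, IsSelfAdjoint y → spectrum ℝ y ⊆ Set.Icc 0 R → ‖y‖ ≤ max R 0 := by
      intro y hy hs
      rw [← cfc_id ℝ y]
      refine norm_cfc_le (le_max_right _ _) fun x hx => ?_
      have := hs hx
      rw [id, Real.norm_of_nonneg this.1]
      exact this.2.trans (le_max_left _ _)
    induction Q using Polynomial.induction_on with
    | C a =>
      refine ⟨0, le_rfl, fun y y' z _ _ _ _ => ?_⟩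
      simp [Algebra.commutes]
    | add p q hp hq =>
      obtain ⟨C₁, h₁, H₁⟩ := hp
      obtain ⟨C₂, h₂, H₂⟩ := hq
      refine ⟨C₁ + C₂, by positivity, fun y y' z a b c d => ?_⟩
      have : Polynomial.aeval y (p + q) * z - z * Polynomial.aeval y' (p + q) =
        (Polynomial.aeval y p * z - z * Polynomial.aeval y' p) +
        (Polynomial.aeval y q * z - z * Polynomial.aeval y' q) := by
        simp only [map_add]; noncomm_ring
      rw [this, add_mul]
      exact (norm_add_le _ _).trans (add_le_add (H₁ y y' z a b c d) (H₂ y y' z a b c d))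
    | monomial n a ih =>
      obtain ⟨C, hC, H⟩ := ih
      let q : Polynomial ℝ := Polynomial.C a * Polynomial.X ^ n
      refine ⟨|a| * (max R 0) ^ n + C * max R 0, by positivity, fun y y' z hy hy' hs hs' => ?_⟩
      have e : Polynomial.aeval y (Polynomial.C a * Polynomial.X ^ (n + 1)) * z -
          z * Polynomial.aeval y' (Polynomial.C a * Polynomial.X ^ (n + 1)) =
          Polynomial.aeval y q * (y * z - z * y') +
          (Polynomial.aeval y q * z - z * Polynomial.aeval y' q) * y' := by
        have hq : Polynomial.C a * Polynomial.X ^ (n + 1) = q * Polynomial.X := by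
          simp only [q]; ring
        rw [hq]
        simp only [map_mul, Polynomial.aeval_X]
        noncomm_ring
      rw [e]
      refine (norm_add_le _ _).trans ?_
      have hb : ‖Polynomial.aeval y q‖ ≤ |a| * (max R 0) ^ n := by
        rw [← cfc_polynomial q y]
        refine norm_cfc_le (by positivity) fun x hx => ?_
        have hx' := hs hx
        simp only [q, Polynomial.eval_mul, Polynomial.eval_C, Polynomial.eval_pow,
          Polynomial.eval_X, norm_mul, norm_pow, Real.norm_eq_abs]
        have : |x| ≤ max R 0 := by
          rw [abs_of_nonneg hx'.1]
          exact hx'.2.trans (le_max_left _ _)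
        gcongr
      have h1 := (norm_mul_le (Polynomial.aeval y q) (y * z - z * y')).trans
        (mul_le_mul_of_nonneg_right hb (norm_nonneg _))
      have h2 : ‖(Polynomial.aeval y q * z - z * Polynomial.aeval y' q) * y'‖ ≤
          (C * ‖y * z - z * y'‖) * max R 0 :=
        (norm_mul_le _ _).trans (mul_le_mul (H y y' z hy hy' hs hs') (bd y' hy' hs')
          (norm_nonneg _) (by positivity))
      nlinarith
  obtain ⟨C, hC, H⟩ := key P
  have near : ∀ y : E, IsSelfAdjoint y → spectrum ℝ y ⊆ Set.Icc 0 R →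
      ‖cfc h y - Polynomial.aeval y P‖ ≤ ε / 2 := by
    intro y hy hs
    rw [← cfc_polynomial P y, ← cfc_sub h P.eval y hh.continuousOn P.continuous.continuousOn]
    refine norm_cfc_le (by positivity) fun x hx => ?_
    rw [Real.norm_eq_abs, abs_sub_comm]
    exact (hP x (hs hx)).le
  refine ⟨ε / (C + 1), by positivity, fun y y' z hy hy' hs hs' hδ => ?_⟩
  have e : cfc h y * z - z * cfc h y' = (cfc h y - Polynomial.aeval y P) * z -
      z * (cfc h y' - Polynomial.aeval y' P) +
      (Polynomial.aeval y P * z - z * Polynomial.aeval y' P) := by noncomm_ring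
  have h1 : ‖(cfc h y - Polynomial.aeval y P) * z‖ ≤ ε / 2 * ‖z‖ :=
    (norm_mul_le _ _).trans (mul_le_mul_of_nonneg_right (near y hy hs) (norm_nonneg _))
  have h2 : ‖z * (cfc h y' - Polynomial.aeval y' P)‖ ≤ ‖z‖ * (ε / 2) :=
    (norm_mul_le _ _).trans (mul_le_mul_of_nonneg_left (near y' hy' hs') (norm_nonneg _))
  have h3 : ‖Polynomial.aeval y P * z - z * Polynomial.aeval y' P‖ ≤ ε := by
    refine (H y y' z hy hy' hs hs').trans ?_
    calc C * ‖y * z - z * y'‖ ≤ C * (ε / (C + 1)) := by gcongr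
      _ = ε * (C / (C + 1)) := by ring
      _ ≤ ε * 1 := by gcongr; rw [div_le_one (by positivity)]; linarith
      _ = ε := mul_one _
  rw [e]
  have := norm_add_le ((cfc h y - Polynomial.aeval y P) * z -
      z * (cfc h y' - Polynomial.aeval y' P)) (Polynomial.aeval y P * z - z * Polynomial.aeval y' P)
  have := norm_sub_le ((cfc h y - Polynomial.aeval y P) * z)
    (z * (cfc h y' - Polynomial.aeval y' P))
  linarith

variable {F : Type*} [CStarAlgebra F]

theorem exists_approx_unit_ker (q : E →⋆ₐ[ℂ] F) {X : Set E} (hX : X.Finite)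
    (hXq : ∀ x ∈ X, q x = 0) {ε : ℝ} (hε : 0 < ε) :
    ∃ u : E, q u = 0 ∧ 0 ≤ u ∧ u ≤ 1 ∧ ∀ x ∈ X, ‖x * (1 - u)‖ ≤ ε ∧ ‖(1 - u) * x‖ ≤ ε := by
  classical
  set h : E := ∑ x ∈ hX.toFinset, (star x * x + x * star x) with hh
  set f : ℝ → ℝ := fun t => t / (|t| + ε ^ 2) with hf
  have hden : ∀ t : ℝ, 0 < |t| + ε ^ 2 := fun t => by positivity
  have hfc : Continuous f := by
    refine continuous_id.div (by fun_prop) fun t => (hden t).ne'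
  have hterm : ∀ x : E, 0 ≤ star x * x + x * star x := fun x =>
    add_nonneg (star_mul_self_nonneg x) (mul_star_self_nonneg x)
  have hh0 : 0 ≤ h := Finset.sum_nonneg fun x _ => hterm x
  have hsa : IsSelfAdjoint h := .of_nonneg hh0
  have hspec : ∀ t ∈ spectrum ℝ h, 0 ≤ t := fun t ht => spectrum_nonneg_of_nonneg hh0 ht
  set v : E := cfc (fun t => 1 - f t) h with hv
  have huv : 1 - cfc f h = v := by
    rw [hv, cfc_sub (fun _ => (1 : ℝ)) f h (by fun_prop) hfc.continuousOn, cfc_const_one ℝ h]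
  have hvsa : star v = v := (cfc_predicate (fun t => 1 - f t) h).star_eq
  have hvhv : ‖v * h * v‖ ≤ ε ^ 2 := by
    have : v * h * v = cfc (fun t => (1 - f t) * t * (1 - f t)) h := by
      rw [cfc_mul (fun t => (1 - f t) * t) (fun t => 1 - f t) h (by fun_prop) (by fun_prop),
        cfc_mul (fun t => 1 - f t) (fun t => t) h (by fun_prop) (by fun_prop), cfc_id' ℝ h]
    rw [this]
    refine norm_cfc_le (by positivity) fun t ht => ?_
    have ht := hspec t ht
    have hd := hden t
    rw [abs_of_nonneg ht] at hd
    have e : (1 - f t) * t * (1 - f t) = ε ^ 2 * ((ε ^ 2 * t) / (t + ε ^ 2) ^ 2) := by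
      simp only [hf, abs_of_nonneg ht]
      field_simp
      ring
    rw [e, Real.norm_of_nonneg (by positivity)]
    refine mul_le_of_le_one_right (by positivity) ?_
    rw [div_le_one (by positivity)]
    nlinarith [sq_nonneg t, sq_nonneg (ε ^ 2), mul_nonneg ht (sq_nonneg ε)]
  have hle : ∀ x ∈ X, star x * x ≤ h ∧ x * star x ≤ h := by
    intro x hx
    have h1 : star x * x + x * star x ≤ h :=
      Finset.single_le_sum (f := fun x : E => star x * x + x * star x)
        (fun x _ => hterm x) (hX.mem_toFinset.2 hx)
    exact ⟨(le_add_of_nonneg_right (mul_star_self_nonneg x)).trans h1,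
      (le_add_of_nonneg_left (star_mul_self_nonneg x)).trans h1⟩
  have hbd : ∀ k : E, 0 ≤ k → k ≤ h → ‖v * k * v‖ ≤ ε ^ 2 := by
    intro k hk0 hk
    have h0 := star_left_conjugate_nonneg hk0 v
    have h1 := star_left_conjugate_le_conjugate hk v
    rw [hvsa] at h0 h1
    exact (CStarAlgebra.norm_le_norm_of_nonneg_of_le h0 h1).trans hvhv
  refine ⟨cfc f h, ?_, ?_, ?_, fun x hx => ⟨?_, ?_⟩⟩
  · have hq : q h = 0 := by
      rw [hh, map_sum]
      refine Finset.sum_eq_zero fun x hx => ?_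
      have := hXq x (hX.mem_toFinset.1 hx)
      simp [this]
    have hqc : Continuous q := map_continuous q
    have := StarAlgHomClass.map_cfc (S := ℂ) q f h hfc.continuousOn hqc hsa
      (by rw [hq]; exact .zero _)
    rw [this, hq, cfc_apply_zero]
    simp [hf]
  · exact cfc_nonneg fun t ht => div_nonneg (hspec t ht) (hden t).le
  · refine cfc_le_one _ _ fun t ht => ?_
    rw [div_le_one (hden t), abs_of_nonneg (hspec t ht)]
    nlinarith
  · rw [huv]
    have := hbd _ (star_mul_self_nonneg x) (hle x hx).1
    rw [← sq_le_sq₀ (norm_nonneg _) hε.le, sq, ← CStarRing.norm_star_mul_self, star_mul, hvsa]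
    simpa [mul_assoc] using this
  · rw [huv]
    have := hbd _ (mul_star_self_nonneg x) (hle x hx).2
    rw [← sq_le_sq₀ (norm_nonneg _) hε.le, sq, ← CStarRing.norm_self_mul_star, star_mul, hvsa]
    simpa [mul_assoc] using this

theorem exists_sum_approx_unit_ker (q : E →⋆ₐ[ℂ] F) {K X : Set E} (hK : K.Finite)
    (hX : X.Finite) (hXq : ∀ x ∈ X, q x = 0) {R : ℝ} (hR : ∀ d ∈ K, ‖d‖ ≤ R) (hR0 : 0 ≤ R)
    {ε : ℝ} (hε : 0 < ε) (N : ℕ) :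
    ∃ U : E, q U = 0 ∧ 0 ≤ U ∧ U ≤ N ∧
      (∀ x ∈ X, ‖x * (N - U)‖ ≤ N * ε ∧ ‖(N - U) * x‖ ≤ N * ε) ∧
      ∀ d ∈ K, ‖U * d - d * U‖ ^ 2 ≤ N * (4 * R ^ 2 + 1) := by
  induction N with
  | zero => exact ⟨0, by simp⟩
  | succ N ih =>
    obtain ⟨U, hqU, hU0, hUN, hUX, hUK⟩ := ih
    let S : E → E := fun d => U * d - d * U
    let X' : Set E := X ∪ ((fun d => star (S d)) '' K ∪ (fun d => star (S d) * d) '' K)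
    have hqS : ∀ d, q (star (S d)) = 0 := fun d => by simp [S, map_star, hqU]
    set ε' := min ε (1 / (2 * (R + 1))) with hε'
    have hε'0 : 0 < ε' := by positivity
    obtain ⟨u, hqu, hu0, hu1, hu⟩ := exists_approx_unit_ker q
      (X := X') (hX.union ((hK.image _).union (hK.image _)))
      (by
        rintro x (hx | ⟨d, -, rfl⟩ | ⟨d, -, rfl⟩)
        · exact hXq x hx
        · exact hqS d
        · simp only [map_mul, hqS, zero_mul]) hε'0
    refine ⟨U + u, by simp [hqU, hqu], add_nonneg hU0 hu0, ?_, fun x hx => ?_, fun d hd => ?_⟩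
    · push_cast
      exact add_le_add hUN hu1
    · have h1 := hUX x hx
      have h2 := hu x (Or.inl hx)
      have hle : ε' ≤ ε := min_le_left _ _
      have e1 : x * ((N + 1 : ℕ) - (U + u)) = x * (N - U) + x * (1 - u) := by
        push_cast; noncomm_ring
      have e2 : ((N + 1 : ℕ) - (U + u)) * x = (N - U) * x + (1 - u) * x := by
        push_cast; noncomm_ring
      rw [e1, e2]
      have := norm_add_le (x * (N - U)) (x * (1 - u))
      have := norm_add_le ((N - U) * x) ((1 - u) * x)
      push_cast
      constructor <;> linarith [h1.1, h1.2, h2.1, h2.2]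
    · have hdR := hR d hd
      set s := S d with hs
      set v := u * d - d * u with hv
      have e : (U + u) * d - d * (U + u) = s + v := by simp only [hs, S, hv]; noncomm_ring
      have hv2 : ‖v‖ ≤ 2 * R := by
        have hun : ‖u‖ ≤ 1 := (CStarAlgebra.norm_le_one_iff_of_nonneg u hu0).2 hu1
        calc ‖v‖ ≤ ‖u * d‖ + ‖d * u‖ := norm_sub_le _ _
          _ ≤ ‖u‖ * ‖d‖ + ‖d‖ * ‖u‖ := add_le_add (norm_mul_le _ _) (norm_mul_le _ _)
          _ ≤ 1 * R + R * 1 := by gcongr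
          _ = 2 * R := by ring
      have hsv : ‖star s * v‖ ≤ 1 / 2 := by
        have e : star s * v = star s * d * (1 - u) - star s * (1 - u) * d := by
          rw [hv]; noncomm_ring
        have h1 := (hu (star s) (Or.inr (Or.inl ⟨d, hd, rfl⟩))).1
        have h2 := (hu (star s * d) (Or.inr (Or.inr ⟨d, hd, rfl⟩))).1
        have h3 : ε' ≤ 1 / (2 * (R + 1)) := min_le_right _ _
        calc ‖star s * v‖ ≤ ‖star s * d * (1 - u)‖ + ‖star s * (1 - u) * d‖ := by
              rw [e]; exact norm_sub_le _ _
          _ ≤ ε' + ε' * R := add_le_add h2 ((norm_mul_le _ _).trans (by gcongr))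
          _ = ε' * (R + 1) := by ring
          _ ≤ 1 / (2 * (R + 1)) * (R + 1) := by gcongr
          _ = 1 / 2 := by field_simp
      have hvs : ‖star v * s‖ ≤ 1 / 2 := by
        rw [← norm_star, star_mul, star_star]; exact hsv
      have hsq : ‖s + v‖ ^ 2 ≤ ‖s‖ ^ 2 + 1 + ‖v‖ ^ 2 := by
        have e2 : star (s + v) * (s + v) = star s * s + star s * v + star v * s + star v * v := by
          rw [star_add]; noncomm_ring
        have n1 := norm_add_le (star s * s + star s * v + star v * s) (star v * v)
        have n2 := norm_add_le (star s * s + star s * v) (star v * s)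
        have n3 := norm_add_le (star s * s) (star s * v)
        rw [CStarRing.norm_star_mul_self] at n1 n3
        rw [sq, ← CStarRing.norm_star_mul_self, e2, sq, sq]
        linarith
      rw [e]
      push_cast
      have := hUK d hd
      change ‖s‖ ^ 2 ≤ _ at this
      nlinarith [norm_nonneg v]

theorem exists_quasicentral_finite (q : E →⋆ₐ[ℂ] F) {K X : Set E} (hK : K.Finite)
    (hX : X.Finite) (hXq : ∀ x ∈ X, q x = 0) {ε : ℝ} (hε : 0 < ε) :
    ∃ u : E, q u = 0 ∧ 0 ≤ u ∧ u ≤ 1 ∧ (∀ x ∈ X, ‖x * (1 - u)‖ ≤ ε ∧ ‖(1 - u) * x‖ ≤ ε) ∧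
      ∀ d ∈ K, ‖u * d - d * u‖ ≤ ε := by
  obtain ⟨R, hR⟩ : ∃ R : ℝ, ∀ d ∈ K, ‖d‖ ≤ R := by
    obtain ⟨R, hR⟩ := hK.isBounded.exists_norm_le
    exact ⟨R, hR⟩
  set R' := max R 0
  obtain ⟨n, hn⟩ := exists_nat_gt ((4 * R' ^ 2 + 1) / ε ^ 2)
  have hn0 : (0 : ℝ) < n := lt_of_le_of_lt (by positivity) hn
  obtain ⟨U, hqU, hU0, hUN, hUX, hUK⟩ := exists_sum_approx_unit_ker q hK hX hXq
    (fun d hd => (hR d hd).trans (le_max_left R 0)) (le_max_right R 0) hε n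
  have hnn : (n : ℝ)⁻¹ • (n : E) = 1 := by
    rw [← Nat.cast_smul_eq_nsmul ℝ n (1 : E) |>.trans (nsmul_one n), smul_smul,
      inv_mul_cancel₀ hn0.ne', one_smul]
  have h1u : 1 - (n : ℝ)⁻¹ • U = (n : ℝ)⁻¹ • ((n : E) - U) := by rw [smul_sub, hnn]
  refine ⟨(n : ℝ)⁻¹ • U, ?_, ?_, ?_, fun x hx => ?_, fun d hd => ?_⟩
  · have : (n : ℝ)⁻¹ • U = ((n : ℂ)⁻¹) • U := by
      rw [← Complex.coe_smul]; simp
    rw [this, map_smul, hqU, smul_zero]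
  · exact smul_nonneg (by positivity) hU0
  · rw [← hnn]
    exact smul_le_smul_of_nonneg_left hUN (by positivity)
  · rw [h1u, mul_smul_comm, smul_mul_assoc, norm_smul, norm_smul, norm_inv, Real.norm_natCast,
      inv_mul_le_iff₀ hn0, inv_mul_le_iff₀ hn0]
    exact hUX x hx
  · rw [smul_mul_assoc, mul_smul_comm, ← smul_sub, norm_smul, norm_inv, Real.norm_natCast,
      inv_mul_le_iff₀ hn0, ← sq_le_sq₀ (norm_nonneg _) (by positivity)]
    refine (hUK d hd).trans ?_
    rw [div_lt_iff₀ (by positivity)] at hn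
    nlinarith

theorem exists_quasicentral (q : E →⋆ₐ[ℂ] F) {K X : Set E} (hK : IsCompact K)
    (hX : IsCompact X) (hXq : ∀ x ∈ X, q x = 0) {ε : ℝ} (hε : 0 < ε) :
    ∃ u : E, q u = 0 ∧ 0 ≤ u ∧ u ≤ 1 ∧ (∀ x ∈ X, ‖x * (1 - u)‖ ≤ ε ∧ ‖(1 - u) * x‖ ≤ ε) ∧
      ∀ d ∈ K, ‖u * d - d * u‖ ≤ ε := by
  obtain ⟨K', hK'K, hK'f, hK'⟩ := hK.finite_cover_balls (e := ε / 4) (by positivity)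
  obtain ⟨X', hX'X, hX'f, hX'⟩ := hX.finite_cover_balls (e := ε / 4) (by positivity)
  obtain ⟨u, hqu, hu0, hu1, hx, hd⟩ := exists_quasicentral_finite q hK'f hX'f
    (fun x hx => hXq x (hX'X hx)) (ε := ε / 2) (by positivity)
  have hun : ‖u‖ ≤ 1 := (CStarAlgebra.norm_le_one_iff_of_nonneg u hu0).2 hu1
  have hvn : ‖1 - u‖ ≤ 1 :=
    (CStarAlgebra.norm_le_one_iff_of_nonneg _ (sub_nonneg.2 hu1)).2 (sub_le_self _ hu0)
  refine ⟨u, hqu, hu0, hu1, fun x hxX => ?_, fun d hdK => ?_⟩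
  · obtain ⟨y, hy, hxy⟩ := Set.mem_iUnion₂.1 (hX' hxX)
    rw [mem_ball_iff_norm] at hxy
    have e1 : x * (1 - u) = y * (1 - u) + (x - y) * (1 - u) := by noncomm_ring
    have e2 : (1 - u) * x = (1 - u) * y + (1 - u) * (x - y) := by noncomm_ring
    have b1 : ‖(x - y) * (1 - u)‖ ≤ ‖x - y‖ * 1 :=
      (norm_mul_le _ _).trans (by gcongr)
    have b2 : ‖(1 - u) * (x - y)‖ ≤ 1 * ‖x - y‖ :=
      (norm_mul_le _ _).trans (by gcongr)
    rw [e1, e2]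
    have := hx y hy
    constructor
    · linarith [norm_add_le (y * (1 - u)) ((x - y) * (1 - u)), this.1]
    · linarith [norm_add_le ((1 - u) * y) ((1 - u) * (x - y)), this.2]
  · obtain ⟨y, hy, hxy⟩ := Set.mem_iUnion₂.1 (hK' hdK)
    rw [mem_ball_iff_norm] at hxy
    have e : u * d - d * u = (u * y - y * u) + (u * (d - y) - (d - y) * u) := by noncomm_ring
    have b1 : ‖u * (d - y)‖ ≤ 1 * ‖d - y‖ := (norm_mul_le _ _).trans (by gcongr)
    have b2 : ‖(d - y) * u‖ ≤ ‖d - y‖ * 1 := (norm_mul_le _ _).trans (by gcongr)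
    rw [e]
    linarith [norm_add_le (u * y - y * u) (u * (d - y) - (d - y) * u),
      norm_sub_le (u * (d - y)) ((d - y) * u), hd y hy]

end CStar

section CompletelyPositive

variable {A B D : Type*} [NonUnitalCStarAlgebra A] [NonUnitalCStarAlgebra B]
  [NonUnitalCStarAlgebra D]

theorem CStarAlgebra.exists_star_mul_self_add (a b : D) :
    ∃ c : D, star a * a + star b * b = star c * c := by
  let : PartialOrder D := CStarAlgebra.spectralOrder D
  let : StarOrderedRing D := CStarAlgebra.spectralOrderedRing D
  exact CStarAlgebra.nonneg_iff_eq_star_mul_self.1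
    (add_nonneg (star_mul_self_nonneg a) (star_mul_self_nonneg b))

theorem Matrix.exists_star_mul_self_add {k : ℕ} (z w : Matrix (Fin k) (Fin k) D) :
    ∃ v : Matrix (Fin k) (Fin k) D, star z * z + star w * w = star v * v := by
  let : PartialOrder D := CStarAlgebra.spectralOrder D
  let : StarOrderedRing D := CStarAlgebra.spectralOrderedRing D
  exact CStarAlgebra.exists_star_mul_self_add (D := CStarMatrix (Fin k) (Fin k) D) z w

namespace IsCompletelyPositive

theorem zero : IsCompletelyPositive (fun _ : A => (0 : D)) :=
  ⟨by simp, by simp, fun k x _ => ⟨0, by ext; simp⟩⟩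

theorem add {f g : A → D} (hf : IsCompletelyPositive f) (hg : IsCompletelyPositive g) :
    IsCompletelyPositive (fun a => f a + g a) := by
  refine ⟨fun a b => by simp only [hf.1, hg.1]; abel,
    fun c a => by simp only [hf.2.1, hg.2.1, smul_add],
    fun k x hx => ?_⟩
  obtain ⟨z, hz⟩ := hf.2.2 k x hx
  obtain ⟨w, hw⟩ := hg.2.2 k x hx
  obtain ⟨v, hv⟩ := Matrix.exists_star_mul_self_add z w
  refine ⟨v, ?_⟩
  rw [← hv, ← hz, ← hw]
  ext i j
  simp

theorem sum {ι : Type*} (s : Finset ι) {f : ι → A → D}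
    (hf : ∀ i ∈ s, IsCompletelyPositive (f i)) :
    IsCompletelyPositive (fun a => ∑ i ∈ s, f i a) := by
  classical
  induction s using Finset.induction_on with
  | empty => simpa using zero
  | insert i s hi ih =>
    simp only [Finset.sum_insert hi]
    exact (hf i (Finset.mem_insert_self i s)).add
      (ih fun j hj => hf j (Finset.mem_insert_of_mem hj))

theorem comp_hom {f : B → D} (hf : IsCompletelyPositive f) (g : A →⋆ₙₐ[ℂ] B) :
    IsCompletelyPositive (fun a => f (g a)) := by
  refine ⟨fun a b => by simp only [map_add, hf.1],
    fun c a => by simp only [map_smul, hf.2.1],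
    fun k x ⟨y, hy⟩ => ?_⟩
  have hxy : x.map g = star (y.map g) * y.map g := by
    rw [hy]
    ext i j
    simp [Matrix.mul_apply, _root_.map_sum, StarHomClass.map_star]
  obtain ⟨z, hz⟩ := hf.2.2 k (x.map g) ⟨y.map g, hxy⟩
  exact ⟨z, by rw [← hz]; ext; simp⟩

theorem conj {f : A → D} (hf : IsCompletelyPositive f) (p : Unitization ℂ D) :
    IsCompletelyPositive (fun a => (star p * (f a : Unitization ℂ D) * p).snd) := by
  refine ⟨fun a b => ?_, fun c a => ?_, fun k x hx => ?_⟩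
  · simp only [hf.1, Unitization.inr_add, mul_add, add_mul, Unitization.snd_add]
  · simp only [hf.2.1, Unitization.inr_smul, mul_smul_comm, smul_mul_assoc, Unitization.snd_smul]
  obtain ⟨z, hz⟩ := hf.2.2 k x hx
  refine ⟨z.map fun d => ((d : Unitization ℂ D) * p).snd, ?_⟩
  have key : ∀ d : D, ((((d : Unitization ℂ D) * p).snd : D) : Unitization ℂ D) = d * p := by
    intro d
    ext <;> simp
  ext i j
  have hij : f (x i j) = ∑ l, star (z l i) * z l j := by
    simpa [Matrix.mul_apply] using congrFun (congrFun hz i) j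
  apply Unitization.inr_injective (R := ℂ)
  have h1 : ((((star p * (f (x i j) : Unitization ℂ D) * p).snd : D)) : Unitization ℂ D)
      = star p * (f (x i j) : Unitization ℂ D) * p := by
    ext <;> simp
  simp only [Matrix.map_apply, Matrix.mul_apply, Matrix.star_apply]
  rw [h1, hij]
  have h2 : ∀ s : Finset (Fin k), ∀ g : Fin k → D,
      ((∑ l ∈ s, g l : D) : Unitization ℂ D) = ∑ l ∈ s, (g l : Unitization ℂ D) := fun s g =>
    map_sum (Unitization.inrNonUnitalAlgHom ℂ D) g s
  rw [h2, h2, Finset.mul_sum, Finset.sum_mul]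
  refine Finset.sum_congr rfl fun l _ => ?_
  rw [Unitization.inr_mul, Unitization.inr_mul, Unitization.inr_star, Unitization.inr_star, key,
    key, star_mul]
  simp only [mul_assoc]

theorem map_sub {f : A → D} (hf : IsCompletelyPositive f) (a b : A) :
    f (a - b) = f a - f b :=
  _root_.map_sub (AddMonoidHom.mk' f hf.1) a b

section Order

variable [PartialOrder A] [StarOrderedRing A] [PartialOrder D] [StarOrderedRing D]

theorem nonneg {f : A → D} (hf : IsCompletelyPositive f) {a : A} (ha : 0 ≤ a) : 0 ≤ f a := by
  obtain ⟨b, rfl⟩ := CStarAlgebra.nonneg_iff_eq_star_mul_self.1 ha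
  obtain ⟨z, hz⟩ := hf.2.2 1 (.of fun _ _ => star b * b) ⟨.of fun _ _ => b, by
    ext; simp [Matrix.mul_apply]⟩
  have : f (star b * b) = star (z 0 0) * z 0 0 := by
    simpa [Matrix.mul_apply] using congrFun (congrFun hz 0) 0
  rw [this]
  exact star_mul_self_nonneg _

theorem mono {f : A → D} (hf : IsCompletelyPositive f) {a b : A} (hab : a ≤ b) : f a ≤ f b := by
  rw [← sub_nonneg, ← hf.map_sub]
  exact hf.nonneg (sub_nonneg.2 hab)

end Order

theorem exists_bound {f : A → D} (hf : IsCompletelyPositive f) :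
    ∃ L : ℝ, 0 ≤ L ∧ ∀ a, ‖f a‖ ≤ L * ‖a‖ := by
  let : PartialOrder D := CStarAlgebra.spectralOrder D
  let : StarOrderedRing D := CStarAlgebra.spectralOrderedRing D
  let : PartialOrder A := CStarAlgebra.spectralOrder A
  let : StarOrderedRing A := CStarAlgebra.spectralOrderedRing A
  obtain ⟨C, hC⟩ := (PositiveLinearMap.mk₀ (R := ℂ) (E₁ := A) (E₂ := D)
    { toFun := f, map_add' := hf.1, map_smul' := hf.2.1 } fun x hx =>
      hf.nonneg hx).exists_norm_apply_le
  exact ⟨C, C.2, hC⟩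

theorem map_star {f : A → D} (hf : IsCompletelyPositive f) (a : A) : f (star a) = star (f a) := by
  let : PartialOrder D := CStarAlgebra.spectralOrder D
  let : StarOrderedRing D := CStarAlgebra.spectralOrderedRing D
  let : PartialOrder A := CStarAlgebra.spectralOrder A
  let : StarOrderedRing A := CStarAlgebra.spectralOrderedRing A
  let g : A →ₚ[ℂ] D := PositiveLinearMap.mk₀
    { toFun := f, map_add' := hf.1, map_smul' := hf.2.1 } fun x hx => hf.nonneg hx
  exact StarHomClass.map_star g a

end IsCompletelyPositive

end CompletelyPositive

section AsymptoticBound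

variable {C D T : Type*} [NonUnitalCStarAlgebra C] [NonUnitalCStarAlgebra D]

theorem eventually_norm_le_of_asymptotically_mul {l : Filter T} {G : T → C → D}
    (hcp : ∀ t, IsCompletelyPositive (G t))
    (hmul : ∀ a b, Tendsto (fun t => ‖G t (a * b) - G t a * G t b‖) l (𝓝 0))
    (a : C) {ε : ℝ} (hε : 0 < ε) : ∀ᶠ t in l, ‖G t a‖ ≤ ‖a‖ + ε := by
  let : PartialOrder C := CStarAlgebra.spectralOrder C
  let : StarOrderedRing C := CStarAlgebra.spectralOrderedRing C
  let : PartialOrder D := CStarAlgebra.spectralOrder D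
  let : StarOrderedRing D := CStarAlgebra.spectralOrderedRing D
  have hev : ∀ a b : C, ∀ e > 0, ∀ᶠ t in l, ‖G t (a * b) - G t a * G t b‖ ≤ e := fun a b e he =>
    (hmul a b).eventually_le_const he
  have hpos : ∀ a : C, 0 ≤ a → ∀ ε > 0, ∀ᶠ t in l, ‖G t a‖ ≤ ‖a‖ + ε := by
    intro a ha ε hε
    filter_upwards [hev a a (ε ^ 2) (by positivity)] with t ht
    have hle : a * a ≤ ((‖a‖ : ℝ) : ℂ) • a := by
      have h := CStarAlgebra.star_left_conjugate_le_norm_smul (a := CFC.sqrt a) (b := a)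
        (IsSelfAdjoint.of_nonneg ha)
      rw [(IsSelfAdjoint.of_nonneg (CFC.sqrt_nonneg a)).star_eq, CFC.sqrt_mul_sqrt_self a ha] at h
      have hc : CFC.sqrt a * a * CFC.sqrt a = a * a := by
        nth_rewrite 2 [← CFC.sqrt_mul_sqrt_self a ha]
        rw [← mul_assoc, CFC.sqrt_mul_sqrt_self a ha, mul_assoc, CFC.sqrt_mul_sqrt_self a ha]
      rw [hc] at h
      simpa using h
    have haa : 0 ≤ a * a := by
      simpa [(IsSelfAdjoint.of_nonneg ha).star_eq] using star_mul_self_nonneg a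
    have h1 : ‖G t (a * a)‖ ≤ ‖a‖ * ‖G t a‖ := by
      refine (CStarAlgebra.norm_le_norm_of_nonneg_of_le ((hcp t).nonneg haa)
        ((hcp t).mono hle)).trans ?_
      rw [(hcp t).2.1, norm_smul]
      simp
    have h2 : ‖G t a‖ * ‖G t a‖ ≤ ‖a‖ * ‖G t a‖ + ε ^ 2 := by
      calc ‖G t a‖ * ‖G t a‖ = ‖G t a * G t a‖ := by
            have := CStarRing.norm_star_mul_self (x := G t a)
            rwa [(IsSelfAdjoint.of_nonneg ((hcp t).nonneg ha)).star_eq, eq_comm] at this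
        _ ≤ ‖G t (a * a)‖ + ‖G t (a * a) - G t a * G t a‖ := norm_le_norm_add_norm_sub _ _
        _ ≤ _ := add_le_add h1 ht
    by_contra! hcon
    nlinarith [norm_nonneg a]
  filter_upwards [hpos (star a * a) (star_mul_self_nonneg a) (ε ^ 2 / 2) (by positivity),
    hev (star a) a (ε ^ 2 / 2) (by positivity)] with t h1 h2
  rw [CStarRing.norm_star_mul_self] at h1
  have h3 : ‖G t a‖ * ‖G t a‖ ≤ ‖a‖ * ‖a‖ + ε ^ 2 := by
    calc ‖G t a‖ * ‖G t a‖ = ‖G t (star a) * G t a‖ := by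
          rw [(hcp t).map_star, CStarRing.norm_star_mul_self]
      _ ≤ ‖G t (star a * a)‖ + ‖G t (star a * a) - G t (star a) * G t a‖ :=
          norm_le_norm_add_norm_sub _ _
      _ ≤ _ := by linarith
  by_contra! hcon
  nlinarith [norm_nonneg a]

end AsymptoticBound

section Tent

/-- The square root of the tent function supported on `[-1, 1]`. -/
def sqrtTent (x : ℝ) : ℝ := √(max 0 (1 - |x|))

theorem continuous_sqrtTent : Continuous sqrtTent := by
  unfold sqrtTent
  fun_prop

theorem sqrtTent_nonneg (x : ℝ) : 0 ≤ sqrtTent x := Real.sqrt_nonneg _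

theorem sqrtTent_le_one (x : ℝ) : sqrtTent x ≤ 1 :=
  Real.sqrt_le_one.2 (max_le zero_le_one (by linarith [abs_nonneg x]))

theorem sqrtTent_eq_zero {x : ℝ} (hx : 1 ≤ |x|) : sqrtTent x = 0 := by
  rw [sqrtTent, max_eq_left (by linarith), Real.sqrt_zero]

theorem sqrtTent_mul_self (x : ℝ) : sqrtTent x * sqrtTent x = max 0 (1 - |x|) :=
  Real.mul_self_sqrt (le_max_left _ _)

theorem sum_sqrtTent_mul_self (n : ℕ) {y : ℝ} (hy0 : 0 ≤ y) (hyn : y ≤ n) :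
    ∑ i ∈ Finset.range (n + 1), sqrtTent (y - i) * sqrtTent (y - i) = 1 := by
  simp only [sqrtTent_mul_self]
  induction n with
  | zero =>
    obtain rfl : y = 0 := le_antisymm (by simpa using hyn) hy0
    simp
  | succ n ih =>
    rw [Finset.sum_range_succ]
    push_cast at hyn ⊢
    rcases le_or_gt y n with h | h
    · rw [ih h, abs_of_nonpos (by linarith), max_eq_left (by linarith), add_zero]
    · rw [Finset.sum_range_succ, Finset.sum_eq_zero fun i hi => ?_, abs_of_nonneg (by linarith),
        abs_of_nonpos (by linarith), max_eq_right (by linarith), max_eq_right (by linarith)]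
      · ring
      · have hi' : (i : ℝ) + 1 ≤ n := by exact_mod_cast Finset.mem_range.1 hi
        rw [abs_of_nonneg (by linarith), max_eq_left (by linarith)]

end Tent

section Partition

variable {E : Type*} [CStarAlgebra E]

/-- The `i`-th member of the partition of unity obtained by applying the square roots of the
tent functions centred at the natural numbers to `y`. -/
def tentCfc (y : E) (i : ℕ) : E := cfc (fun t => sqrtTent (t - i)) y

theorem continuous_sqrtTent_sub (i : ℕ) : Continuous fun t : ℝ => sqrtTent (t - i) :=
  continuous_sqrtTent.comp (by fun_prop)

theorem isSelfAdjoint_tentCfc (y : E) (i : ℕ) : IsSelfAdjoint (tentCfc y i) :=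
  cfc_predicate _ _

theorem norm_tentCfc_le (y : E) (i : ℕ) : ‖tentCfc y i‖ ≤ 1 :=
  norm_cfc_le zero_le_one fun t _ => by
    rw [Real.norm_of_nonneg (sqrtTent_nonneg _)]
    exact sqrtTent_le_one _

theorem tentCfc_mul (y : E) (i j : ℕ) :
    tentCfc y i * tentCfc y j = cfc (fun t => sqrtTent (t - i) * sqrtTent (t - j)) y :=
  (cfc_mul _ _ y (continuous_sqrtTent_sub i).continuousOn
    (continuous_sqrtTent_sub j).continuousOn).symm

theorem commute_tentCfc (y : E) (i j : ℕ) : Commute (tentCfc y i) (tentCfc y j) := by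
  rw [commute_iff_eq, tentCfc_mul, tentCfc_mul]
  simp only [mul_comm]

theorem tentCfc_mul_eq_zero (y : E) {i j : ℕ} (hij : i + 2 ≤ j) :
    tentCfc y i * tentCfc y j = 0 := by
  have hij' : (i : ℝ) + 2 ≤ j := by exact_mod_cast hij
  have : (fun t : ℝ => sqrtTent (t - i) * sqrtTent (t - j)) = fun _ => 0 := by
    funext t
    rcases le_or_gt 1 |t - i| with h | h
    · rw [sqrtTent_eq_zero h, zero_mul]
    · rw [sqrtTent_eq_zero (x := t - j), mul_zero]
      rw [abs_lt] at h
      rw [abs_of_nonpos (by linarith)]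
      linarith
  rw [tentCfc_mul, this, cfc_const_zero]

theorem sum_tentCfc_mul_self {y : E} (hy : IsSelfAdjoint y) (n : ℕ)
    (hsp : spectrum ℝ y ⊆ Set.Icc 0 (n : ℝ)) :
    ∑ i ∈ Finset.range (n + 1), tentCfc y i * tentCfc y i = 1 := by
  simp only [tentCfc_mul]
  rw [← cfc_sum (fun (i : ℕ) (t : ℝ) => sqrtTent (t - i) * sqrtTent (t - i)) y _ fun i _ =>
    ((continuous_sqrtTent_sub i).mul (continuous_sqrtTent_sub i)).continuousOn,
    ← cfc_const_one ℝ y]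
  refine cfc_congr fun t ht => ?_
  rw [Finset.sum_apply]
  exact sum_sqrtTent_mul_self n (hsp ht).1 (hsp ht).2

variable [PartialOrder E] [StarOrderedRing E]

theorem norm_sum_conj_mul_sum_conj_sub_le (N : ℕ) {p A B C : ℕ → E} {R δ κ : ℝ}
    (hR : 0 ≤ R) (hδ : 0 ≤ δ) (hκ : 0 ≤ κ) (hsa : ∀ i, IsSelfAdjoint (p i))
    (hp : ∀ i, ‖p i‖ ≤ 1) (hsum : ∑ i ∈ Finset.range N, p i * p i = 1)
    (hcomm : ∀ i j, Commute (p i) (p j))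
    (hA : ∀ i < N, ‖A i‖ ≤ R) (hB : ∀ i < N, ‖B i‖ ≤ R)
    (hpA : ∀ i < N, ∀ j < N, ‖p i * A j - A j * p i‖ ≤ δ)
    (hpB : ∀ i < N, ∀ j < N, ‖p i * B j - B j * p i‖ ≤ δ)
    (hpC : ∀ i < N, ∀ j < N, ‖p i * C j - C j * p i‖ ≤ δ)
    (hK : ∀ i < N, ∀ j < N, ∃ K, ‖K‖ ≤ κ ∧
      ‖p i * p j * (A i * B j - C i - K) * (p i * p j)‖ ≤ δ) :
    ‖(∑ i ∈ Finset.range N, p i * A i * p i) * (∑ i ∈ Finset.range N, p i * B i * p i) -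
        ∑ i ∈ Finset.range N, p i * C i * p i‖ ≤ 4 * κ + N ^ 2 * ((2 * R + 2) * δ) := by
  choose! K hKn hK using hK
  set P := Finset.range N ×ˢ Finset.range N with hP
  set w : ℕ × ℕ → E := fun ij => p ij.1 * p ij.2 with hw
  have hwsa : ∀ ij, star (w ij) = w ij := fun ij => by
    simp only [hw, star_mul, (hsa _).star_eq]
    exact (hcomm _ _).eq
  have hw1 : ∑ ij ∈ P, star (w ij) * w ij = 1 := by
    simp only [hwsa]
    rw [hP, Finset.sum_product]
    calc ∑ i ∈ Finset.range N, ∑ j ∈ Finset.range N, p i * p j * (p i * p j)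
        = ∑ i ∈ Finset.range N, p i * (∑ j ∈ Finset.range N, p j * p j) * p i := by
          refine Finset.sum_congr rfl fun i _ => ?_
          rw [Finset.mul_sum, Finset.sum_mul]
          refine Finset.sum_congr rfl fun j _ => ?_
          rw [(hcomm i j).eq]
          nth_rewrite 1 [← (hcomm i j).eq]
          simp only [mul_assoc]
      _ = 1 := by rw [hsum]; simpa using hsum
  have hmain : (∑ i ∈ Finset.range N, p i * A i * p i) * (∑ i ∈ Finset.range N, p i * B i * p i) -
        ∑ i ∈ Finset.range N, p i * C i * p i =
      ∑ ij ∈ P, (p ij.1 * A ij.1 * p ij.1 * (p ij.2 * B ij.2 * p ij.2) -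
        p ij.1 * C ij.1 * p ij.1 * (p ij.2 * p ij.2)) := by
    rw [Finset.sum_sub_distrib, hP, Finset.sum_product, Finset.sum_product,
      Finset.sum_mul_sum]
    simp only [← Finset.mul_sum, hsum, mul_one]
  have hterm : ∀ ij ∈ P, ‖(p ij.1 * A ij.1 * p ij.1 * (p ij.2 * B ij.2 * p ij.2) -
        p ij.1 * C ij.1 * p ij.1 * (p ij.2 * p ij.2)) -
        star (w ij) * K ij.1 ij.2 * w ij‖ ≤ (2 * R + 2) * δ := by
    rintro ⟨i, j⟩ hij
    obtain ⟨hi, hj⟩ : i < N ∧ j < N := by simpa [hP] using hij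
    rw [hwsa]
    simp only [hw]
    have e : (p i * A i * p i * (p j * B j * p j) - p i * C i * p i * (p j * p j)) -
        p i * p j * K i j * (p i * p j) =
        -(p i * (p j * A i - A i * p j) * (p i * B j * p j))
        + p i * p j * A i * (p i * B j - B j * p i) * p j
        + p i * (p j * C i - C i * p j) * (p i * p j)
        + p i * p j * (A i * B j - C i - K i j) * (p i * p j) := by
      have h := (hcomm i j).eq
      have h' : ∀ x, p i * (p j * x) = p j * (p i * x) := fun x => by
        rw [← mul_assoc, h, mul_assoc]
      simp only [mul_sub, sub_mul, mul_assoc, h, h']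
      abel
    rw [e]
    have n3 : ∀ a b c : E, ‖a * b * c‖ ≤ ‖a‖ * ‖b‖ * ‖c‖ := fun a b c =>
      norm_mul₃_le
    have hw1 : ‖p i * p j‖ ≤ 1 :=
      (norm_mul_le _ _).trans (mul_le_one₀ (hp i) (norm_nonneg _) (hp j))
    have b1 : ‖p i * (p j * A i - A i * p j) * (p i * B j * p j)‖ ≤ 1 * δ * (1 * R * 1) := by
      refine (n3 _ _ _).trans ?_
      gcongr
      · exact hp i
      · exact hpA j hj i hi
      · refine (n3 _ _ _).trans ?_
        gcongr
        exacts [hp i, hB j hj, hp j]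
    have b2 : ‖p i * p j * A i * (p i * B j - B j * p i) * p j‖ ≤ 1 * R * δ * 1 := by
      refine (n3 _ _ _).trans ?_
      gcongr
      · refine (norm_mul_le _ _).trans ?_
        gcongr
        exact hA i hi
      · exact hpB i hi j hj
      · exact hp j
    have b3 : ‖p i * (p j * C i - C i * p j) * (p i * p j)‖ ≤ 1 * δ * 1 := by
      refine (n3 _ _ _).trans ?_
      gcongr
      exacts [hp i, hpC j hj i hi]
    have b4 := hK i hi j hj
    refine (norm_add_le _ _).trans ?_
    refine (add_le_add_left (norm_add₃_le) _).trans ?_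
    rw [norm_neg]
    linarith
  calc _ = ‖∑ ij ∈ P, ((p ij.1 * A ij.1 * p ij.1 * (p ij.2 * B ij.2 * p ij.2) -
        p ij.1 * C ij.1 * p ij.1 * (p ij.2 * p ij.2)) - star (w ij) * K ij.1 ij.2 * w ij)
        + ∑ ij ∈ P, star (w ij) * K ij.1 ij.2 * w ij‖ := by
        rw [hmain, ← Finset.sum_add_distrib]
        simp only [sub_add_cancel]
    _ ≤ N ^ 2 * ((2 * R + 2) * δ) + 4 * κ := by
        refine (norm_add_le _ _).trans (add_le_add ?_ ?_)
        · refine (norm_sum_le_of_le P hterm).trans ?_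
          simp [hP, sq]
        · refine norm_sum_conj_le P w (fun ij => K ij.1 ij.2) hw1.le ?_ hκ
          rintro ⟨i, j⟩ hij
          obtain ⟨hi, hj⟩ : i < N ∧ j < N := by simpa [hP] using hij
          exact hKn i hi j hj
    _ = _ := add_comm _ _

end Partition

section Path

variable {E : Type*} [CStarAlgebra E]

theorem spectrum_zero_subset_Icc {R : ℝ} (hR : 0 ≤ R) : spectrum ℝ (0 : E) ⊆ Set.Icc 0 R := by
  rcases subsingleton_or_nontrivial E with h | h
  · simp [spectrum.of_subsingleton]
  · rw [spectrum.zero_eq]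
    simpa using hR

theorem tentCfc_zero {i : ℕ} (hi : 1 ≤ i) : tentCfc (0 : E) i = 0 := by
  have hi' : (1 : ℝ) ≤ i := by exact_mod_cast hi
  rw [tentCfc, cfc_apply_zero, sqrtTent_eq_zero, map_zero]
  rw [abs_of_nonpos (by linarith)]
  linarith

theorem exists_delta_tentCfc (E : Type*) [CStarAlgebra E] {R : ℝ} (hR : 0 ≤ R) (n : ℕ) {ε : ℝ}
    (hε : 0 < ε) :
    ∃ δ > 0, ∀ (y z : E), IsSelfAdjoint y → spectrum ℝ y ⊆ Set.Icc 0 R → ∀ i ≤ n,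
      (‖y * z - z * y‖ ≤ δ → ‖tentCfc y i * z - z * tentCfc y i‖ ≤ ε * (1 + ‖z‖)) ∧
      (1 ≤ i → ‖y * z‖ ≤ δ → ‖tentCfc y i * z‖ ≤ ε * (1 + ‖z‖)) ∧
      (1 ≤ i → ‖z * y‖ ≤ δ → ‖z * tentCfc y i‖ ≤ ε * (1 + ‖z‖)) := by
  induction n with
  | zero =>
    obtain ⟨δ, hδ, h⟩ := exists_delta_intertwine E (R := R) (continuous_sqrtTent_sub 0) hε
    refine ⟨δ, hδ, fun y z hy hsp i hi => ?_⟩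
    obtain rfl : i = 0 := by omega
    exact ⟨h y y z hy hy hsp hsp, by omega, by omega⟩
  | succ n ih =>
    obtain ⟨δ₁, hδ₁, h₁⟩ := ih
    obtain ⟨δ₂, hδ₂, h₂⟩ := exists_delta_intertwine E (R := R) (continuous_sqrtTent_sub (n + 1)) hε
    refine ⟨min δ₁ δ₂, lt_min hδ₁ hδ₂, fun y z hy hsp i hi => ?_⟩
    rcases Nat.lt_or_ge n i with hin | hin
    · obtain rfl : i = n + 1 := by omega
      have h0 := tentCfc_zero (E := E) (i := n + 1) (by omega)
      rw [tentCfc] at h0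
      refine ⟨fun h => h₂ y y z hy hy hsp hsp (h.trans (min_le_right _ _)), fun _ h => ?_,
        fun _ h => ?_⟩
      · have := h₂ y 0 z hy (.zero E) hsp (spectrum_zero_subset_Icc hR)
          (by simpa using h.trans (min_le_right _ _))
        rw [h0, mul_zero, sub_zero] at this
        exact this
      · have := h₂ 0 y z (.zero E) hy (spectrum_zero_subset_Icc hR) hsp
          (by simpa using h.trans (min_le_right _ _))
        rw [h0, zero_mul, zero_sub, norm_neg] at this
        exact this
    · obtain ⟨a, b, c⟩ := h₁ y z hy hsp i hin
      exact ⟨fun h => a (h.trans (min_le_left _ _)), fun hi h => b hi (h.trans (min_le_left _ _)),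
        fun hi h => c hi (h.trans (min_le_left _ _))⟩

theorem exists_pos_le_of_forall_pos (δ : ℕ → ℝ) (hδ : ∀ n, 0 < δ n) (n : ℕ) :
    ∃ d > 0, ∀ k ≤ n, d ≤ δ k := by
  induction n with
  | zero => exact ⟨δ 0, hδ 0, fun k hk => by rw [Nat.le_zero.1 hk]⟩
  | succ n ih =>
    obtain ⟨d, hd, h⟩ := ih
    refine ⟨min d (δ (n + 1)), lt_min hd (hδ _), fun k hk => ?_⟩
    rcases Nat.lt_or_ge n k with hnk | hnk
    · obtain rfl : k = n + 1 := by omega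
      exact min_le_right _ _
    · exact (min_le_left _ _).trans (h k hnk)

variable [PartialOrder E] [StarOrderedRing E] {F : Type*} [CStarAlgebra F]

theorem exists_quasicentral_path (q : E →⋆ₐ[ℂ] F) {K X : ℕ → Set E} (hK : ∀ n, IsCompact (K n))
    (hX : ∀ n, IsCompact (X n)) (hXq : ∀ n, ∀ x ∈ X n, q x = 0) {δ : ℕ → ℝ} (hδ : ∀ n, 0 < δ n) :
    ∃ u : C(ℝ, E), ∀ r, q (u r) = 0 ∧ 0 ≤ u r ∧ u r ≤ 1 ∧
      (∀ x ∈ X ⌊r⌋₊, ‖x * (1 - u r)‖ ≤ δ ⌊r⌋₊ ∧ ‖(1 - u r) * x‖ ≤ δ ⌊r⌋₊) ∧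
      ∀ d ∈ K ⌊r⌋₊, ‖u r * d - d * u r‖ ≤ δ ⌊r⌋₊ := by
  let S : ℕ → Set E := fun n => {u | q u = 0 ∧ 0 ≤ u ∧ u ≤ 1 ∧ ∀ k ≤ n,
    (∀ x ∈ X k, ‖x * (1 - u)‖ ≤ δ k ∧ ‖(1 - u) * x‖ ≤ δ k) ∧
      ∀ d ∈ K k, ‖u * d - d * u‖ ≤ δ k}
  have hS : ∀ n, Convex ℝ (S n) := by
    intro n u hu v hv a b ha hb hab
    have h1 : 1 - (a • u + b • v) = a • (1 - u) + b • (1 - v) := by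
      rw [smul_sub, smul_sub, sub_add_sub_comm, ← add_smul, hab, one_smul]
    have hn : ∀ (w w' : E) (k : ℕ), ‖w‖ ≤ δ k → ‖w'‖ ≤ δ k → ‖a • w + b • w'‖ ≤ δ k := by
      intro w w' k hw hw'
      calc ‖a • w + b • w'‖ ≤ a * ‖w‖ + b * ‖w'‖ := by
            refine (norm_add_le _ _).trans_eq ?_
            rw [norm_smul, norm_smul, Real.norm_of_nonneg ha, Real.norm_of_nonneg hb]
        _ ≤ a * δ k + b * δ k := by gcongr
        _ = δ k := by rw [← add_mul, hab, one_mul]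
    refine ⟨?_, add_nonneg (smul_nonneg ha hu.2.1) (smul_nonneg hb hv.2.1), ?_, fun k hk =>
      ⟨fun x hx => ⟨?_, ?_⟩, fun d hd => ?_⟩⟩
    · have : ∀ (c : ℝ) (w : E), q (c • w) = c • q w := fun c w => by
        rw [← Complex.coe_smul, map_smul, Complex.coe_smul]
      rw [map_add, this, this, hu.1, hv.1]
      simp
    · rw [← sub_nonneg, h1]
      exact add_nonneg (smul_nonneg ha (sub_nonneg.2 hu.2.2.1))
        (smul_nonneg hb (sub_nonneg.2 hv.2.2.1))
    · rw [h1, mul_add, mul_smul_comm, mul_smul_comm]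
      exact hn _ _ k ((hu.2.2.2 k hk).1 x hx).1 ((hv.2.2.2 k hk).1 x hx).1
    · rw [h1, add_mul, smul_mul_assoc, smul_mul_assoc]
      exact hn _ _ k ((hu.2.2.2 k hk).1 x hx).2 ((hv.2.2.2 k hk).1 x hx).2
    · have : (a • u + b • v) * d - d * (a • u + b • v) =
          a • (u * d - d * u) + b • (v * d - d * v) := by
        simp only [add_mul, mul_add, smul_mul_assoc, mul_smul_comm, smul_sub]
        abel
      rw [this]
      exact hn _ _ k ((hu.2.2.2 k hk).2 d hd) ((hv.2.2.2 k hk).2 d hd)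
  have hne : ∀ n, (S n).Nonempty := by
    intro n
    obtain ⟨d, hd, hdk⟩ := exists_pos_le_of_forall_pos δ hδ n
    obtain ⟨u, hu, hu0, hu1, huX, huK⟩ := exists_quasicentral q
      (K := ⋃ k ∈ Set.Iic n, K k) (X := ⋃ k ∈ Set.Iic n, X k)
      ((Set.finite_Iic n).isCompact_biUnion fun k _ => hK k)
      ((Set.finite_Iic n).isCompact_biUnion fun k _ => hX k)
      (by simp only [Set.mem_iUnion]; rintro x ⟨k, _, hx⟩; exact hXq k x hx) hd
    refine ⟨u, hu, hu0, hu1, fun k hk => ⟨fun x hx => ?_, fun z hz => ?_⟩⟩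
    · have := huX x (Set.mem_biUnion (Set.mem_Iic.2 hk) hx)
      exact ⟨this.1.trans (hdk k hk), this.2.trans (hdk k hk)⟩
    · exact (huK z (Set.mem_biUnion (Set.mem_Iic.2 hk) hz)).trans (hdk k hk)
  obtain ⟨u, hu⟩ := exists_continuous_forall_mem_convex_of_local_const
    (t := fun r : ℝ => S ⌊r⌋₊) (fun r => hS _) fun r => by
      obtain ⟨v, hv⟩ := hne (⌊r⌋₊ + 1)
      refine ⟨v, ?_⟩
      filter_upwards [Iio_mem_nhds (Nat.lt_floor_add_one r)] with r' hr'
      have hle : ⌊r'⌋₊ ≤ ⌊r⌋₊ + 1 := by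
        refine Nat.floor_le_of_le ?_
        push_cast
        exact le_of_lt hr'
      exact ⟨hv.1, hv.2.1, hv.2.2.1, fun k hk => hv.2.2.2 k (hk.trans hle)⟩
  exact ⟨u, fun r => ⟨(hu r).1, (hu r).2.1, (hu r).2.2.1, (hu r).2.2.2 _ le_rfl⟩⟩

theorem exists_tentCfc_path (q : E →⋆ₐ[ℂ] F) {K X : ℕ → Set E} (hK : ∀ n, IsCompact (K n))
    (hX : ∀ n, IsCompact (X n)) (hXq : ∀ n, ∀ x ∈ X n, q x = 0) {ε : ℕ → ℝ} (hε : ∀ n, 0 < ε n) :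
    ∃ y : ℝ → E, Continuous y ∧ ∀ r, 0 ≤ r → IsSelfAdjoint (y r) ∧
      spectrum ℝ (y r) ⊆ Set.Icc 0 r ∧ q (y r) = algebraMap ℝ F r ∧ ∀ i ≤ ⌊r⌋₊ + 1,
        (∀ d ∈ K ⌊r⌋₊, ‖tentCfc (y r) i * d - d * tentCfc (y r) i‖ ≤ ε ⌊r⌋₊ * (1 + ‖d‖)) ∧
        (1 ≤ i → ∀ x ∈ X ⌊r⌋₊, ‖tentCfc (y r) i * x‖ ≤ ε ⌊r⌋₊ * (1 + ‖x‖) ∧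
          ‖x * tentCfc (y r) i‖ ≤ ε ⌊r⌋₊ * (1 + ‖x‖)) := by
  choose δ hδ hδt using fun n : ℕ =>
    exists_delta_tentCfc E (R := n + 1) (by positivity) (n + 1) (hε n)
  obtain ⟨u, hu⟩ := exists_quasicentral_path q hK hX hXq
    (δ := fun n => δ n / (n + 1)) fun n => div_pos (hδ n) (by positivity)
  refine ⟨fun r => r • (1 - u r), by fun_prop, fun r hr => ?_⟩
  obtain ⟨hq0, hu0, hu1, huX, huK⟩ := hu r
  set n := ⌊r⌋₊ with hn
  have hrn : r ≤ n + 1 := (Nat.lt_floor_add_one r).le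
  have hv0 : 0 ≤ r • (1 - u r) := smul_nonneg hr (sub_nonneg.2 hu1)
  have hsa : IsSelfAdjoint (r • (1 - u r)) := .of_nonneg hv0
  have hsp : spectrum ℝ (r • (1 - u r)) ⊆ Set.Icc 0 r := by
    have hle : r • (1 - u r) ≤ algebraMap ℝ E r := by
      rw [Algebra.algebraMap_eq_smul_one]
      exact smul_le_smul_of_nonneg_left (sub_le_self _ hu0) hr
    exact fun t ht => ⟨spectrum_nonneg_of_nonneg hv0 ht,
      (le_algebraMap_iff_spectrum_le hsa).1 hle t ht⟩
  have hmul : ∀ e : E, ‖e‖ ≤ δ n / (n + 1) → ‖r • e‖ ≤ δ n := by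
    intro e he
    rw [norm_smul, Real.norm_of_nonneg hr]
    calc r * ‖e‖ ≤ (n + 1) * (δ n / (n + 1)) := by gcongr
      _ = δ n := by field_simp
  have hsp' : spectrum ℝ (r • (1 - u r)) ⊆ Set.Icc 0 ((n : ℝ) + 1) :=
    hsp.trans (Set.Icc_subset_Icc_right hrn)
  refine ⟨hsa, hsp, ?_, fun i hi => ⟨fun d hd => ?_, fun h1 x hx => ⟨?_, ?_⟩⟩⟩
  · change q (r • (1 - u r)) = _
    rw [← Complex.coe_smul, map_smul, map_sub, hq0, map_one, sub_zero, Complex.coe_smul,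
      Algebra.algebraMap_eq_smul_one]
  · refine (hδt n _ d hsa hsp' i hi).1 ?_
    have : r • (1 - u r) * d - d * r • (1 - u r) = r • -(u r * d - d * u r) := by
      simp only [smul_mul_assoc, mul_smul_comm, ← smul_sub]
      congr 1
      noncomm_ring
    rw [this]
    exact hmul _ (by rw [norm_neg]; exact huK d hd)
  · refine (hδt n _ x hsa hsp' i hi).2.1 h1 ?_
    rw [smul_mul_assoc]
    exact hmul _ (huX x hx).2
  · refine (hδt n _ x hsa hsp' i hi).2.2 h1 ?_
    rw [mul_smul_comm]
    exact hmul _ (huX x hx).1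

end Path

section Compression

variable {E : Type*} [CStarAlgebra E]

/-- The compression `∑ pᵢ Aᵢ pᵢ` of a sequence by the tent partition of unity of `y`. -/
def tentSum (N : ℕ) (y : E) (A : ℕ → E) : E :=
  ∑ i ∈ Finset.range N, tentCfc y i * A i * tentCfc y i

theorem tentCfc_mul_eq_zero_of_dist (y : E) {i j : ℕ} (hij : i + 2 ≤ j ∨ j + 2 ≤ i) :
    tentCfc y i * tentCfc y j = 0 := by
  rcases hij with h | h
  · exact tentCfc_mul_eq_zero y h
  · rw [(commute_tentCfc y i j).eq, tentCfc_mul_eq_zero y h]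

theorem tentCfc_eq_zero {y : E} {r : ℝ} (hsp : spectrum ℝ y ⊆ Set.Icc 0 r) {i : ℕ}
    (hi : r + 1 ≤ i) : tentCfc y i = 0 := by
  rw [tentCfc, ← cfc_const_zero ℝ y]
  refine cfc_congr fun t ht => sqrtTent_eq_zero ?_
  have := (hsp ht).2
  rw [abs_of_nonpos (by linarith)]
  linarith

theorem tentSum_eq_of_le {y : E} {r : ℝ} (hsp : spectrum ℝ y ⊆ Set.Icc 0 r) (A : ℕ → E) {N : ℕ}
    (hN : ⌊r⌋₊ + 2 ≤ N) : tentSum (⌊r⌋₊ + 2) y A = tentSum N y A := by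
  refine Finset.sum_subset (Finset.range_mono hN) fun i _ hi => ?_
  have hi' : ⌊r⌋₊ + 2 ≤ i := by simpa using hi
  have h : ((⌊r⌋₊ : ℝ)) + 2 ≤ i := by exact_mod_cast hi'
  rw [tentCfc_eq_zero hsp (by linarith [Nat.lt_floor_add_one r]), mul_zero]

theorem sum_tentCfc_mul_self_floor {y : E} (hy : IsSelfAdjoint y) {r : ℝ}
    (hsp : spectrum ℝ y ⊆ Set.Icc 0 r) :
    ∑ i ∈ Finset.range (⌊r⌋₊ + 2), tentCfc y i * tentCfc y i = 1 := by
  refine sum_tentCfc_mul_self hy (⌊r⌋₊ + 1) (hsp.trans (Set.Icc_subset_Icc_right ?_))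
  push_cast
  exact (Nat.lt_floor_add_one r).le

theorem continuous_tentSum {T : Type*} [TopologicalSpace T] {lam : T → ℝ} (hlam : Continuous lam)
    {y : T → E} (hy : Continuous y) (hsa : ∀ t, IsSelfAdjoint (y t))
    (hsp : ∀ t, spectrum ℝ (y t) ⊆ Set.Icc 0 (lam t)) {A : T → ℕ → E}
    (hA : ∀ i, Continuous fun t => A t i) :
    Continuous fun t => tentSum (⌊lam t⌋₊ + 2) (y t) (A t) := by
  have hev : ∀ t₀, ∀ᶠ t in 𝓝 t₀, lam t < ⌊lam t₀⌋₊ + 1 := fun t₀ =>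
    hlam.continuousAt.eventually_lt_const (Nat.lt_floor_add_one _)
  have hp : ∀ i, Continuous fun t => tentCfc (y t) i := fun i => by
    refine Continuous.cfc (s := fun t₀ => Set.Icc 0 ((⌊lam t₀⌋₊ : ℝ) + 1))
      (fun t => sqrtTent (t - i)) hy (fun _ => isCompact_Icc)
      (fun t₀ => ?_) (fun _ => (continuous_sqrtTent_sub i).continuousOn) hsa
    filter_upwards [hev t₀] with t ht
    exact (hsp t).trans (Set.Icc_subset_Icc_right ht.le)
  rw [continuous_iff_continuousAt]
  intro t₀
  have hc : Continuous fun t => tentSum (⌊lam t₀⌋₊ + 3) (y t) (A t) :=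
    continuous_finsetSum _ fun i _ => ((hp i).mul (hA i)).mul (hp i)
  refine hc.continuousAt.congr ?_
  filter_upwards [hev t₀] with t ht
  refine (tentSum_eq_of_le (hsp t) _ ?_).symm
  have : ⌊lam t⌋₊ ≤ ⌊lam t₀⌋₊ + 1 := Nat.floor_le_of_le (by push_cast; exact ht.le)
  omega

theorem map_tentSum {F : Type*} [CStarAlgebra F] (q : E →⋆ₐ[ℂ] F) {y : E} (hy : IsSelfAdjoint y)
    {r : ℝ} (hr : 0 ≤ r) (hqy : q y = algebraMap ℝ F r) {A : ℕ → E} {c : F}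
    (hA : ∀ i : ℕ, r < i + 1 → (i : ℝ) < r + 1 → q (A i) = c) :
    q (tentSum (⌊r⌋₊ + 2) y A) = c := by
  have hp : ∀ i, q (tentCfc y i) = algebraMap ℝ F (sqrtTent (r - i)) := fun i => by
    rw [tentCfc, StarAlgHomClass.map_cfc (S := ℂ) q _ y
      ((continuous_sqrtTent_sub i).continuousOn) ?_ hy (hy.map q), hqy, cfc_algebraMap]
    fun_prop
  have hterm : ∀ i, q (tentCfc y i * A i * tentCfc y i) =
      (sqrtTent (r - i) * sqrtTent (r - i)) • c := fun i => by
    rw [map_mul, map_mul, hp, Algebra.algebraMap_eq_smul_one, mul_smul_comm, mul_one,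
      smul_mul_assoc, one_mul, smul_smul]
    by_cases h : 1 ≤ |r - i|
    · rw [sqrtTent_eq_zero h]
      simp
    · rw [not_le, abs_lt] at h
      rw [hA i (by linarith) (by linarith)]
  rw [tentSum, map_sum, Finset.sum_congr rfl fun i _ => hterm i, ← Finset.sum_smul,
    sum_sqrtTent_mul_self (⌊r⌋₊ + 1) hr, one_smul]
  push_cast
  exact (Nat.lt_floor_add_one r).le

variable [PartialOrder E] [StarOrderedRing E]

theorem norm_tentSum_le {y : E} (hy : IsSelfAdjoint y) {r : ℝ}
    (hsp : spectrum ℝ y ⊆ Set.Icc 0 r) {A : ℕ → E} {κ : ℝ} (hκ : 0 ≤ κ) (hA : ∀ i, ‖A i‖ ≤ κ) :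
    ‖tentSum (⌊r⌋₊ + 2) y A‖ ≤ 4 * κ := by
  have h := norm_sum_conj_le (Finset.range (⌊r⌋₊ + 2)) (tentCfc y) A (κ := κ) ?_
    (fun i _ => hA i) hκ
  · simpa only [(isSelfAdjoint_tentCfc y _).star_eq, tentSum] using h
  · simp only [(isSelfAdjoint_tentCfc y _).star_eq]
    exact (sum_tentCfc_mul_self_floor hy hsp).le

theorem norm_tentSum_mul_tentSum_sub_le {y : E} (hy : IsSelfAdjoint y) {r : ℝ}
    (hsp : spectrum ℝ y ⊆ Set.Icc 0 r) {A B C S S' S'' : ℕ → E} {R ε η μ : ℝ}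
    (hR : 0 ≤ R) (hε : 0 ≤ ε) (hη : 0 ≤ η) (hμ : 0 ≤ μ)
    (hA : ∀ i, ‖A i‖ ≤ R) (hB : ∀ i, ‖B i‖ ≤ R) (hS : ∀ i, ‖S i‖ ≤ R)
    (hpA : ∀ i < ⌊r⌋₊ + 2, ∀ j, ‖tentCfc y i * A j - A j * tentCfc y i‖ ≤ ε)
    (hpB : ∀ i < ⌊r⌋₊ + 2, ∀ j, ‖tentCfc y i * B j - B j * tentCfc y i‖ ≤ ε)
    (hpC : ∀ i < ⌊r⌋₊ + 2, ∀ j, ‖tentCfc y i * C j - C j * tentCfc y i‖ ≤ ε)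
    (hkA : ∀ i < ⌊r⌋₊ + 2, 1 ≤ i → ∀ j, ‖tentCfc y i * (A j - S j)‖ ≤ ε)
    (hkB : ∀ i < ⌊r⌋₊ + 2, 1 ≤ i → ∀ j, ‖(B j - S' j) * tentCfc y i‖ ≤ ε)
    (hkC : ∀ i < ⌊r⌋₊ + 2, 1 ≤ i → ∀ j, ‖tentCfc y i * (C j - S'' j)‖ ≤ ε)
    (hkS : ∀ i < ⌊r⌋₊ + 2, 1 ≤ i → ∀ j, ‖tentCfc y i * (S j * S' j - S'' j)‖ ≤ ε)
    (hSη : ∀ i j, i ≤ j + 1 → j ≤ i + 1 → ‖S' j - S' i‖ ≤ η) (h₀ : ‖A 0 * B 0 - C 0‖ ≤ μ) :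
    ‖tentSum (⌊r⌋₊ + 2) y A * tentSum (⌊r⌋₊ + 2) y B - tentSum (⌊r⌋₊ + 2) y C‖ ≤
      4 * (R * η + μ) + ((⌊r⌋₊ + 2 : ℕ) : ℝ) ^ 2 * ((2 * R + 2) * ((2 * R + 2) * ε)) := by
  have hle : ε ≤ (2 * R + 2) * ε := by nlinarith
  have hp := norm_tentCfc_le y
  have hp2 : ∀ i j, ‖tentCfc y i * tentCfc y j‖ ≤ 1 := fun i j =>
    (norm_mul_le _ _).trans (mul_le_one₀ (hp i) (norm_nonneg _) (hp j))
  refine norm_sum_conj_mul_sum_conj_sub_le (⌊r⌋₊ + 2) hR (by positivity) (by positivity)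
    (isSelfAdjoint_tentCfc y) hp (sum_tentCfc_mul_self_floor hy hsp)
    (commute_tentCfc y) (fun i _ => hA i) (fun i _ => hB i) (fun i hi j _ => (hpA i hi j).trans hle)
    (fun i hi j _ => (hpB i hi j).trans hle) (fun i hi j _ => (hpC i hi j).trans hle)
    fun i hi j hj => ?_
  by_cases hfar : i + 2 ≤ j ∨ j + 2 ≤ i
  · refine ⟨0, by rw [norm_zero]; positivity, ?_⟩
    rw [tentCfc_mul_eq_zero_of_dist y hfar]
    simp only [zero_mul, norm_zero]
    positivity
  by_cases h00 : i = 0 ∧ j = 0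
  · obtain ⟨rfl, rfl⟩ := h00
    refine ⟨A 0 * B 0 - C 0, h₀.trans (le_add_of_nonneg_left (by positivity)), ?_⟩
    rw [sub_self, mul_zero, zero_mul, norm_zero]
    positivity
  refine ⟨S i * (S' j - S' i), ?_, ?_⟩
  · refine (norm_mul_le _ _).trans ((mul_le_mul (hS i) (hSη i j (by omega) (by omega))
      (norm_nonneg _) hR).trans (le_add_of_nonneg_right hμ))
  obtain ⟨k, l, hk, hk1, hkl, hlk⟩ : ∃ k l, k < ⌊r⌋₊ + 2 ∧ 1 ≤ k ∧
      tentCfc y i * tentCfc y j = tentCfc y k * tentCfc y l ∧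
      tentCfc y i * tentCfc y j = tentCfc y l * tentCfc y k := by
    rcases Nat.eq_zero_or_pos i with h | h
    · exact ⟨j, i, hj, by omega, (commute_tentCfc y i j).eq, rfl⟩
    · exact ⟨i, j, hi, h, rfl, (commute_tentCfc y i j).eq⟩
  have hleft : ∀ X Y : E, ‖tentCfc y k * X‖ ≤ ε →
      ‖tentCfc y i * tentCfc y j * (X * Y) * (tentCfc y i * tentCfc y j)‖ ≤ ε * ‖Y‖ := by
    intro X Y hX
    calc _ = ‖tentCfc y l * (tentCfc y k * X) * (Y * (tentCfc y i * tentCfc y j))‖ := by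
          nth_rewrite 1 [hlk]
          simp only [mul_assoc]
      _ ≤ 1 * ε * (‖Y‖ * 1) := by
          refine norm_mul₃_le.trans ?_
          gcongr
          · exact hp l
          · refine (norm_mul_le _ _).trans ?_
            gcongr
            exact hp2 i j
      _ = _ := by ring
  have hleft' : ∀ X : E, ‖tentCfc y k * X‖ ≤ ε →
      ‖tentCfc y i * tentCfc y j * X * (tentCfc y i * tentCfc y j)‖ ≤ ε := by
    intro X hX
    calc _ = ‖tentCfc y l * (tentCfc y k * X) * (tentCfc y i * tentCfc y j)‖ := by
          nth_rewrite 1 [hlk]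
          simp only [mul_assoc]
      _ ≤ 1 * ε * 1 := by
          refine norm_mul₃_le.trans ?_
          gcongr
          · exact hp l
          · exact hp2 i j
      _ = _ := by ring
  have hright : ∀ X Y : E, ‖X * tentCfc y k‖ ≤ ε →
      ‖tentCfc y i * tentCfc y j * (Y * X) * (tentCfc y i * tentCfc y j)‖ ≤ ‖Y‖ * ε := by
    intro X Y hX
    calc _ = ‖tentCfc y i * tentCfc y j * Y * (X * tentCfc y k) * tentCfc y l‖ := by
          nth_rewrite 2 [hkl]
          simp only [mul_assoc]
      _ ≤ 1 * ‖Y‖ * ε * 1 := by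
          refine norm_mul₃_le.trans ?_
          gcongr
          · refine (norm_mul_le _ _).trans ?_
            gcongr
            exact hp2 i j
          · exact hp l
      _ = _ := by ring
  have hsplit : A i * B j - C i - S i * (S' j - S' i) =
      (A i - S i) * B j + S i * (B j - S' j) + (S i * S' i - S'' i) - (C i - S'' i) := by
    noncomm_ring
  rw [hsplit]
  have hdist : ∀ w a b c d : E, w * (a + b + c - d) * w =
      w * a * w + w * b * w + w * c * w - w * d * w := by
    intros
    noncomm_ring
  rw [hdist]
  refine (norm_sub_le _ _).trans ?_
  refine (add_le_add_left norm_add₃_le _).trans ?_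
  have h1 := hleft (A i - S i) (B j) (hkA k hk hk1 i)
  have h2 := hright (B j - S' j) (S i) (hkB k hk hk1 j)
  have h3 := hleft' _ (hkS k hk hk1 i)
  have h4 := hleft' _ (hkC k hk hk1 i)
  have h5 : ε * ‖B j‖ ≤ ε * R := by gcongr; exact hB j
  have h6 : ‖S i‖ * ε ≤ R * ε := by gcongr; exact hS i
  linarith

end Compression

section Asymptotic

/-- The sequence equal to `g` at `0` whose `i`-th term, for `i ≥ 1`, samples `S` at the time
`min 1 (2 * i / x)`. -/
def tentFamily {α : Type*} (x : ℝ) (g : α) (S : unitInterval → α) (i : ℕ) : α :=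
  if i = 0 then g else S (Set.projIcc 0 1 zero_le_one (2 * i / x))

theorem dist_projIcc_le {x : ℝ} (hx : 0 < x) {i j : ℕ} (hij : i ≤ j + 1) (hji : j ≤ i + 1) :
    dist (Set.projIcc (0 : ℝ) 1 zero_le_one (2 * j / x))
      (Set.projIcc (0 : ℝ) 1 zero_le_one (2 * i / x)) ≤ 2 / x := by
  have h := (LipschitzWith.projIcc (a := (0 : ℝ)) (b := 1) zero_le_one).dist_le_mul
    (2 * j / x) (2 * i / x)
  refine h.trans ?_
  have h1 : (i : ℝ) ≤ j + 1 := by exact_mod_cast hij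
  have h2 : (j : ℝ) ≤ i + 1 := by exact_mod_cast hji
  rw [NNReal.coe_one, one_mul, Real.dist_eq, ← sub_div, abs_div, abs_of_pos hx]
  gcongr
  rw [abs_le]
  constructor <;> linarith

variable {C E F T : Type*} [Mul C] [CStarAlgebra E] [PartialOrder E] [StarOrderedRing E]
  [CStarAlgebra F] [TopologicalSpace T]

theorem exists_tentSum_asymptotically_mul {l : Filter T} {lam : T → ℝ} (hlam : Continuous lam)
    (hlam1 : ∀ t, 1 ≤ lam t) (hcpt : ∀ c, IsCompact {t | lam t ≤ c}) (hl : Tendsto lam l atTop)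
    (q : E →⋆ₐ[ℂ] F) (e : ℕ → C) {g : T → C → E} {S : C → unitInterval → E}
    (hg : ∀ c, Continuous fun t => g t c) (hS : ∀ c, Continuous (S c))
    (hgS : ∀ t c, q (g t c) = q (S c 0))
    (hSmul : ∀ a b r, q (S a r * S b r) = q (S (a * b) r))
    (hgmul : ∀ a b, Tendsto (fun t => ‖g t (a * b) - g t a * g t b‖) l (𝓝 0))
    (hgb : ∀ c, ∃ M, ∀ᶠ t in l, ‖g t c‖ ≤ M) :
    ∃ y : T → E, Continuous y ∧ (∀ t, IsSelfAdjoint (y t) ∧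
      spectrum ℝ (y t) ⊆ Set.Icc 0 (lam t) ∧ q (y t) = algebraMap ℝ F (lam t)) ∧
      ∀ a ∈ Set.range e, ∀ b ∈ Set.range e, a * b ∈ Set.range e →
        Tendsto (fun t =>
          ‖tentSum (⌊lam t⌋₊ + 2) (y t) (tentFamily (lam t) (g t a) (S a)) *
            tentSum (⌊lam t⌋₊ + 2) (y t) (tentFamily (lam t) (g t b) (S b)) -
            tentSum (⌊lam t⌋₊ + 2) (y t) (tentFamily (lam t) (g t (a * b)) (S (a * b)))‖)
          l (𝓝 0) := by
  let K : ℕ → Set E := fun n => ⋃ k ∈ Set.Iic n,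
    ((fun t => g t (e k)) '' {t | lam t ≤ n + 1} ∪ Set.range (S (e k)))
  let X : ℕ → Set E := fun n => ⋃ k ∈ Set.Iic n,
    ((fun t => g t (e k) - S (e k) 0) '' {t | lam t ≤ n + 1} ∪
      ⋃ j ∈ Set.Iic n, Set.range fun r => S (e k) r * S (e j) r - S (e k * e j) r)
  have hK : ∀ n, IsCompact (K n) := fun n => (Set.finite_Iic n).isCompact_biUnion fun k _ =>
    ((hcpt _).image (hg _)).union (isCompact_range (hS _))
  have hX : ∀ n, IsCompact (X n) := fun n => (Set.finite_Iic n).isCompact_biUnion fun k _ =>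
    ((hcpt _).image ((hg _).sub continuous_const)).union
      ((Set.finite_Iic n).isCompact_biUnion fun j _ =>
        isCompact_range (((hS _).mul (hS _)).sub (hS _)))
  have hXq : ∀ n, ∀ x ∈ X n, q x = 0 := by
    intro n x hx
    simp only [X, Set.mem_iUnion, Set.mem_union, Set.mem_image, Set.mem_range] at hx
    obtain ⟨k, _, ⟨t, _, rfl⟩ | ⟨j, _, r, rfl⟩⟩ := hx
    · rw [map_sub, hgS, sub_self]
    · rw [map_sub, hSmul, sub_self]
  obtain ⟨y, hy, hyp⟩ := exists_tentCfc_path q hK hX hXq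
    (ε := fun n => 1 / ((n : ℝ) + 2) ^ 3) fun n => by positivity
  refine ⟨fun t => y (lam t), hy.comp hlam, fun t => ?_, ?_⟩
  · obtain ⟨h1, h2, h3, -⟩ := hyp (lam t) (zero_le_one.trans (hlam1 t))
    exact ⟨h1, h2, h3⟩
  rintro _ ⟨ka, rfl⟩ _ ⟨kb, rfl⟩ ⟨kc, hkc⟩
  have hbd : ∀ c, ∃ M, 0 ≤ M ∧ (∀ r, ‖S c r‖ ≤ M) ∧ ∀ᶠ t in l, ‖g t c‖ ≤ M := by
    intro c
    obtain ⟨M₁, hM₁⟩ := hgb c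
    obtain ⟨M₂, hM₂⟩ := isCompact_univ.exists_bound_of_continuousOn (hS c).continuousOn
    refine ⟨max M₁ M₂, ?_, fun r => (hM₂ r trivial).trans (le_max_right _ _), ?_⟩
    · exact (norm_nonneg _).trans ((hM₂ 0 trivial).trans (le_max_right _ _))
    · filter_upwards [hM₁] with t ht using ht.trans (le_max_left _ _)
  obtain ⟨Ra, hRa, hSa, hga⟩ := hbd (e ka)
  obtain ⟨Rb, hRb, hSb, hgb'⟩ := hbd (e kb)
  obtain ⟨Rc, hRc, hSc, hgc⟩ := hbd (e ka * e kb)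
  set R := Ra + Rb + Rc with hRdef
  have hR : 0 ≤ R := by positivity
  rw [Metric.tendsto_nhds]
  intro ε₀ hε₀
  set η := ε₀ / (16 * (R + 1)) with hη
  have hη0 : 0 < η := by positivity
  obtain ⟨d, hd, hdη⟩ := Metric.uniformContinuous_iff.1
    (CompactSpace.uniformContinuous_of_continuous (hS (e kb))) η hη0
  have hfl : Tendsto (fun t => ⌊lam t⌋₊) l atTop := tendsto_nat_floor_atTop.comp hl
  have hsmall : Tendsto (fun t => (2 * R + 2) * ((2 * R + 2) * (1 + R) ^ 2) *
      (1 / ((⌊lam t⌋₊ : ℝ) + 2))) l (𝓝 0) := by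
    have h1 : Tendsto (fun t => (⌊lam t⌋₊ : ℝ) + 2) l atTop :=
      tendsto_atTop_add_const_right _ _ (tendsto_natCast_atTop_atTop.comp hfl)
    simpa using (h1.inv_tendsto_atTop).const_mul ((2 * R + 2) * ((2 * R + 2) * (1 + R) ^ 2))
  filter_upwards [hga, hgb', hgc, hl.eventually_gt_atTop (2 / d), hfl.eventually_ge_atTop ka,
    hfl.eventually_ge_atTop kb, hfl.eventually_ge_atTop kc,
    hsmall.eventually_lt_const (show 0 < ε₀ / 2 by positivity),
    (hgmul (e ka) (e kb)).eventually_le_const (show 0 < ε₀ / 16 by positivity)]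
    with t hga hgb hgc htd hka hkb hkc' hts hgab
  have hpos : 0 < lam t := zero_lt_one.trans_le (hlam1 t)
  obtain ⟨hsa, hsp, -, hpi⟩ := hyp (lam t) hpos.le
  set n := ⌊lam t⌋₊ with hn
  have htn : lam t ≤ n + 1 := (Nat.lt_floor_add_one _).le
  set ε := 1 / ((n : ℝ) + 2) ^ 3 * (1 + R) ^ 2 with hε
  set ρ : ℕ → unitInterval := fun i => Set.projIcc 0 1 zero_le_one (2 * i / lam t) with hρ
  have hρ0 : ρ 0 = 0 := by
    simp [hρ]
  have hfam : ∀ c i, tentFamily (lam t) (g t c) (S c) i = if i = 0 then g t c else S c (ρ i) :=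
    fun c i => rfl
  have hnorm : ∀ c, ‖g t c‖ ≤ R → (∀ r, ‖S c r‖ ≤ R) →
      ∀ i, ‖tentFamily (lam t) (g t c) (S c) i‖ ≤ R := by
    intro c h1 h2 i
    rw [hfam]
    split_ifs
    exacts [h1, h2 _]
  have hmemK : ∀ k ≤ n, ∀ i, tentFamily (lam t) (g t (e k)) (S (e k)) i ∈ K n := by
    intro k hk i
    refine Set.mem_biUnion (Set.mem_Iic.2 hk) ?_
    rw [hfam]
    split_ifs
    exacts [Or.inl ⟨t, htn, rfl⟩, Or.inr ⟨_, rfl⟩]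
  have hcommon : ∀ v : E, ‖v‖ ≤ 2 * R + R ^ 2 → 1 / ((n : ℝ) + 2) ^ 3 * (1 + ‖v‖) ≤ ε := by
    intro v hv
    rw [hε]
    gcongr
    linarith
  have hcommK : ∀ k ≤ n, (∀ i, ‖tentFamily (lam t) (g t (e k)) (S (e k)) i‖ ≤ R) →
      ∀ i < n + 2, ∀ j, ‖tentCfc (y (lam t)) i * tentFamily (lam t) (g t (e k)) (S (e k)) j -
        tentFamily (lam t) (g t (e k)) (S (e k)) j * tentCfc (y (lam t)) i‖ ≤ ε := by
    intro k hk hb i hi j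
    exact ((hpi i (by omega)).1 _ (hmemK k hk j)).trans (hcommon _ (by nlinarith [hb j]))
  have hkill : ∀ k ≤ n, ‖g t (e k)‖ ≤ R → (∀ r, ‖S (e k) r‖ ≤ R) → ∀ i < n + 2, 1 ≤ i → ∀ j,
      ‖tentCfc (y (lam t)) i * (tentFamily (lam t) (g t (e k)) (S (e k)) j - S (e k) (ρ j))‖ ≤ ε ∧
      ‖(tentFamily (lam t) (g t (e k)) (S (e k)) j - S (e k) (ρ j)) * tentCfc (y (lam t)) i‖
        ≤ ε := by
    intro k hk h1 h2 i hi hi1 j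
    rw [hfam]
    split_ifs with hj
    · rw [hj, hρ0]
      have hmem : g t (e k) - S (e k) 0 ∈ X n :=
        Set.mem_biUnion (Set.mem_Iic.2 hk) (Or.inl ⟨t, htn, rfl⟩)
      have hb : ‖g t (e k) - S (e k) 0‖ ≤ 2 * R + R ^ 2 := by
        nlinarith [norm_sub_le (g t (e k)) (S (e k) 0), h2 0]
      have := (hpi i (by omega)).2 hi1 _ hmem
      exact ⟨this.1.trans (hcommon _ hb), this.2.trans (hcommon _ hb)⟩
    · simp only [sub_self, mul_zero, zero_mul, norm_zero, and_self]
      positivity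
  have hga' : ‖g t (e ka)‖ ≤ R := hga.trans (by linarith)
  have hgb' : ‖g t (e kb)‖ ≤ R := hgb.trans (by linarith)
  have hgc' : ‖g t (e kc)‖ ≤ R := by rw [hkc]; exact hgc.trans (by linarith)
  have hSa' : ∀ r, ‖S (e ka) r‖ ≤ R := fun r => (hSa r).trans (by linarith)
  have hSb' : ∀ r, ‖S (e kb) r‖ ≤ R := fun r => (hSb r).trans (by linarith)
  have hSc' : ∀ r, ‖S (e kc) r‖ ≤ R := fun r => by rw [hkc]; exact (hSc r).trans (by linarith)
  have hmain := norm_tentSum_mul_tentSum_sub_le hsa hsp (R := R) (ε := ε) (η := η)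
    (μ := ε₀ / 16) (A := tentFamily (lam t) (g t (e ka)) (S (e ka)))
    (B := tentFamily (lam t) (g t (e kb)) (S (e kb)))
    (C := tentFamily (lam t) (g t (e kc)) (S (e kc)))
    (S := fun i => S (e ka) (ρ i)) (S' := fun i => S (e kb) (ρ i)) (S'' := fun i => S (e kc) (ρ i))
    hR (by positivity) hη0.le (by positivity)
    (hnorm _ hga' hSa') (hnorm _ hgb' hSb') (fun i => hSa' _)
    (hcommK ka hka (hnorm _ hga' hSa')) (hcommK kb hkb (hnorm _ hgb' hSb'))
    (hcommK kc hkc' (hnorm _ hgc' hSc'))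
    (fun i hi h1 j => (hkill ka hka hga' hSa' i hi h1 j).1)
    (fun i hi h1 j => (hkill kb hkb hgb' hSb' i hi h1 j).2)
    (fun i hi h1 j => (hkill kc hkc' hgc' hSc' i hi h1 j).1)
    (fun i hi h1 j => by
      refine ((hpi i (by omega)).2 h1 (S (e ka) (ρ j) * S (e kb) (ρ j) - S (e kc) (ρ j)) ?_).1.trans
        (hcommon _ ?_)
      · refine Set.mem_biUnion (Set.mem_Iic.2 hka) (Or.inr (Set.mem_biUnion (Set.mem_Iic.2 hkb)
          ⟨ρ j, ?_⟩))
        simp only [hkc]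
      · have hm : ‖S (e ka) (ρ j) * S (e kb) (ρ j)‖ ≤ R * R :=
          (norm_mul_le _ _).trans (mul_le_mul (hSa' _) (hSb' _) (norm_nonneg _) hR)
        nlinarith [norm_sub_le (S (e ka) (ρ j) * S (e kb) (ρ j)) (S (e kc) (ρ j)), hSc' (ρ j)])
    (fun i j hij hji => by
      rw [← dist_eq_norm]
      refine (hdη ((dist_projIcc_le hpos hij hji).trans_lt ?_)).le
      rw [div_lt_iff₀ hpos]
      rwa [div_lt_iff₀ hd, mul_comm] at htd)
    (by
      rw [hfam, hfam, hfam, if_pos rfl, if_pos rfl, if_pos rfl, hkc, norm_sub_rev]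
      exact hgab)
  rw [hkc] at hmain
  rw [dist_zero_right, norm_norm]
  refine hmain.trans_lt ?_
  have e1 : (((n + 2 : ℕ) : ℝ)) ^ 2 * ((2 * R + 2) * ((2 * R + 2) * ε)) =
      (2 * R + 2) * ((2 * R + 2) * (1 + R) ^ 2) * (1 / ((n : ℝ) + 2)) := by
    rw [hε]
    push_cast
    field_simp
  have e2 : R * η ≤ ε₀ / 16 := by
    rw [hη, mul_div_assoc', div_le_div_iff₀ (by positivity) (by norm_num)]
    nlinarith
  rw [e1]
  linarith

end Asymptotic

section Dense

variable {C D T : Type*} [NonUnitalCStarAlgebra C] [NonUnitalCStarAlgebra D]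

theorem tendsto_norm_map_mul_sub_of_dense {l : Filter T} {f : T → C → D}
    (hsub : ∀ t a b, f t (a - b) = f t a - f t b) {M : ℝ} (hM : 0 ≤ M)
    (hb : ∀ c, ∀ ε > 0, ∀ᶠ t in l, ‖f t c‖ ≤ M * ‖c‖ + ε) {Δ : Set C} (hΔ : Dense Δ)
    (hmul : ∀ a ∈ Δ, ∀ b ∈ Δ, Tendsto (fun t => ‖f t (a * b) - f t a * f t b‖) l (𝓝 0)) (a b : C) :
    Tendsto (fun t => ‖f t (a * b) - f t a * f t b‖) l (𝓝 0) := by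
  rw [Metric.tendsto_nhds]
  intro ε hε
  set Q := (M * (‖a‖ + ‖b‖ + 1) + 1) + 1 + (M * (‖a‖ + 1) + 1) * (M + 1) +
    (M + 1) * (M * ‖b‖ + 1) with hQ
  have hQ0 : 0 < Q := by positivity
  obtain ⟨d, hd, hd1, hdQ⟩ : ∃ d > 0, d ≤ 1 ∧ d * Q < ε := by
    refine ⟨min 1 (ε / (2 * Q)), by positivity, min_le_left _ _, ?_⟩
    calc min 1 (ε / (2 * Q)) * Q ≤ ε / (2 * Q) * Q := by gcongr; exact min_le_right _ _
      _ = ε / 2 := by field_simp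
      _ < ε := by linarith
  obtain ⟨a', ha', haa⟩ := hΔ.exists_dist_lt a hd
  obtain ⟨b', hb', hbb⟩ := hΔ.exists_dist_lt b hd
  rw [dist_eq_norm] at haa hbb
  have hna : ‖a'‖ ≤ ‖a‖ + 1 := by
    have := norm_sub_norm_le a' a
    rw [norm_sub_rev] at this
    linarith
  have hnb : ‖b'‖ ≤ ‖b‖ + 1 := by
    have := norm_sub_norm_le b' b
    rw [norm_sub_rev] at this
    linarith
  have hab : ‖a * b - a' * b'‖ ≤ d * (‖a‖ + ‖b‖ + 1) := by
    have e : a * b - a' * b' = a * (b - b') + (a - a') * b' := by noncomm_ring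
    rw [e]
    refine (norm_add_le _ _).trans ((add_le_add (norm_mul_le _ _) (norm_mul_le _ _)).trans ?_)
    have h1 : ‖a‖ * ‖b - b'‖ ≤ ‖a‖ * d := by gcongr
    have h2 : ‖a - a'‖ * ‖b'‖ ≤ d * (‖b‖ + 1) := by gcongr
    linarith
  filter_upwards [hb (a * b - a' * b') d hd, hb a' 1 one_pos, hb (b - b') d hd, hb (a - a') d hd,
    hb b 1 one_pos, (hmul a' ha' b' hb').eventually_le_const hd] with t h1 h2 h3 h4 h5 h6
  rw [dist_zero_right, norm_norm]
  have e : f t (a * b) - f t a * f t b = f t (a * b - a' * b') +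
      (f t (a' * b') - f t a' * f t b') - f t a' * f t (b - b') - f t (a - a') * f t b := by
    rw [hsub, hsub, hsub]
    noncomm_ring
  have k1 : ‖f t (a * b - a' * b')‖ ≤ d * (M * (‖a‖ + ‖b‖ + 1) + 1) :=
    h1.trans (by nlinarith [mul_le_mul_of_nonneg_left hab hM])
  have k2 : ‖f t a' * f t (b - b')‖ ≤ (M * (‖a‖ + 1) + 1) * (d * (M + 1)) := by
    refine (norm_mul_le _ _).trans (mul_le_mul (h2.trans ?_) (h3.trans ?_) (norm_nonneg _)
      (by positivity))
    · gcongr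
    · nlinarith [mul_le_mul_of_nonneg_left hbb.le hM]
  have k3 : ‖f t (a - a') * f t b‖ ≤ (d * (M + 1)) * (M * ‖b‖ + 1) := by
    refine (norm_mul_le _ _).trans (mul_le_mul (h4.trans ?_) h5 (norm_nonneg _)
      (by positivity))
    nlinarith [mul_le_mul_of_nonneg_left haa.le hM]
  calc _ ≤ ‖f t (a * b - a' * b')‖ + ‖f t (a' * b') - f t a' * f t b'‖ +
        ‖f t a' * f t (b - b')‖ + ‖f t (a - a') * f t b‖ := by
        rw [e]
        refine (norm_sub_le _ _).trans (add_le_add_left ?_ _)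
        refine (norm_sub_le _ _).trans (add_le_add_left ?_ _)
        exact norm_add_le _ _
    _ ≤ d * Q := by
        rw [hQ]
        linarith
    _ < ε := hdQ

theorem exists_dense_range_mul (C : Type*) [NonUnitalCStarAlgebra C]
    [TopologicalSpace.SeparableSpace C] :
    ∃ (e : ℕ → C) (Δ : Set C), Dense Δ ∧ Δ ⊆ Set.range e ∧
      ∀ a ∈ Δ, ∀ b ∈ Δ, a * b ∈ Set.range e := by
  obtain ⟨Δ, hΔ, hd⟩ := TopologicalSpace.exists_countable_dense C
  have hc : (Δ ∪ Set.image2 (· * ·) Δ Δ).Countable := hΔ.union (hΔ.image2 hΔ _)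
  obtain ⟨e, he⟩ := hc.exists_eq_range (hd.nonempty.mono Set.subset_union_left)
  exact ⟨e, Δ, hd, he ▸ Set.subset_union_left, fun a ha b hb =>
    he ▸ Or.inr (Set.mem_image2_of_mem ha hb)⟩

end Dense

section Lifting

theorem continuous_tentFamily {α T : Type*} [TopologicalSpace α] [TopologicalSpace T] {lam : T → ℝ}
    (hlam : Continuous lam) (hlam0 : ∀ t, lam t ≠ 0) {g : T → α} (hg : Continuous g)
    {S : unitInterval → α} (hS : Continuous S) (i : ℕ) :
    Continuous fun t => tentFamily (lam t) (g t) S i := by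
  unfold tentFamily
  split_ifs
  · exact hg
  · exact hS.comp (continuous_projIcc.comp (continuous_const.div hlam hlam0))

theorem tentFamily_comp {α β : Type*} (f : α → β) (x : ℝ) (g : α) (S : unitInterval → α) (i : ℕ) :
    tentFamily x (f g) (fun r => f (S r)) i = f (tentFamily x g S i) := by
  unfold tentFamily
  split_ifs <;> rfl

theorem tentFamily_eq_one {α : Type*} {x : ℝ} (hx : 1 ≤ x) (g : α) (S : unitInterval → α) {i : ℕ}
    (hi : x < i + 1) : tentFamily x g S i = S 1 := by
  have h0 : 0 < i := by
    have : (0 : ℝ) < i := by linarith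
    exact_mod_cast this
  have h1 : (1 : ℝ) ≤ i := by exact_mod_cast h0
  rw [tentFamily, if_neg h0.ne', Set.projIcc_of_right_le]
  · rfl
  · rw [le_div_iff₀ (by linarith)]
    linarith

variable {B C D Q T : Type*} [NonUnitalCStarAlgebra B] [NonUnitalCStarAlgebra C]
  [NonUnitalCStarAlgebra D] [NonUnitalCStarAlgebra Q] [TopologicalSpace T]

/-- The element of `D` represented by `∑ pᵢ Aᵢ pᵢ`, the compression of a sequence in `D` by the tent
partition of unity of an element of the unitization. -/
def tentSumCompression (N : ℕ) (y : Unitization ℂ D) (A : ℕ → D) : D :=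
  ∑ i ∈ Finset.range N, (star (tentCfc y i) * (A i : Unitization ℂ D) * tentCfc y i).snd

theorem inr_tentSumCompression (N : ℕ) (y : Unitization ℂ D) (A : ℕ → D) :
    ((tentSumCompression N y A : D) : Unitization ℂ D) =
      tentSum N y fun i => (A i : Unitization ℂ D) := by
  refine (map_sum (Unitization.inrNonUnitalAlgHom ℂ D) _ _).trans
    (Finset.sum_congr rfl fun i _ => ?_)
  rw [(isSelfAdjoint_tentCfc y i).star_eq, Unitization.inrNonUnitalAlgHom_toFun]
  ext <;> simp

theorem isCompletelyPositive_tentSumCompression (N : ℕ) (y : Unitization ℂ D) {A : C → ℕ → D}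
    (hA : ∀ i, IsCompletelyPositive fun c => A c i) :
    IsCompletelyPositive fun c => tentSumCompression N y (A c) :=
  IsCompletelyPositive.sum _ fun i _ => (hA i).conj (tentCfc y i)

theorem exists_lift_of_homotopy [TopologicalSpace.SeparableSpace C] {l : Filter T} {lam : T → ℝ}
    (hlam : Continuous lam) (hlam1 : ∀ t, 1 ≤ lam t) (hcpt : ∀ c, IsCompact {t | lam t ≤ c})
    (hl : Tendsto lam l atTop) (q : D →⋆ₙₐ[ℂ] Q) (φ : B →⋆ₙₐ[ℂ] Q) {s : B → D}
    (hs : IsCompletelyPositive s) (hsq : ∀ b, q (s b) = φ b) (H : C →⋆ₙₐ[ℂ] C(unitInterval, B))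
    {G : T → C → D} (hG : ∀ c, Continuous fun t => G t c) (hcp : ∀ t, IsCompletelyPositive (G t))
    (hmul : ∀ a b, Tendsto (fun t => ‖G t (a * b) - G t a * G t b‖) l (𝓝 0))
    (hGq : ∀ t c, q (G t c) = φ (H c 0)) :
    ∃ F : T → C → D, (∀ c, Continuous fun t => F t c) ∧ (∀ t, IsCompletelyPositive (F t)) ∧
      (∀ a b, Tendsto (fun t => ‖F t (a * b) - F t a * F t b‖) l (𝓝 0)) ∧
      (∀ c, ∃ M, ∀ᶠ t in l, ‖F t c‖ ≤ M) ∧ ∀ t c, q (F t c) = φ (H c 1) := by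
  let : PartialOrder (Unitization ℂ D) := CStarAlgebra.spectralOrder _
  let : StarOrderedRing (Unitization ℂ D) := CStarAlgebra.spectralOrderedRing _
  obtain ⟨L, hL0, hL⟩ := hs.exists_bound
  obtain ⟨e, Δ, hΔ, hΔe, hΔm⟩ := exists_dense_range_mul C
  have hsc : Continuous s :=
    AddMonoidHomClass.continuous_of_bound (AddMonoidHom.mk' s hs.1) L hL
  have hGev : ∀ c, ∀ ε > 0, ∀ᶠ t in l, ‖G t c‖ ≤ ‖c‖ + ε := fun c _ hε =>
    eventually_norm_le_of_asymptotically_mul hcp hmul c hε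
  have hqinr : ∀ d : D, Unitization.starMap q (d : Unitization ℂ D) = (q d : Unitization ℂ Q) :=
    fun d => by simp
  obtain ⟨y, hyc, hy, hymul⟩ := exists_tentSum_asymptotically_mul hlam hlam1 hcpt hl
    (Unitization.starMap q) e (g := fun t c => (G t c : Unitization ℂ D))
    (S := fun c r => (s (H c r) : Unitization ℂ D))
    (fun c => Unitization.isometry_inr.continuous.comp (hG c))
    (fun c => Unitization.isometry_inr.continuous.comp (hsc.comp (H c).continuous))
    (fun t c => by rw [hqinr, hqinr, hGq, hsq])
    (fun a b r => by
      simp only [map_mul, hqinr, hsq, ← Unitization.inr_mul, ContinuousMap.mul_apply])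
    (fun a b => by
      simpa only [← Unitization.inr_mul, ← Unitization.inr_sub, Unitization.norm_inr]
        using hmul a b)
    (fun c => ⟨‖c‖ + 1, by simpa only [Unitization.norm_inr] using hGev c 1 one_pos⟩)
  let A : T → C → ℕ → D := fun t c => tentFamily (lam t) (G t c) fun r => s (H c r)
  have hA : ∀ t c, tentFamily (lam t) (G t c : Unitization ℂ D)
      (fun r => (s (H c r) : Unitization ℂ D)) = fun i => ((A t c i : D) : Unitization ℂ D) :=
    fun t c => funext fun i => tentFamily_comp _ _ _ _ _
  simp only [hA, ← inr_tentSumCompression, ← Unitization.inr_mul, ← Unitization.inr_sub,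
    Unitization.norm_inr] at hymul
  have hcpF : ∀ t, IsCompletelyPositive
      fun c => tentSumCompression (⌊lam t⌋₊ + 2) (y t) (A t c) := fun t => by
    refine isCompletelyPositive_tentSumCompression _ _ fun i => ?_
    by_cases hi : i = 0
    · simpa only [A, tentFamily, if_pos hi] using hcp t
    · simp only [A, tentFamily, if_neg hi]
      exact hs.comp_hom ((NonUnitalStarAlgHom.mk (NonUnitalAlgHom.mk
        (DistribMulActionHom.mk ⟨fun f : C(unitInterval, B) => f
          (Set.projIcc 0 1 zero_le_one (2 * i / lam t)), fun _ _ => rfl⟩ rfl fun _ _ => rfl)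
          fun _ _ => rfl) fun _ => rfl).comp H)
  have hnormF : ∀ c, ∀ ε > 0, ∀ᶠ t in l,
      ‖tentSumCompression (⌊lam t⌋₊ + 2) (y t) (A t c)‖ ≤ 4 * (1 + L) * ‖c‖ + ε := fun c ε hε => by
    filter_upwards [hGev c (ε / 4) (by positivity)] with t ht
    rw [← Unitization.norm_inr (𝕜 := ℂ), inr_tentSumCompression]
    refine (norm_tentSum_le (hy t).1 (hy t).2.1 (κ := (1 + L) * ‖c‖ + ε / 4) (by positivity)
      fun i => ?_).trans (by linarith)
    rw [Unitization.norm_inr]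
    simp only [A, tentFamily]
    split_ifs
    · nlinarith [norm_nonneg c]
    · refine (hL _).trans ?_
      have h1 : ‖H c (Set.projIcc 0 1 zero_le_one (2 * i / lam t))‖ ≤ ‖c‖ :=
        ((H c).norm_coe_le_norm _).trans (NonUnitalStarAlgHom.norm_apply_le H c)
      nlinarith [norm_nonneg c]
  have hmulF := tendsto_norm_map_mul_sub_of_dense
    (f := fun t c => tentSumCompression (⌊lam t⌋₊ + 2) (y t) (A t c))
    (fun t => (hcpF t).map_sub) (by positivity) hnormF hΔ
    fun a ha b hb => (hymul a (hΔe ha) b (hΔe hb) (hΔm a ha b hb)).congr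
      fun t => norm_sub_rev _ _
  refine ⟨fun t c => tentSumCompression (⌊lam t⌋₊ + 2) (y t) (A t c), fun c => ?_, hcpF,
    hmulF, fun c => ⟨_, hnormF c 1 one_pos⟩, fun t c => ?_⟩
  · refine Unitization.isometry_inr (𝕜 := ℂ).isEmbedding.continuous_iff.2 ?_
    simp only [Function.comp_def, inr_tentSumCompression]
    exact continuous_tentSum hlam hyc (fun t => (hy t).1) (fun t => (hy t).2.1) fun i =>
      Unitization.isometry_inr.continuous.comp (continuous_tentFamily hlam
        (fun t => by linarith [hlam1 t]) (hG c) (hsc.comp (H c).continuous) i)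
  · apply Unitization.inr_injective (R := ℂ)
    rw [← hqinr, inr_tentSumCompression]
    refine map_tentSum _ (hy t).1 (by linarith [hlam1 t]) (hy t).2.2 fun i hi _ => ?_
    simp only [A]
    rw [tentFamily_eq_one (hlam1 t) _ _ hi, hqinr, hsq]

end Lifting

theorem IsCompletelyPositive.map_linear_combination {A D : Type*} [NonUnitalCStarAlgebra A]
    [NonUnitalCStarAlgebra D] {f : A → D} (hf : IsCompletelyPositive f) (μ₁ μ₂ : ℂ) (a b : A) :
    f (μ₁ • a + μ₂ • b) = μ₁ • f a + μ₂ • f b := by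
  rw [hf.1, hf.2.1, hf.2.1]

end Auxiliary

/-- **cp homotopy lifting.**  Let `q : D → D/I` be the quotient map (modelled as a surjective
∗-homomorphism onto `Q`), `φ : B → D/I` a ∗-homomorphism admitting a completely positive lift
to `D`, and `ψ', ψ'' : C → B` homotopic ∗-homomorphisms.  If `φ∘ψ''` lifts to a cp (discrete)
asymptotic homomorphism `C → D`, then so does `φ∘ψ'`. -/
theorem cp_homotopy_lifting
    {B C D Q : Type*} [NonUnitalCStarAlgebra B] [NonUnitalCStarAlgebra C]
    [NonUnitalCStarAlgebra D] [NonUnitalCStarAlgebra Q]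
    [TopologicalSpace.SeparableSpace B] [TopologicalSpace.SeparableSpace C]
    (q : D →⋆ₙₐ[ℂ] Q) (hq : Function.Surjective q)
    (φ : B →⋆ₙₐ[ℂ] Q) (hφ : ∃ Φ : B → D, IsCompletelyPositive Φ ∧ ∀ b, q (Φ b) = φ b)
    (ψ' ψ'' : C →⋆ₙₐ[ℂ] B) (hhom : AreHomotopic ψ' ψ'') :
    -- continuous version
    ((∃ G : NNReal → C → D, IsAsymptoticHom G ∧ (∀ t, IsCompletelyPositive (G t)) ∧
        ∀ t c, q (G t c) = φ (ψ'' c)) →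
      ∃ G : NNReal → C → D, IsAsymptoticHom G ∧ (∀ t, IsCompletelyPositive (G t)) ∧
        ∀ t c, q (G t c) = φ (ψ' c)) ∧
    -- discrete version
    ((∃ G : ℕ → C → D, IsDiscreteAsymptoticHom G ∧ (∀ n, IsCompletelyPositive (G n)) ∧
        ∀ n c, q (G n c) = φ (ψ'' c)) →
      ∃ G : ℕ → C → D, IsDiscreteAsymptoticHom G ∧ (∀ n, IsCompletelyPositive (G n)) ∧
        ∀ n c, q (G n c) = φ (ψ' c)) := by
  obtain ⟨s, hs, hsq⟩ := hφ
  obtain ⟨H, H0, H1⟩ := hhom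
  constructor
  · rintro ⟨G, ⟨hGc, hGmul, -, -⟩, hGcp, hGq⟩
    have hcpt : ∀ c : ℝ, IsCompact {t : NNReal | (t : ℝ) + 1 ≤ c} := fun c => by
      refine (isCompact_Icc (a := (0 : NNReal)) (b := Real.toNNReal c)).of_isClosed_subset
        (isClosed_le (by fun_prop) (by fun_prop)) fun t ht => ⟨zero_le, ?_⟩
      exact NNReal.le_toNNReal_of_coe_le (by linarith [Set.mem_ofPred.1 ht])
    obtain ⟨F, hFc, hFcp, hFmul, -, hFq⟩ := exists_lift_of_homotopy (l := atTop)
      (lam := fun t : NNReal => (t : ℝ) + 1) (by fun_prop) (fun t => by simp)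
      hcpt (tendsto_atTop_add_const_right _ _ (NNReal.tendsto_coe_atTop.2 tendsto_id)) q φ hs
      hsq H hGc hGcp hGmul (fun t c => by rw [hGq, H0])
    refine ⟨F, ⟨hFc, hFmul, fun μ₁ μ₂ a b => ?_, fun a => ?_⟩, hFcp, fun t c => by rw [hFq, H1]⟩
    · simp [(hFcp _).map_linear_combination]
    · simp [(hFcp _).map_star]
  · rintro ⟨G, ⟨hGmul, -, -, -⟩, hGcp, hGq⟩
    have hcpt : ∀ c : ℝ, IsCompact {n : ℕ | (n : ℝ) + 1 ≤ c} := fun c => by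
      refine ((Set.finite_Iic ⌊c⌋₊).subset fun n hn => ?_).isCompact
      exact Nat.le_floor (by linarith [Set.mem_ofPred.1 hn])
    obtain ⟨F, -, hFcp, hFmul, hFb, hFq⟩ := exists_lift_of_homotopy (l := atTop)
      (lam := fun n : ℕ => (n : ℝ) + 1) continuous_of_discreteTopology (fun t => by simp)
      hcpt (tendsto_atTop_add_const_right _ _ tendsto_natCast_atTop_atTop) q φ hs
      hsq H (fun c => continuous_of_discreteTopology) hGcp hGmul (fun t c => by rw [hGq, H0])
    refine ⟨F, ⟨hFmul, fun μ₁ μ₂ a b => ?_, fun a => ?_, fun a => ?_⟩, hFcp,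
      fun t c => by rw [hFq, H1]⟩
    · simp [(hFcp _).map_linear_combination]
    · simp [(hFcp _).map_star]
    · obtain ⟨M, hM⟩ := hFb a
      obtain ⟨K, hK⟩ := (isBoundedUnder_of_eventually_le hM).bddAbove_range
      exact ⟨K, fun n => hK ⟨n, rfl⟩⟩

end
end
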